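/- For all h, d, m ∈ ℕ with m ≥ 2, the (154 × 154)-grid is not a 3-fat minor of G_{h,d,m}. -/

import Mathlib

open SimpleGraph

namespace CGT

/-- Distance between two vertex sets, as an extended natural number. -/
noncomputable def sDist {V : Type*} (G : SimpleGraph V) (U U' : Set V) : ℕ∞ :=
  ⨅ (u : U) (v : U'), G.edist u.1 v.1

/-- The ball of radius `r` around a vertex set `U`. -/
def gBall {V : Type*} (G : SimpleGraph V) (U : Set V) (r : ℕ) : Set V :=
  {v | ∃ u ∈ U, G.edist u v ≤ (r : ℕ∞)}

/-- A set of vertices is connected if the induced subgraph is connected. -/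
def SetConn {V : Type*} (G : SimpleGraph V) (U : Set V) : Prop :=
  (G.induce U).Connected

/-- The vertex set of a walk. -/
def walkSupp {V : Type*} {G : SimpleGraph V} {a b : V} (p : G.Walk a b) : Set V :=
  {v | v ∈ p.support}

/-- `X` separates `Y` and `Z` in `G`: every path with one end in `Y` and one in `Z`
contains a vertex of `X`. -/
def Separates {V : Type*} (G : SimpleGraph V) (X Y Z : Set V) : Prop :=
  ∀ ⦃y z : V⦄, y ∈ Y → z ∈ Z → ∀ p : G.Walk y z, p.IsPath → ∃ x ∈ X, x ∈ p.support

/-- `f` is an `(M,A)`-quasi-isometry from `G` to `H`.  The two-sided distance bound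
`M⁻¹ d_G(u,v) - A ≤ d_H(f u, f v) ≤ M d_G(u,v) + A` is stated multiplied out over `ℕ∞`. -/
structure IsQI {V V' : Type*} (M A : ℕ) (G : SimpleGraph V) (H : SimpleGraph V')
    (f : V → V') : Prop where
  upper : ∀ u v : V, H.edist (f u) (f v) ≤ (M : ℕ∞) * G.edist u v + (A : ℕ∞)
  lower : ∀ u v : V, G.edist u v ≤ (M : ℕ∞) * H.edist (f u) (f v) + (M : ℕ∞) * (A : ℕ∞)
  dense : ∀ w : V', ∃ v : V, H.edist w (f v) ≤ (A : ℕ∞)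

/-- `G` is `(M,A)`-quasi-isometric to `H`. -/
def QIsometric {V V' : Type*} (M A : ℕ) (G : SimpleGraph V) (H : SimpleGraph V') : Prop :=
  ∃ f : V → V', IsQI M A G H f

/-- `X` is a minor of `G`. -/
def HasMinor {V W : Type*} (G : SimpleGraph V) (X : SimpleGraph W) : Prop :=
  ∃ U : W → Set V,
    (∀ x, (U x).Nonempty) ∧ (∀ x, SetConn G (U x)) ∧
    (∀ ⦃x y⦄, x ≠ y → Disjoint (U x) (U y)) ∧
    ∀ ⦃x y⦄, X.Adj x y → ∃ u ∈ U x, ∃ v ∈ U y, G.Adj u v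

/-- The `(a × b)`-grid graph. -/
def gridGraph (a b : ℕ) : SimpleGraph (Fin a × Fin b) :=
  SimpleGraph.fromRel (fun u v =>
    (u.1 = v.1 ∧ u.2.1 + 1 = v.2.1) ∨ (u.2 = v.2 ∧ u.1.1 + 1 = v.1.1))

/-- A `K`-fat model of `X` in `G`: disjoint connected branch sets joined by internally
disjoint branch paths, all pairwise at distance at least `K` except for a branch path and
the branch sets of its endpoints. -/
structure FatModel {V W : Type*} (G : SimpleGraph V) (X : SimpleGraph W) (K : ℕ) where
  branch : W → Set V
  branch_nonempty : ∀ x, (branch x).Nonempty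
  branch_connected : ∀ x, SetConn G (branch x)
  branch_disjoint : ∀ ⦃x y⦄, x ≠ y → Disjoint (branch x) (branch y)
  pathEnd : ∀ ⦃x y⦄, X.Adj x y → V
  path : ∀ ⦃x y⦄ (e : X.Adj x y), G.Walk (pathEnd e) (pathEnd e.symm)
  path_isPath : ∀ ⦃x y⦄ (e : X.Adj x y), (path e).IsPath
  path_symm : ∀ ⦃x y⦄ (e : X.Adj x y), path e.symm = (path e).reverse
  pathEnd_mem : ∀ ⦃x y⦄ (e : X.Adj x y), pathEnd e ∈ branch x
  path_meets : ∀ ⦃x y⦄ (e : X.Adj x y) (z : W) (v : V), v ∈ (path e).support → v ∈ branch z →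
    (z = x ∧ v = pathEnd e) ∨ (z = y ∧ v = pathEnd e.symm)
  path_int_disjoint : ∀ ⦃x y x' y'⦄ (e : X.Adj x y) (e' : X.Adj x' y'), s(x, y) ≠ s(x', y') →
    ∀ v, v ∈ (path e).support → v ∈ (path e').support → v = pathEnd e' ∨ v = pathEnd e'.symm
  fat_branch : ∀ ⦃x y⦄, x ≠ y → (K : ℕ∞) ≤ sDist G (branch x) (branch y)
  fat_path_branch : ∀ ⦃x y⦄ (e : X.Adj x y) (z : W), z ≠ x → z ≠ y →
    (K : ℕ∞) ≤ sDist G (walkSupp (path e)) (branch z)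
  fat_paths : ∀ ⦃x y x' y'⦄ (e : X.Adj x y) (e' : X.Adj x' y'), s(x, y) ≠ s(x', y') →
    (K : ℕ∞) ≤ sDist G (walkSupp (path e)) (walkSupp (path e'))

/-- `X` is a `K`-fat minor of `G`. -/
def IsFatMinor {V W : Type*} (G : SimpleGraph V) (X : SimpleGraph W) (K : ℕ) : Prop :=
  Nonempty (FatModel G X K)

/-- `W` is a `K`-fat `n`-path-connected set in `G`. -/
def FatPathConn {V : Type*} (G : SimpleGraph V) (K n : ℕ) (W : Set V) : Prop :=
  (∃ S : Finset V, ↑S ⊆ W ∧ 2 * n ≤ S.card) ∧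
  (∀ ⦃u v : V⦄, u ∈ W → v ∈ W → u ≠ v → (K : ℕ∞) ≤ G.edist u v) ∧
  ∀ l : ℕ, l ≤ n → ∀ A B : Finset V, ↑A ⊆ W → ↑B ⊆ W → A.card = l → B.card = l →
    ∃ (a b : Fin l → V) (P : ∀ i : Fin l, G.Walk (a i) (b i)),
      (∀ i, (P i).IsPath) ∧ (∀ i, a i ∈ A ∧ b i ∈ B) ∧
      ∀ i j, i ≠ j → (K : ℕ∞) ≤ sDist G (walkSupp (P i)) (walkSupp (P j))

end CGT

namespace Ghdm

/-- Raw vertex codes for the graphs `G_{h,d,m}`: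
`path k` is the `k`-th vertex of the base path; `tree j i p` is the vertex at position `p`
of the `i`-th binary tree at level `j` (the root being position `[]`); and
`spine j i k t e s` is the `s`-th internal vertex of the spine from the `k`-th leaf of that
tree to the `e`-th element of the `t`-th local gluing set at level `j-1`. -/
inductive Raw : Type where
  | path (k : ℕ)
  | tree (j i : ℕ) (p : List Bool)
  | spine (j i k t e s : ℕ)
deriving DecidableEq

/-- `N = 2^{h+1} - 1`, the number of copies of `G_{h,d,m-1}` glued inside `G_{h,d,m}`. -/
def NN (h : ℕ) : ℕ := 2 ^ (h + 1) - 1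

/-- Canonical representative of a raw vertex code: all tree roots are identified with the
single root `tree m 1 []`, and the leftmost leaf of tree `i > 1` is identified with the
rightmost leaf of tree `i - 1` (consecutive copies are glued along these leaves). -/
def canon (h m : ℕ) : Raw → Raw
  | .tree j i p =>
    if p = [] then .tree m 1 []
    else if p = List.replicate h false ∧ 1 < i then .tree j (i - 1) (List.replicate h true)
    else .tree j i p
  | x => x

/-- The `q`-bit binary representation of `i` (most significant bit first);
`false` means "left". -/
def natToBits (q i : ℕ) : List Bool := (List.range q).map fun a => Nat.testBit i (q - 1 - a)

/-- Position of the `k`-th leaf (1-based, from the left) in a binary tree of height `h`. -/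
def leafPos (h k : ℕ) : List Bool := natToBits h (k - 1)

/-- The `e`-th element of the `g`-th gluing set `V^{jv}_g` (at level `jv`):
its element `e = 1` is an anchor of the base path, and its element `e ≥ 2` is a shared
extreme leaf of the trees at level `e`. -/
def VsetElem (h d jv g e : ℕ) : Raw :=
  if e = 1 then .path ((g - 1) * NN h ^ (jv - 1) * (d + 1))
  else if (g - 1) * NN h ^ (jv - e) = 0 then .tree e 1 (List.replicate h false)
  else .tree e ((g - 1) * NN h ^ (jv - e)) (List.replicate h true)

/-- Valid (canonical) vertex codes of `G_{h,d,m}`. -/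
def Valid (h d m : ℕ) : Raw → Prop
  | .path k => k ≤ (d + 1) * NN h ^ (m - 1)
  | .tree j i p => 2 ≤ j ∧ j ≤ m ∧ 1 ≤ i ∧ i ≤ NN h ^ (m - j) ∧ p.length ≤ h ∧
      (p = [] → j = m ∧ i = 1) ∧ (p = List.replicate h false → p ≠ [] → i = 1)
  | .spine j i k t e s => 2 ≤ j ∧ j ≤ m ∧ 1 ≤ i ∧ i ≤ NN h ^ (m - j) ∧
      1 ≤ k ∧ k ≤ 2 ^ h ∧ (t = 2 * k - 2 ∨ t = 2 * k + 1) ∧ 1 ≤ t ∧ t ≤ 2 ^ (h + 1) ∧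
      1 ≤ e ∧ e ≤ j - 1 ∧ 1 ≤ s ∧ s ≤ d

/-- Generating adjacencies between raw vertex codes: consecutive base path vertices,
parent/child in the binary trees, consecutive spine vertices, a spine and the leaf it
starts at, a spine and the gluing-set vertex it ends at (the latter collapsed to a single
edge when `d = 0`). -/
inductive rawAdj (h d : ℕ) : Raw → Raw → Prop
  | base (k : ℕ) : rawAdj h d (.path k) (.path (k + 1))
  | child (j i : ℕ) (p : List Bool) (b : Bool) : p.length < h →
      rawAdj h d (.tree j i p) (.tree j i (p ++ [b]))
  | step (j i k t e s : ℕ) : rawAdj h d (.spine j i k t e s) (.spine j i k t e (s + 1))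
  | toLeaf (j i k t e : ℕ) : rawAdj h d (.tree j i (leafPos h k)) (.spine j i k t e 1)
  | toV (j i k t e : ℕ) :
      rawAdj h d (.spine j i k t e d) (VsetElem h d (j - 1) ((i - 1) * NN h + t) e)
  | short (j i k t e : ℕ) : d = 0 → 1 ≤ k → k ≤ 2 ^ h → (t = 2 * k - 2 ∨ t = 2 * k + 1) →
      1 ≤ t → t ≤ 2 ^ (h + 1) → 1 ≤ e → e ≤ j - 1 →
      rawAdj h d (.tree j i (leafPos h k)) (VsetElem h d (j - 1) ((i - 1) * NN h + t) e)

/-- Adjacency of canonical representatives. -/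
def rel (h d m : ℕ) (x y : Raw) : Prop :=
  ∃ a b, rawAdj h d a b ∧ x = canon h m a ∧ y = canon h m b

/-- The vertex set of `G_{h,d,m}`. -/
def Verts (h d m : ℕ) : Set Raw := {x | Valid h d m x}

/-- The graph `G_{h,d,m}`. -/
def G (h d m : ℕ) : SimpleGraph (Verts h d m) :=
  (SimpleGraph.fromRel (rel h d m)).induce (Verts h d m)

/-- Lift a set of raw codes to a set of vertices of `G_{h,d,m}`. -/
def lift {h d m : ℕ} (S : Set Raw) : Set (Verts h d m) := Subtype.val ⁻¹' S

/-- The root `R(G_{h,d,m})`. -/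
def RootR (m : ℕ) : Raw := .tree m 1 []

/-- The gluing set `V^{jv}_g` of `G_{h,d,m}`, as a set of raw codes. -/
def VsetRaw (h d m jv g : ℕ) : Set Raw :=
  {x | ∃ e, 1 ≤ e ∧ e ≤ jv ∧ x = canon h m (VsetElem h d jv g e)}

/-- The set `S(G_{h,d,m})`. -/
def SsetR (h d m : ℕ) : Set Raw :=
  VsetRaw h d m (m - 1) 1 ∪ {canon h m (.tree m 1 (leafPos h 1))}

/-- The set `T(G_{h,d,m})`. -/
def TsetR (h d m : ℕ) : Set Raw :=
  VsetRaw h d m (m - 1) (2 ^ (h + 1)) ∪ {canon h m (.tree m 1 (leafPos h (2 ^ h)))}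

/-- For a vertex of the top binary tree at position `p`, the (1-based) index of the
leftmost leaf of the top tree below it. -/
def kOf (h : ℕ) (p : List Bool) : ℕ :=
  (p.foldl (fun a b => 2 * a + if b then 1 else 0) 0) * 2 ^ (h - p.length) + 1

/-- `S(Δ(x))` for the vertex `x` of the top binary tree `B(G_{h,d,m})` at position `p`. -/
def SDeltaR (h d m : ℕ) (p : List Bool) : Set Raw :=
  VsetRaw h d m (m - 1) (2 * kOf h p - 1) ∪ {canon h m (.tree m 1 (leafPos h (kOf h p)))}

/-- The leaf of `B(G_{h,d,m})` immediately to the left of the leftmost leaf below the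
top-tree vertex at position `p`; it is the unique leaf joined by spines to `S(Δ(x))`. -/
def leafLeftR (h m : ℕ) (p : List Bool) : Raw :=
  canon h m (.tree m 1 (leafPos h (kOf h p - 1)))

end Ghdm

namespace Ghdm

section Abs
variable {α : Type*}

def Conn (R : α → α → Prop) (P : Set α) : Prop :=
  ∀ X : Set α, ∀ a b, a ∈ P → a ∈ X → b ∈ P → b ∉ X →
    ∃ u w, u ∈ P ∧ u ∈ X ∧ w ∈ P ∧ w ∉ X ∧ R u w

def Far (R : α → α → Prop) (P Q : Set α) : Prop :=
  ∀ u w, u ∈ P → w ∈ Q → u ≠ w ∧ ¬ R u w ∧ ∀ z, R u z → R z w → False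

theorem Far.symm {R : α → α → Prop} (hR : ∀ u w, R u w → R w u) {P Q : Set α}
    (hf : Far R P Q) : Far R Q P := by
  intro u w hu hw
  obtain ⟨h1, h2, h3⟩ := hf w u hw hu
  exact ⟨fun h => h1 h.symm, fun h => h2 (hR _ _ h), fun z a b => h3 z (hR _ _ b) (hR _ _ a)⟩

theorem Far.mono {R : α → α → Prop} {P Q P' Q' : Set α}
    (hf : Far R P Q) (h1 : P' ⊆ P) (h2 : Q' ⊆ Q) : Far R P' Q' :=
  fun u w hu hw => hf u w (h1 hu) (h2 hw)

/-- the component of `a` in `P ∩ C` -/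
def comp (R : α → α → Prop) (D : Set α) (a : α) : Set α :=
  {x | Relation.ReflTransGen (fun u w => R u w ∧ u ∈ D ∧ w ∈ D) a x}

theorem comp_sub {R : α → α → Prop} {D : Set α} {a : α} (ha : a ∈ D) : comp R D a ⊆ D := by
  intro x hx
  induction hx with
  | refl => exact ha
  | tail _ h _ => exact h.2.2

theorem comp_self {R : α → α → Prop} {D : Set α} {a : α} : a ∈ comp R D a :=
  Relation.ReflTransGen.refl

theorem comp_step {R : α → α → Prop} {D : Set α} {a u w : α} (hu : u ∈ comp R D a)
    (hD : a ∈ D) (hw : w ∈ D) (h : R u w) : w ∈ comp R D a :=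
  Relation.ReflTransGen.tail hu ⟨h, comp_sub hD hu, hw⟩

theorem comp_conn {R : α → α → Prop} (hR : ∀ u w, R u w → R w u) {D : Set α} {a : α}
    (ha : a ∈ D) : Conn R (comp R D a) := by
  intro X p b hp hpX hb hbX
  by_cases haX : a ∈ X
  · by_contra hcon
    push Not at hcon
    have key : ∀ x, x ∈ comp R D a → x ∈ X := by
      intro x hx
      induction hx with
      | refl => exact haX
      | @tail u w h1 h2 ih =>
        by_contra hw
        exact hcon u w h1 ih (comp_step h1 ha h2.2.2 h2.1) hw h2.1
    exact hbX (key b hb)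
  · by_contra hcon
    push Not at hcon
    have key : ∀ x, x ∈ comp R D a → x ∉ X := by
      intro x hx
      induction hx with
      | refl => exact haX
      | @tail u w h1 h2 ih =>
        intro hw
        exact hcon w u (comp_step h1 ha h2.2.2 h2.1) hw h1 ih (hR _ _ h2.1)
    exact key p hp hpX

theorem comp_exit {R : α → α → Prop} (hR : ∀ u w, R u w → R w u) {P : Set α}
    (hP : Conn R P) (C : Set α) {a b : α} (ha : a ∈ P) (haC : a ∈ C) (hb : b ∈ P) (hbC : b ∉ C) :
    ∃ P', P' ⊆ P ∧ P' ⊆ C ∧ Conn R P' ∧ a ∈ P' ∧ ∃ u w, u ∈ P' ∧ w ∈ P ∧ w ∉ C ∧ R u w := by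
  have hD : a ∈ P ∩ C := ⟨ha, haC⟩
  refine ⟨comp R (P ∩ C) a, fun x hx => (comp_sub hD hx).1, fun x hx => (comp_sub hD hx).2,
    comp_conn hR hD, comp_self, ?_⟩
  obtain ⟨u, w, hu, huX, hw, hwX, h⟩ := hP (comp R (P ∩ C) a) a b ha comp_self hb
    (fun hx => hbC (comp_sub hD hx).2)
  refine ⟨u, w, huX, hw, fun hwC => hwX (comp_step huX hD ⟨hw, hwC⟩ h), h⟩

theorem coloring {R : α → α → Prop} (hR : ∀ u w, R u w → R w u) (D S T : Set α)
    (hno : ∀ P', Conn R P' → P' ⊆ D → (∃ s ∈ P', s ∈ S) → (∃ t ∈ P', t ∈ T) → False) :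
    ∃ X : Set α, (∀ x ∈ D, x ∈ S → x ∈ X) ∧ (∀ x ∈ D, x ∈ T → x ∉ X) ∧
      ∀ u w, u ∈ D → w ∈ D → R u w → (u ∈ X ↔ w ∈ X) := by
  refine ⟨{x | ∃ s ∈ D, s ∈ S ∧ x ∈ comp R D s}, fun x hx hS => ⟨x, hx, hS, comp_self⟩, ?_, ?_⟩
  · rintro x hx hT ⟨s, hs, hsS, hxs⟩
    exact hno _ (comp_conn hR hs) (comp_sub hs) ⟨s, comp_self, hsS⟩ ⟨x, hxs, hT⟩
  · intro u w hu hw h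
    constructor
    · rintro ⟨s, hs, hsS, hus⟩
      exact ⟨s, hs, hsS, comp_step hus hs hw h⟩
    · rintro ⟨s, hs, hsS, hus⟩
      exact ⟨s, hs, hsS, comp_step hus hs hu (hR _ _ h)⟩

end Abs

def val (p : List Bool) : ℕ := p.foldl (fun a b => 2 * a + b.toNat) 0

theorem val_append (p : List Bool) (b : Bool) : val (p ++ [b]) = 2 * val p + b.toNat := by
  simp [val, List.foldl_append]

theorem ntb_length (q a : ℕ) : (natToBits q a).length = q := by simp [natToBits]

theorem ntb_succ (q a : ℕ) (b : Bool) :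
    natToBits (q + 1) (2 * a + b.toNat) = natToBits q a ++ [b] := by
  unfold natToBits
  rw [List.range_succ, List.map_append]
  congr 1
  · apply List.map_congr_left
    intro x hx
    rw [List.mem_range] at hx
    have : q + 1 - 1 - x = (q - 1 - x) + 1 := by omega
    rw [this, Nat.testBit_succ]
    congr 1
    cases b <;> simp <;> omega
  · simp
    cases b <;> simp

theorem ntb_val (p : List Bool) : natToBits p.length (val p) = p := by
  induction p using List.reverseRecOn with
  | nil => simp [natToBits]
  | append_singleton p b ih =>
    rw [val_append, List.length_append]
    simp only [List.length_singleton]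
    rw [ntb_succ, ih]

theorem val_lt (p : List Bool) : val p < 2 ^ p.length := by
  induction p using List.reverseRecOn with
  | nil => simp [val]
  | append_singleton p b ih =>
    rw [val_append, List.length_append]
    simp only [List.length_singleton, pow_succ]
    cases b <;> simp <;> omega

theorem val_ntb (q a : ℕ) (ha : a < 2 ^ q) : val (natToBits q a) = a := by
  induction q generalizing a with
  | zero => simp [natToBits, val] at *; omega
  | succ q ih =>
    have hb : ∃ b : Bool, a = 2 * (a / 2) + b.toNat := by
      rcases Nat.even_or_odd' a with ⟨k, hk | hk⟩
      · exact ⟨false, by simp; omega⟩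
      · exact ⟨true, by simp; omega⟩
    obtain ⟨b, hb⟩ := hb
    rw [pow_succ] at ha
    rw [hb, ntb_succ, val_append, ih _ (by omega)]

theorem ntb_zero (q : ℕ) : natToBits q 0 = List.replicate q false := by
  simp [natToBits, List.eq_replicate_iff]

theorem ntb_ones (q : ℕ) : natToBits q (2 ^ q - 1) = List.replicate q true := by
  induction q with
  | zero => simp [natToBits]
  | succ q ih =>
    have : 2 ^ (q + 1) - 1 = 2 * (2 ^ q - 1) + true.toNat := by
      have := Nat.one_le_two_pow (n := q)
      simp [pow_succ]; omega
    rw [this, ntb_succ, ih, List.replicate_succ']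

theorem ntb_inj {q a a' : ℕ} (ha : a < 2 ^ q) (ha' : a' < 2 ^ q)
    (h : natToBits q a = natToBits q a') : a = a' := by
  rw [← val_ntb q a ha, ← val_ntb q a' ha', h]

theorem NN_eq (h : ℕ) : NN h + 1 = 2 * 2 ^ h := by
  have := Nat.one_le_two_pow (n := h)
  unfold NN; rw [pow_succ]; omega

theorem two_le_H {h : ℕ} (hh : 1 ≤ h) : 2 ≤ 2 ^ h := by
  calc 2 = 2 ^ 1 := by norm_num
    _ ≤ 2 ^ h := Nat.pow_le_pow_right (by norm_num) hh

theorem NN_pos (h : ℕ) : 0 < NN h := by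
  have := Nat.one_le_two_pow (n := h)
  have := NN_eq h; omega

/-- length of a level `e` block -/
def cc (h d e : ℕ) : ℕ := NN h ^ (e - 1) * (d + 1)

theorem cc_pos (h d e : ℕ) : 0 < cc h d e := by
  unfold cc; have := NN_pos h; positivity

theorem cc_succ {h d e : ℕ} (he : 2 ≤ e) : cc h d e = NN h * cc h d (e - 1) := by
  unfold cc
  obtain ⟨k, rfl⟩ : ∃ k, e = k + 2 := ⟨e - 2, by omega⟩
  simp [pow_succ]; ring

theorem cc_add {h d f e : ℕ} (hf : 1 ≤ f) (he : f ≤ e) : cc h d e = NN h ^ (e - f) * cc h d f := by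
  unfold cc
  rw [← mul_assoc, ← pow_add]; congr 2; omega

def lam : Raw → ℕ
  | .path _ => 1
  | .tree j _ p => if p = [] then j + 1 else j
  | .spine j _ _ _ _ _ => j

def lo (h d : ℕ) : Raw → ℕ
  | .path k => k
  | .tree j i p => if p = List.replicate h true then i * cc h d j
      else ((i - 1) * NN h + 2 * (val p * 2 ^ (h - p.length))) * cc h d (j - 1)
  | .spine j i k t _ _ => ((i - 1) * NN h + (if t = 2 * k + 1 then 2 * k - 1 else t - 1)) * cc h d (j - 1)

def hi (h d : ℕ) : Raw → ℕ
  | .path k => k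
  | .tree j i p => if p = List.replicate h false then (i - 1) * cc h d j
      else ((i - 1) * NN h + (2 * ((val p + 1) * 2 ^ (h - p.length)) - 1)) * cc h d (j - 1)
  | .spine j i k t _ _ =>
      ((i - 1) * NN h + (if t = 2 * k + 1 then 2 * k - 1 else t - 1) + 1) * cc h d (j - 1)

def side : Raw → Bool
  | .spine _ _ k t _ _ => decide (t = 2 * k + 1)
  | _ => false

def ff : Raw → ℕ
  | .spine _ _ _ _ e _ => e
  | _ => 0

def nd (h m e I q a : ℕ) : Raw := canon h m (.tree e (I + 1) (natToBits q a))

def pt (h d f g : ℕ) : Raw :=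
  if f = 1 then .path (g * (d + 1))
  else if g = 0 then .tree f 1 (List.replicate h false)
  else .tree f g (List.replicate h true)

def sp (e I j : ℕ) (c : Bool) (f s : ℕ) : Raw :=
  .spine e (I + 1) (if c then j + 1 else j + 2) (if c then 2 * j + 3 else 2 * j + 2) f s

theorem vset_eq (h d jv g f : ℕ) : VsetElem h d jv g f = pt h d f ((g - 1) * NN h ^ (jv - f)) := by
  unfold VsetElem pt
  split_ifs with h1 <;> simp_all

theorem rep_ne {h : ℕ} (hh : 1 ≤ h) : List.replicate h true ≠ List.replicate h false := by
  obtain ⟨k, rfl⟩ : ∃ k, h = k + 1 := ⟨h - 1, by omega⟩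
  simp [List.replicate_succ]

theorem rep_ne_nil {h : ℕ} (hh : 1 ≤ h) (b : Bool) : List.replicate h b ≠ [] := by
  obtain ⟨k, rfl⟩ : ∃ k, h = k + 1 := ⟨h - 1, by omega⟩
  simp [List.replicate_succ]

theorem canon_pt {h d m f g : ℕ} (hh : 1 ≤ h) : canon h m (pt h d f g) = pt h d f g := by
  unfold pt
  split_ifs with h1 h2
  · rfl
  · simp [canon, rep_ne_nil hh]
  · simp [canon, rep_ne_nil hh, rep_ne hh]

theorem ntb_ne_nil {q a : ℕ} (hq : 1 ≤ q) : natToBits q a ≠ [] := by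
  intro h
  have := ntb_length q a
  rw [h] at this; simp at this; omega

theorem ntb_eq_false {h q a : ℕ} (ha : a < 2 ^ q) :
    natToBits q a = List.replicate h false ↔ q = h ∧ a = 0 := by
  constructor
  · intro hE
    have h1 : q = h := by
      have := congrArg List.length hE
      simpa [ntb_length] using this
    subst h1
    rw [← ntb_zero] at hE
    exact ⟨rfl, ntb_inj ha (by positivity) hE⟩
  · rintro ⟨rfl, rfl⟩; exact ntb_zero _

theorem ntb_eq_true {h q a : ℕ} (ha : a < 2 ^ q) :
    natToBits q a = List.replicate h true ↔ q = h ∧ a + 1 = 2 ^ h := by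
  constructor
  · intro hE
    have h1 : q = h := by
      have := congrArg List.length hE
      simpa [ntb_length] using this
    subst h1
    rw [← ntb_ones] at hE
    have := ntb_inj ha (by have : 0 < 2 ^ q := by positivity
                           omega) hE
    exact ⟨rfl, by omega⟩
  · rintro ⟨rfl, h2⟩
    rw [← ntb_ones]; congr 1; omega

theorem nd_cases {h m e I q a : ℕ} (hq : 1 ≤ q) (ha : a < 2 ^ q) :
    (q = h ∧ a = 0 ∧ 1 ≤ I ∧ nd h m e I q a = .tree e I (List.replicate h true)) ∨
    (¬ (q = h ∧ a = 0 ∧ 1 ≤ I) ∧ nd h m e I q a = .tree e (I + 1) (natToBits q a)) := by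
  unfold nd canon
  simp only [ntb_ne_nil hq, if_false, ntb_eq_false ha]
  by_cases hc : q = h ∧ a = 0 ∧ 1 ≤ I
  · left
    refine ⟨hc.1, hc.2.1, hc.2.2, ?_⟩
    rw [if_pos ⟨⟨hc.1, hc.2.1⟩, by omega⟩]; simp
  · right
    refine ⟨hc, ?_⟩
    rw [if_neg]
    rintro ⟨⟨h1, h2⟩, h3⟩
    exact hc ⟨h1, h2, by omega⟩

theorem nd_first {h d m e I : ℕ} (hh : 1 ≤ h) (he : 2 ≤ e) :
    nd h m e I h 0 = pt h d e I := by
  rcases nd_cases (h := h) (m := m) (e := e) (I := I) hh (Nat.two_pow_pos h) with ⟨_, _, h1, h2⟩ | ⟨h1, h2⟩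
  · rw [h2, pt, if_neg (by omega), if_neg (by omega)]
  · have : I = 0 := by
      by_contra hI
      exact h1 ⟨rfl, rfl, by omega⟩
    subst this
    rw [h2, pt, if_neg (by omega), if_pos rfl, ntb_zero]

theorem nd_last {h d m e I : ℕ} (hh : 1 ≤ h) (he : 2 ≤ e) :
    nd h m e I h (2 ^ h - 1) = pt h d e (I + 1) := by
  have := two_le_H hh
  rcases nd_cases (h := h) (m := m) (e := e) (I := I) (a := 2 ^ h - 1) hh (by omega) with ⟨_, h0, h1, h2⟩ | ⟨h1, h2⟩
  · omega
  · rw [h2, pt, if_neg (by omega), if_neg (by omega), ntb_ones]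

theorem lam_nd {h m e I q a : ℕ} (hh : 1 ≤ h) (hq : 1 ≤ q) (ha : a < 2 ^ q) :
    lam (nd h m e I q a) = e := by
  rcases nd_cases (h := h) (m := m) (e := e) (I := I) hq ha with ⟨_, _, _, h2⟩ | ⟨_, h2⟩ <;> rw [h2]
  · simp [lam, rep_ne_nil hh]
  · simp [lam, ntb_ne_nil hq]

theorem val_true (h : ℕ) : val (List.replicate h true) = 2 ^ h - 1 := by
  rw [← ntb_ones, val_ntb]
  have : 0 < 2 ^ h := by positivity
  omega

theorem lo_nd {h d m e I q a : ℕ} (hh : 1 ≤ h) (hq : 1 ≤ q) (ha : a < 2 ^ q) (he : 2 ≤ e) :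
    lo h d (nd h m e I q a) = if q = h ∧ a + 1 = 2 ^ h then (I * NN h + NN h) * cc h d (e - 1)
      else (I * NN h + 2 * (a * 2 ^ (h - q))) * cc h d (e - 1) := by
  have := two_le_H hh
  rcases nd_cases (h := h) (m := m) (e := e) (I := I) hq ha with ⟨h0, h1, h3, h2⟩ | ⟨_, h2⟩ <;> rw [h2]
  · subst h0 h1
    rw [if_neg (by omega)]
    simp only [lo, if_true]
    rw [cc_succ he]; simp; ring
  · simp only [lo, ntb_eq_true ha]
    split_ifs with hc
    · rw [cc_succ he]; ring
    · rw [val_ntb q a ha, ntb_length]; simp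

theorem hi_nd {h d m e I q a : ℕ} (hh : 1 ≤ h) (hq : 1 ≤ q) (ha : a < 2 ^ q) (he : 2 ≤ e) :
    hi h d (nd h m e I q a) = if q = h ∧ a = 0 then (I * NN h) * cc h d (e - 1)
      else (I * NN h + (2 * ((a + 1) * 2 ^ (h - q)) - 1)) * cc h d (e - 1) := by
  have := two_le_H hh
  rcases nd_cases (h := h) (m := m) (e := e) (I := I) hq ha with ⟨h0, h1, h3, h2⟩ | ⟨_, h2⟩ <;> rw [h2]
  · subst h0 h1
    rw [if_pos (by omega)]
    simp only [hi, if_neg (rep_ne hh), val_true, List.length_replicate]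
    congr 1
    obtain ⟨J, rfl⟩ : ∃ J, I = J + 1 := ⟨I - 1, by omega⟩
    have := NN_eq q
    simp
    rw [add_mul]
    have : 2 ^ q - 1 + 1 = 2 ^ q := by omega
    rw [this]; omega
  · simp only [hi, ntb_eq_false ha]
    split_ifs with hc
    · rw [cc_succ he]; simp; ring
    · rw [val_ntb q a ha, ntb_length]; simp

theorem lam_pt {h d f g : ℕ} (hh : 1 ≤ h) : lam (pt h d f g) = f := by
  unfold pt; split_ifs <;> simp_all [lam, rep_ne_nil hh]

theorem lo_pt {h d f g : ℕ} (hh : 1 ≤ h) (hf : 1 ≤ f) : lo h d (pt h d f g) = g * cc h d f := by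
  by_cases h1 : f = 1
  · subst h1; simp [pt, lo, cc]
  · by_cases h2 : g = 0
    · subst h2
      simp [pt, h1, lo, (rep_ne hh).symm]
      left; rw [← ntb_zero]; exact val_ntb h 0 (Nat.two_pow_pos h)
    · simp [pt, h1, h2, lo]

theorem hi_pt {h d f g : ℕ} (hh : 1 ≤ h) (hf : 1 ≤ f) : hi h d (pt h d f g) = g * cc h d f := by
  by_cases h1 : f = 1
  · subst h1; simp [pt, hi, cc]
  · by_cases h2 : g = 0
    · subst h2
      simp [pt, h1, hi]
    · have hH := two_le_H hh
      have := NN_eq h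
      simp only [pt, h1, h2, hi, if_false, rep_ne hh, val_true, List.length_replicate]
      rw [cc_succ (by omega : 2 ≤ f), ← mul_assoc g]
      congr 1
      obtain ⟨J, rfl⟩ : ∃ J, g = J + 1 := ⟨g - 1, by omega⟩
      have : 2 ^ h - 1 + 1 = 2 ^ h := by omega
      rw [this, add_mul, Nat.sub_self, pow_zero, Nat.add_sub_cancel]; omega

theorem sp_lam {e I j f s : ℕ} {c : Bool} : lam (sp e I j c f s) = e := rfl
theorem sp_ff {e I j f s : ℕ} {c : Bool} : ff (sp e I j c f s) = f := rfl
theorem sp_side {e I j f s : ℕ} {c : Bool} : side (sp e I j c f s) = c := by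
  cases c <;> simp [sp, side] <;> omega
theorem sp_lo {h d e I j f s : ℕ} {c : Bool} :
    lo h d (sp e I j c f s) = (I * NN h + (2 * j + 1)) * cc h d (e - 1) := by
  cases c
  · simp only [sp, lo, Bool.false_eq_true, if_false]
    rw [if_neg (by omega)]; simp
  · simp only [sp, lo, if_true]
    rw [if_pos (by omega)]; congr 2
theorem sp_hi {h d e I j f s : ℕ} {c : Bool} :
    hi h d (sp e I j c f s) = (I * NN h + (2 * j + 2)) * cc h d (e - 1) := by
  cases c
  · simp only [sp, hi, Bool.false_eq_true, if_false]
    rw [if_neg (by omega)]; simp; left; omega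
  · simp only [sp, hi, if_true]
    rw [if_pos (by omega)]; congr 1
theorem nd_ff {h m e I q a : ℕ} (hq : 1 ≤ q) (ha : a < 2 ^ q) : ff (nd h m e I q a) = 0 := by
  rcases nd_cases (h := h) (m := m) (e := e) (I := I) hq ha with ⟨_, _, _, h2⟩ | ⟨_, h2⟩ <;> rw [h2] <;> rfl
theorem pt_ff {h d f g : ℕ} : ff (pt h d f g) = 0 := by
  unfold pt; split_ifs <;> rfl

/-- adjacency -/
def RR (h d m : ℕ) (u w : Raw) : Prop :=
  Valid h d m u ∧ Valid h d m w ∧ u ≠ w ∧ (rel h d m u w ∨ rel h d m w u)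

theorem RR_symm {h d m : ℕ} : ∀ u w, RR h d m u w → RR h d m w u :=
  fun _ _ ⟨a, b, c, d⟩ => ⟨b, a, fun h => c h.symm, d.symm⟩

/-- leaf of a star -/
def sleaf (h m e I j : ℕ) (c : Bool) : Raw := nd h m e I h (j + (!c).toNat)
/-- foot of a star -/
def sfoot (h d e I j : ℕ) (c : Bool) (f : ℕ) : Raw :=
  pt h d f ((I * NN h + (2 * j + 1 + c.toNat)) * NN h ^ (e - 1 - f))

structure SOK (h m e I j f : ℕ) : Prop where
  e2 : 2 ≤ e
  em : e ≤ m
  hI : I < NN h ^ (m - e)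
  hj : j + 1 < 2 ^ h
  f1 : 1 ≤ f
  fe : f < e

inductive Edge (h d m : ℕ) : Raw → Raw → Prop
  | base (k : ℕ) : Edge h d m (.path k) (.path (k + 1))
  | tr (e I q a : ℕ) (b : Bool) : 2 ≤ e → e ≤ m → I < NN h ^ (m - e) → 1 ≤ q → q < h → a < 2 ^ q →
      Edge h d m (nd h m e I q a) (nd h m e I (q + 1) (2 * a + b.toNat))
  | step (e I j : ℕ) (c : Bool) (f s : ℕ) : SOK h m e I j f → 1 ≤ s → s + 1 ≤ d →
      Edge h d m (sp e I j c f s) (sp e I j c f (s + 1))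
  | leaf (e I j : ℕ) (c : Bool) (f : ℕ) : SOK h m e I j f → 1 ≤ d →
      Edge h d m (sleaf h m e I j c) (sp e I j c f 1)
  | foot (e I j : ℕ) (c : Bool) (f : ℕ) : SOK h m e I j f → 1 ≤ d →
      Edge h d m (sp e I j c f d) (sfoot h d e I j c f)
  | short (e I j : ℕ) (c : Bool) (f : ℕ) : SOK h m e I j f → d = 0 →
      Edge h d m (sleaf h m e I j c) (sfoot h d e I j c f)

theorem valid_spine {h d m e i k t f s : ℕ} (hv : Valid h d m (.spine e i k t f s)) :
    ∃ I j, ∃ c : Bool, i = I + 1 ∧ k = (if c then j + 1 else j + 2) ∧ t = (if c then 2 * j + 3 else 2 * j + 2) ∧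
      SOK h m e I j f ∧ 1 ≤ s ∧ s ≤ d := by
  obtain ⟨h1, h2, h3, h4, h5, h6, h7, h8, h9, h10, h11, h12, h13⟩ := hv
  rw [pow_succ] at h9
  rcases h7 with h7 | h7
  · refine ⟨i - 1, k - 2, false, by omega, by simp; omega, by simp; omega, ⟨h1, h2, by omega, by omega, h10, by omega⟩, h12, h13⟩
  · refine ⟨i - 1, k - 1, true, by omega, by simp; omega, by simp; omega, ⟨h1, h2, by omega, by omega, h10, by omega⟩, h12, h13⟩

theorem vset_foot {h d e I j f : ℕ} {c : Bool} :
    VsetElem h d (e - 1) ((I + 1 - 1) * NN h + (if c then 2 * j + 3 else 2 * j + 2)) f =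
      sfoot h d e I j c f := by
  rw [vset_eq, sfoot]; congr 2
  cases c <;> simp

theorem leaf_sleaf {h m e I j : ℕ} {c : Bool} :
    canon h m (.tree e (I + 1) (leafPos h (if c then j + 1 else j + 2))) = sleaf h m e I j c := by
  unfold sleaf nd leafPos
  congr 3
  cases c <;> simp

theorem valid_pt {h d m f g : ℕ} (hh : 1 ≤ h) (hf : 1 ≤ f) (hfm : f ≤ m)
    (hv : Valid h d m (pt h d f g)) : g ≤ NN h ^ (m - f) := by
  unfold pt at hv
  split_ifs at hv with h1 h2
  · subst h1
    simp only [Valid] at hv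
    rw [mul_comm] at hv
    exact Nat.le_of_mul_le_mul_left hv (by omega)
  · omega
  · exact hv.2.2.2.1

theorem rel_edge {h d m : ℕ} (hh : 1 ≤ h) {u w : Raw} (hu : Valid h d m u) (hw : Valid h d m w)
    (hur : u ≠ RootR m) (hr : rel h d m u w) : Edge h d m u w := by
  obtain ⟨a, b, hab, rfl, rfl⟩ := hr
  have hH := two_le_H hh
  cases hab with
  | base k => exact Edge.base k
  | child j i p b hp =>
    have hp0 : p ≠ [] := by
      rintro rfl; exact hur (by simp [canon, RootR])
    have hpf : p ≠ List.replicate h false := by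
      rintro rfl; simp at hp
    have e1 : canon h m (.tree j i p) = .tree j i p := by simp [canon, hp0, hpf]
    have hu' := hu
    rw [e1] at hu'
    obtain ⟨h1, h2, h3, h4, h5, h6, h7⟩ := hu'
    have hpl : 1 ≤ p.length := List.length_pos_iff.mpr hp0
    have := Edge.tr (h := h) (d := d) (m := m) j (i - 1) p.length (val p) b h1 h2 (by omega) hpl hp (val_lt p)
    unfold nd at this
    rw [ntb_succ, ntb_val, Nat.sub_add_cancel h3] at this
    exact this
  | step e i k t f s =>
    have hu' : Valid h d m (.spine e i k t f s) := hu
    have hw' : Valid h d m (.spine e i k t f (s + 1)) := hw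
    obtain ⟨I, j, c, rfl, rfl, rfl, h4, h5, h6⟩ := valid_spine hu'
    obtain ⟨_, _, _, _, _, _, _, _, _, _, _, _, h13⟩ := hw'
    exact Edge.step e I j c f s h4 h5 h13
  | toLeaf e i k t f =>
    have hw' : Valid h d m (.spine e i k t f 1) := hw
    obtain ⟨I, j, c, rfl, rfl, rfl, h4, h5, h6⟩ := valid_spine hw'
    rw [leaf_sleaf]
    exact Edge.leaf e I j c f h4 h6
  | toV e i k t f =>
    have hu' : Valid h d m (.spine e i k t f d) := hu
    obtain ⟨I, j, c, rfl, rfl, rfl, h4, h5, h6⟩ := valid_spine hu'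
    rw [vset_foot, sfoot, canon_pt hh]
    exact Edge.foot e I j c f h4 h5
  | short e i k t f hd hk1 hk2 ht ht1 ht2 hf1 hf2 =>
    have hlp : leafPos h k ≠ [] := ntb_ne_nil hh
    have hi1 : 1 ≤ i := by
      by_contra hi
      have : canon h m (.tree e i (leafPos h k)) = .tree e i (leafPos h k) := by
        have : ¬ (1 < i) := by omega
        simp [canon, hlp, this]
      rw [this] at hu
      have := hu.2.2.1
      omega
    have hem : e ≤ m := by
      have : ∃ i' p, canon h m (.tree e i (leafPos h k)) = .tree e i' p := by
        simp only [canon, if_neg hlp]; split_ifs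
        · exact ⟨_, _, rfl⟩
        · exact ⟨_, _, rfl⟩
      obtain ⟨i', p, hE⟩ := this
      rw [hE] at hu; exact hu.2.1
    obtain ⟨I, rfl⟩ : ∃ I, i = I + 1 := ⟨i - 1, by omega⟩
    rw [pow_succ] at ht2
    obtain ⟨j, c, rfl, rfl, hj⟩ : ∃ j, ∃ c : Bool, k = (if c then j + 1 else j + 2) ∧
        t = (if c then 2 * j + 3 else 2 * j + 2) ∧ j + 1 < 2 ^ h := by
      rcases ht with ht | ht
      · exact ⟨k - 2, false, by simp; omega, by simp; omega, by omega⟩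
      · exact ⟨k - 1, true, by simp; omega, by simp; omega, by omega⟩
    rw [vset_foot, sfoot, canon_pt hh] at hw
    rw [vset_foot, sfoot, canon_pt hh, leaf_sleaf]
    have hg := valid_pt hh hf1 (by omega) hw
    have hI : I < NN h ^ (m - e) := by
      by_contra hcon
      push Not at hcon
      have hp : 0 < NN h ^ (e - 1 - f) := pow_pos (NN_pos h) _
      have : NN h ^ (m - f) = NN h ^ (m - e) * NN h * NN h ^ (e - 1 - f) := by
        rw [← pow_succ, ← pow_add]; congr 1; omega
      rw [this] at hg
      have hg := Nat.le_of_mul_le_mul_right hg hp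
      have := Nat.mul_le_mul_right (NN h) hcon
      omega
    exact Edge.short e I j c f ⟨by omega, hem, hI, hj, hf1, by omega⟩ hd

theorem RR_edge {h d m : ℕ} (hh : 1 ≤ h) {u w : Raw} (hr : RR h d m u w)
    (hu : u ≠ RootR m) (hw : w ≠ RootR m) : Edge h d m u w ∨ Edge h d m w u := by
  obtain ⟨h1, h2, _, h3 | h3⟩ := hr
  · exact Or.inl (rel_edge hh h1 h2 hu h3)
  · exact Or.inr (rel_edge hh h2 h1 hw h3)

theorem valid_nd {h d m e I q a : ℕ} (hh : 1 ≤ h) (hq : 1 ≤ q) (hqh : q ≤ h) (ha : a < 2 ^ q)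
    (he : 2 ≤ e) (hem : e ≤ m) (hI : I < NN h ^ (m - e)) : Valid h d m (nd h m e I q a) := by
  rcases nd_cases (h := h) (m := m) (e := e) (I := I) hq ha with ⟨h0, h1, h3, h2⟩ | ⟨h1, h2⟩ <;> rw [h2]
  · refine ⟨he, hem, h3, by omega, by simp, fun hc => absurd hc (rep_ne_nil hh _), fun hc => absurd hc (rep_ne hh)⟩
  · refine ⟨he, hem, by omega, by omega, by rw [ntb_length]; exact hqh, fun hc => absurd hc (ntb_ne_nil hq), fun hc _ => ?_⟩
    rw [ntb_eq_false ha] at hc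
    by_contra hcon
    exact h1 ⟨hc.1, hc.2, by omega⟩

theorem nd_root {h m e I a : ℕ} : nd h m e I 0 a = RootR m := by
  simp [nd, natToBits, canon, RootR]

theorem lam_root {m : ℕ} : lam (RootR m) = m + 1 := rfl

theorem RR_tree {h d m e I q a : ℕ} {b : Bool} (hh : 1 ≤ h) (hqh : q < h) (ha : a < 2 ^ q)
    (he : 2 ≤ e) (hem : e ≤ m) (hI : I < NN h ^ (m - e)) :
    RR h d m (nd h m e I q a) (nd h m e I (q + 1) (2 * a + b.toNat)) := by
  have ha' : 2 * a + b.toNat < 2 ^ (q + 1) := by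
    rw [pow_succ]; cases b <;> simp <;> omega
  have hv : Valid h d m (nd h m e I (q + 1) (2 * a + b.toNat)) :=
    valid_nd hh (by omega) (by omega) ha' he hem hI
  have hr : rel h d m (nd h m e I q a) (nd h m e I (q + 1) (2 * a + b.toNat)) := by
    refine ⟨_, _, rawAdj.child e (I + 1) (natToBits q a) b (by rw [ntb_length]; exact hqh), rfl, ?_⟩
    rw [← ntb_succ]; rfl
  rcases Nat.eq_zero_or_pos q with rfl | hq
  · refine ⟨?_, hv, ?_, Or.inl hr⟩
    · rw [nd_root]
      refine ⟨by omega, le_rfl, le_rfl, by simp, by simp, fun _ => ⟨rfl, rfl⟩, fun _ h => absurd rfl h⟩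
    · intro hE
      have := congrArg lam hE
      rw [nd_root, lam_root, lam_nd hh (by omega) ha'] at this
      omega
  · refine ⟨valid_nd hh hq (by omega) ha he hem hI, hv, ?_, Or.inl hr⟩
    rcases nd_cases (h := h) (m := m) (e := e) (I := I) hq ha with ⟨h0, _⟩ | ⟨h1, h2⟩
    · omega
    · rw [h2]
      rcases nd_cases (h := h) (m := m) (e := e) (I := I) (by omega : 1 ≤ q + 1) ha' with ⟨h0, h4, h5, h6⟩ | ⟨h5, h6⟩
      · rw [h6]; intro hE; injection hE; omega
      · rw [h6]; intro hE; injection hE with _ _ hE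
        have := congrArg List.length hE
        simp [ntb_length] at this

end Ghdm
namespace Ghdm

def OnStar (h d m e I j : ℕ) (c : Bool) (f : ℕ) (x : Raw) : Prop :=
  x = sleaf h m e I j c ∨ (∃ s, 1 ≤ s ∧ s ≤ d ∧ x = sp e I j c f s) ∨ x = sfoot h d e I j c f

theorem Edge.three {h d m : ℕ} {u w : Raw} (hE : Edge h d m u w) :
    (∃ k, u = .path k ∧ w = .path (k + 1)) ∨
    (∃ e I q a, ∃ b : Bool, 2 ≤ e ∧ e ≤ m ∧ I < NN h ^ (m - e) ∧ 1 ≤ q ∧ q < h ∧ a < 2 ^ q ∧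
      u = nd h m e I q a ∧ w = nd h m e I (q + 1) (2 * a + b.toNat)) ∨
    (∃ e I j c f, SOK h m e I j f ∧ OnStar h d m e I j c f u ∧ OnStar h d m e I j c f w) := by
  cases hE with
  | base k => exact Or.inl ⟨k, rfl, rfl⟩
  | tr e I q a b h1 h2 h3 h4 h5 h6 =>
    exact Or.inr (Or.inl ⟨e, I, q, a, b, h1, h2, h3, h4, h5, h6, rfl, rfl⟩)
  | step e I j c f s h1 h2 h3 =>
    exact Or.inr (Or.inr ⟨e, I, j, c, f, h1, Or.inr (Or.inl ⟨s, h2, by omega, rfl⟩),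
      Or.inr (Or.inl ⟨s + 1, by omega, by omega, rfl⟩)⟩)
  | leaf e I j c f h1 h2 =>
    exact Or.inr (Or.inr ⟨e, I, j, c, f, h1, Or.inl rfl, Or.inr (Or.inl ⟨1, le_rfl, h2, rfl⟩)⟩)
  | foot e I j c f h1 h2 =>
    exact Or.inr (Or.inr ⟨e, I, j, c, f, h1, Or.inr (Or.inl ⟨d, h2, le_rfl, rfl⟩), Or.inr (Or.inr rfl)⟩)
  | short e I j c f h1 h2 =>
    exact Or.inr (Or.inr ⟨e, I, j, c, f, h1, Or.inl rfl, Or.inr (Or.inr rfl)⟩)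

theorem sfoot_lam {h d e I j f : ℕ} {c : Bool} (hh : 1 ≤ h) : lam (sfoot h d e I j c f) = f :=
  lam_pt hh

theorem sfoot_lo {h d m e I j f : ℕ} {c : Bool} (hh : 1 ≤ h) (hs : SOK h m e I j f) :
    lo h d (sfoot h d e I j c f) = (I * NN h + (2 * j + 1 + c.toNat)) * cc h d (e - 1) := by
  have := hs.f1; have := hs.fe
  rw [sfoot, lo_pt hh hs.f1, cc_add hs.f1 (by omega : f ≤ e - 1), mul_assoc]

theorem sfoot_hi {h d m e I j f : ℕ} {c : Bool} (hh : 1 ≤ h) (hs : SOK h m e I j f) :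
    hi h d (sfoot h d e I j c f) = (I * NN h + (2 * j + 1 + c.toNat)) * cc h d (e - 1) := by
  have := hs.f1; have := hs.fe
  rw [sfoot, hi_pt hh hs.f1, cc_add hs.f1 (by omega : f ≤ e - 1), mul_assoc]

theorem leaf_lt {h m e I j f : ℕ} {c : Bool} (hs : SOK h m e I j f) : j + (!c).toNat < 2 ^ h := by
  have := hs.hj; cases c <;> simp <;> omega

theorem sleaf_lam {h m e I j f : ℕ} {c : Bool} (hh : 1 ≤ h) (hs : SOK h m e I j f) :
    lam (sleaf h m e I j c) = e :=
  lam_nd hh hh (leaf_lt hs)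

/-- coordinates of a tree node in natural units -/
theorem nd_coord {h m e I q a : ℕ} (d : ℕ) (hh : 1 ≤ h) (hq : 1 ≤ q) (hqh : q ≤ h) (ha : a < 2 ^ q)
    (he : 2 ≤ e) :
    ∃ x y D, D = 2 ^ (h - q) ∧ 1 ≤ D ∧ (a + 1) * 2 ^ (h - q) = a * D + D ∧ a * D + D ≤ 2 ^ h ∧
      lo h d (nd h m e I q a) = (I * NN h + x) * cc h d (e - 1) ∧
      hi h d (nd h m e I q a) = (I * NN h + y) * cc h d (e - 1) ∧
      ((x = 2 * (a * D) ∧ y + 1 = 2 * (a * D + D)) ∨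
       (q = h ∧ D = 1 ∧ a = 0 ∧ a * D = 0 ∧ x = 0 ∧ y = 0) ∨
       (q = h ∧ D = 1 ∧ a + 1 = 2 ^ h ∧ a * D + 1 = 2 ^ h ∧ x = NN h ∧ y = NN h)) := by
  have hH := two_le_H hh
  have hN := NN_eq h
  have hD : 1 ≤ 2 ^ (h - q) := Nat.one_le_two_pow
  have hle : (a + 1) * 2 ^ (h - q) ≤ 2 ^ h := by
    calc (a + 1) * 2 ^ (h - q) ≤ 2 ^ q * 2 ^ (h - q) := Nat.mul_le_mul_right _ ha
      _ = 2 ^ h := by rw [← pow_add]; congr 1; omega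
  have e1 : (a + 1) * 2 ^ (h - q) = a * 2 ^ (h - q) + 2 ^ (h - q) := by ring
  rw [e1] at hle
  refine ⟨if q = h ∧ a + 1 = 2 ^ h then NN h else 2 * (a * 2 ^ (h - q)),
    if q = h ∧ a = 0 then 0 else 2 * (a * 2 ^ (h - q) + 2 ^ (h - q)) - 1, _, rfl, hD, e1, hle, ?_, ?_, ?_⟩
  · rw [lo_nd hh hq ha he]; split_ifs <;> rfl
  · rw [hi_nd hh hq ha he, e1]; split_ifs <;> rfl
  · by_cases h1 : q = h ∧ a + 1 = 2 ^ h
    · right; right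
      obtain ⟨rfl, h1⟩ := h1
      simp only [Nat.sub_self, pow_zero, mul_one, h1, and_self, if_true, true_and]
      rw [if_neg (by omega)]; omega
    · by_cases h2 : q = h ∧ a = 0
      · right; left
        obtain ⟨rfl, rfl⟩ := h2
        rw [if_neg h1]
        simp
      · left
        rw [if_neg h1, if_neg h2]
        omega

theorem sleaf_coord {h m e I j f : ℕ} {c : Bool} (d : ℕ) (hh : 1 ≤ h) (hs : SOK h m e I j f) :
    ∃ x y, lo h d (sleaf h m e I j c) = (I * NN h + x) * cc h d (e - 1) ∧
      hi h d (sleaf h m e I j c) = (I * NN h + y) * cc h d (e - 1) ∧ x ≤ y ∧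
      ((c = true ∧ x = 2 * j ∧ y ≤ 2 * j + 1) ∨ (c = false ∧ y = 2 * j + 3 ∧ 2 * j + 2 ≤ x)) := by
  obtain ⟨x, y, D, hD, h1, h2, h3, h4, h5, h6⟩ := nd_coord d hh hh le_rfl (leaf_lt (c := c) hs) hs.e2
    (h := h) (m := m) (I := I)
  refine ⟨x, y, h4, h5, ?_⟩
  have := hs.hj
  have hN := NN_eq h
  have hH := two_le_H hh
  simp at hD
  subst hD
  cases c <;> simp at * <;> omega

theorem cmp {N u I I' x y : ℕ} (hu : 0 < u) (hle : (I * N + x) * u ≤ (I' * N + y) * u) :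
    I * N + x ≤ I' * N + y := Nat.le_of_mul_le_mul_right hle hu

theorem uncmp {N u I I' x y : ℕ} (hle : I * N + x ≤ I' * N + y) :
    (I * N + x) * u ≤ (I' * N + y) * u := Nat.mul_le_mul_right _ hle

theorem cmp_lt {N u I I' x y : ℕ} (hle : (I * N + x) * u < (I' * N + y) * u) :
    I * N + x < I' * N + y := Nat.lt_of_mul_lt_mul_right hle

theorem uncmp_lt {N u I I' x y : ℕ} (hu : 0 < u) (hle : I * N + x < I' * N + y) :
    (I * N + x) * u < (I' * N + y) * u := Nat.mul_lt_mul_of_pos_right hle hu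

theorem mulstep {N I I' : ℕ} (hI : I < I') : I * N + N ≤ I' * N := by
  calc I * N + N = (I + 1) * N := by ring
    _ ≤ I' * N := Nat.mul_le_mul_right _ hI

/-- star members: coordinates -/
theorem star_coord {h d m e I j f : ℕ} {c : Bool} {x : Raw} (hh : 1 ≤ h) (hs : SOK h m e I j f)
    (hx : OnStar h d m e I j c f x) :
    ∃ p q, lo h d x = (I * NN h + p) * cc h d (e - 1) ∧ hi h d x = (I * NN h + q) * cc h d (e - 1) ∧
      p ≤ q ∧
      ((x = sleaf h m e I j c ∧ lam x = e ∧
          ((c = true ∧ p = 2 * j ∧ q ≤ 2 * j + 1) ∨ (c = false ∧ q = 2 * j + 3 ∧ 2 * j + 2 ≤ p))) ∨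
       (ff x = f ∧ side x = c ∧ lam x = e ∧ p = 2 * j + 1 ∧ q = 2 * j + 2) ∨
       (x = sfoot h d e I j c f ∧ lam x = f ∧ p = 2 * j + 1 + c.toNat ∧ q = 2 * j + 1 + c.toNat)) := by
  rcases hx with rfl | ⟨s, _, _, rfl⟩ | rfl
  · obtain ⟨p, q, h1, h2, h3, h4⟩ := sleaf_coord d hh hs (c := c)
    exact ⟨p, q, h1, h2, h3, Or.inl ⟨rfl, sleaf_lam hh hs, h4⟩⟩
  · exact ⟨_, _, sp_lo, sp_hi, by omega, Or.inr (Or.inl ⟨sp_ff, sp_side, sp_lam, rfl, rfl⟩)⟩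
  · exact ⟨_, _, sfoot_lo hh hs, sfoot_hi hh hs, le_rfl, Or.inr (Or.inr ⟨rfl, sfoot_lam hh, rfl, rfl⟩)⟩

theorem block_lift {h d e0 e' g0 : ℕ} (h0 : 1 ≤ e0) (he : e0 ≤ e') :
    ∃ g, g * cc h d e' ≤ g0 * cc h d e0 ∧ (g0 + 1) * cc h d e0 ≤ (g + 1) * cc h d e' := by
  have hp : 0 < NN h ^ (e' - e0) := pow_pos (NN_pos h) _
  refine ⟨g0 / NN h ^ (e' - e0), ?_, ?_⟩
  · rw [cc_add h0 he, ← mul_assoc]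
    exact Nat.mul_le_mul_right _ (Nat.div_mul_le_self _ _)
  · rw [cc_add h0 he, ← mul_assoc]
    apply Nat.mul_le_mul_right
    have := Nat.lt_div_mul_add hp (a := g0)
    rw [add_mul, one_mul]; omega

def InBlk (h d e g : ℕ) (u : Raw) : Prop := g * cc h d e ≤ lo h d u ∧ hi h d u ≤ (g + 1) * cc h d e

theorem edge_block {h d m : ℕ} (hh : 1 ≤ h) {u w : Raw} (hE : Edge h d m u w) {e' : ℕ}
    (hu : lam u ≤ e') (hw : lam w ≤ e') : ∃ g, InBlk h d e' g u ∧ InBlk h d e' g w := by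
  have hH := two_le_H hh
  have hN := NN_eq h
  suffices hs : ∃ e0 g0, 1 ≤ e0 ∧ e0 ≤ e' ∧ InBlk h d e0 g0 u ∧ InBlk h d e0 g0 w by
    obtain ⟨e0, g0, h1, h2, h3, h4⟩ := hs
    obtain ⟨g, h5, h6⟩ := block_lift (h := h) (d := d) (g0 := g0) h1 h2
    exact ⟨g, ⟨h5.trans h3.1, h3.2.trans h6⟩, ⟨h5.trans h4.1, h4.2.trans h6⟩⟩
  have blk : ∀ e I : ℕ, ∀ x : Raw, ∀ p q : ℕ, 2 ≤ e → lo h d x = (I * NN h + p) * cc h d (e - 1) →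
      hi h d x = (I * NN h + q) * cc h d (e - 1) → q ≤ NN h → InBlk h d e I x := by
    intro e I x p q he h1 h2 h3
    unfold InBlk
    rw [h1, h2, cc_succ he]
    constructor
    · rw [← mul_assoc]; apply Nat.mul_le_mul_right; omega
    · rw [← mul_assoc]; apply Nat.mul_le_mul_right; rw [add_mul]; omega
  rcases hE.three with ⟨k, rfl, rfl⟩ | ⟨e, I, q, a, b, h1, h2, h3, h4, h5, h6, rfl, rfl⟩ |
    ⟨e, I, j, c, f, hs, hx, hy⟩
  · refine ⟨1, k / (d + 1), le_rfl, hu, ?_⟩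
    have h1 := Nat.div_mul_le_self k (d + 1)
    have h2 := Nat.lt_div_mul_add (Nat.succ_pos d) (a := k)
    simp only [InBlk, lo, hi, cc, Nat.sub_self, pow_zero, one_mul, add_mul]
    simp only [Nat.succ_eq_add_one] at h2
    omega
  · have ha' : 2 * a + b.toNat < 2 ^ (q + 1) := by
      rw [pow_succ]; cases b <;> simp <;> omega
    rw [lam_nd hh h4 h6] at hu
    obtain ⟨x, y, D, _, _, _, k1, k2, k3, k4⟩ := nd_coord d hh h4 h5.le h6 h1 (m := m) (I := I)
    obtain ⟨x', y', D', _, _, _, l1, l2, l3, l4⟩ := nd_coord d hh (by omega) h5 ha' h1 (m := m) (I := I)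
    refine ⟨e, I, by omega, hu, blk e I _ _ _ h1 k2 k3 ?_, blk e I _ _ _ h1 l2 l3 ?_⟩ <;> omega
  · have hj := hs.hj
    obtain ⟨p, q, k1, k2, k3, k4⟩ := star_coord hh hs hx
    obtain ⟨p', q', l1, l2, l3, l4⟩ := star_coord hh hs hy
    have hq : q ≤ NN h := by
      rcases k4 with k4 | k4 | ⟨_, _, _, k4⟩
      · omega
      · omega
      · cases c <;> simp at k4 <;> omega
    have hq' : q' ≤ NN h := by
      rcases l4 with k4 | k4 | ⟨_, _, _, k4⟩
      · omega
      · omega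
      · cases c <;> simp at k4 <;> omega
    by_cases hle : e ≤ e'
    · exact ⟨e, I, by have := hs.e2; omega, hle, blk e I _ _ _ hs.e2 k1 k2 hq, blk e I _ _ _ hs.e2 l1 l2 hq'⟩
    · have hu2 : u = sfoot h d e I j c f := by
        rcases k4 with k4 | k4 | k4
        · omega
        · omega
        · exact k4.1
      have hw2 : w = sfoot h d e I j c f := by
        rcases l4 with k4 | k4 | k4
        · omega
        · omega
        · exact k4.1
      subst hu2; subst hw2
      rw [sfoot_lam hh] at hu
      refine ⟨f, (I * NN h + (2 * j + 1 + c.toNat)) * NN h ^ (e - 1 - f), hs.f1, hu, ⟨?_, ?_⟩, ⟨?_, ?_⟩⟩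
      all_goals simp only [sfoot, lo_pt hh hs.f1, hi_pt hh hs.f1]
      all_goals exact Nat.mul_le_mul_right _ (by omega)

theorem pt_unique {h d m : ℕ} (hh : 1 ≤ h) {u : Raw} (hv : Valid h d m u) {e g : ℕ} (he : 1 ≤ e) (hem : e ≤ m)
    (hl : lam u = e) (h1 : lo h d u = g * cc h d e) (h2 : hi h d u = g * cc h d e) : u = pt h d e g := by
  have hc := cc_pos h d e
  have hc1 := cc_pos h d (e - 1)
  cases u with
  | path k => 
    simp only [lam] at hl
    subst hl
    simp [pt]
    simpa [lo, cc] using h1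
  | tree j i p =>
    obtain ⟨v1, v2, v3, v4, v5, v6, v7⟩ := hv
    have hp : p ≠ [] := by
      rintro rfl
      have := (v6 rfl).1
      simp [lam] at hl
      omega
    have : j = e := by simpa [lam, hp] using hl
    subst this
    by_cases ht : p = List.replicate h true
    · subst ht
      simp only [lo, if_true] at h1
      have := Nat.eq_of_mul_eq_mul_right hc h1
      subst this
      rw [pt, if_neg (by omega), if_neg (by omega)]
    · by_cases hf : p = List.replicate h false
      · have := v7 hf hp
        subst this
        subst hf
        simp only [hi, if_true] at h2
        have := Nat.eq_of_mul_eq_mul_right hc h2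
        rw [pt, if_neg (by omega), if_pos (by omega)]
      · simp only [lo, hi, if_neg ht, if_neg hf] at h1 h2
        have := Nat.eq_of_mul_eq_mul_right hc1 (h1.trans h2.symm)
        have : 1 ≤ 2 ^ (h - p.length) := Nat.one_le_two_pow
        rw [add_mul] at *
        omega
  | spine j i k t f s =>
    simp only [lam] at hl
    subst hl
    simp only [lo, hi] at h1 h2
    have := Nat.eq_of_mul_eq_mul_right hc1 (h1.trans h2.symm)
    omega

def Box (h d m e α β : ℕ) : Set Raw := {w | Valid h d m w ∧ lam w ≤ e ∧ α ≤ lo h d w ∧ hi h d w ≤ β}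

def lA (h d e I A : ℕ) : ℕ := (I * NN h + 2 * A) * cc h d (e - 1)
def lB (h d e I B : ℕ) : ℕ := (I * NN h + (2 * B - 1)) * cc h d (e - 1)

/-- the region above leaves `A, …, B-1` of the `I`-th tree of level `e` -/
def Cl (h d m e I A B : ℕ) : Set Raw := Box h d m e (lA h d e I A) (lB h d e I B)

def SS (h d m e I A : ℕ) : Set Raw :=
  {u | (lam u < e ∧ lo h d u = lA h d e I A ∧ hi h d u = lA h d e I A) ∨ u = nd h m e I h A}
def TT (h d m e I B : ℕ) : Set Raw :=
  {u | (lam u < e ∧ lo h d u = lB h d e I B ∧ hi h d u = lB h d e I B) ∨ u = nd h m e I h (B - 1)}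

theorem nd_in_cl {h d m e I A B I' q a : ℕ} (hh : 1 ≤ h) (he : 2 ≤ e) (hAB : A < B) (hB : B ≤ 2 ^ h)
    (hq : 1 ≤ q) (hqh : q ≤ h) (ha : a < 2 ^ q) (hu : nd h m e I' q a ∈ Cl h d m e I A B) :
    (I' = I ∧ A ≤ a * 2 ^ (h - q) ∧ (a + 1) * 2 ^ (h - q) ≤ B) ∨
    (q = h ∧ a = 0 ∧ I' = I + 1 ∧ B = 2 ^ h) ∨ (q = h ∧ a + 1 = 2 ^ h ∧ I = I' + 1 ∧ A = 0) := by
  have hH := two_le_H hh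
  have hN := NN_eq h
  obtain ⟨_, _, h1, h2⟩ := hu
  obtain ⟨x, y, D, hD, k1, k2, k3, k4, k5, k6⟩ := nd_coord d hh hq hqh ha he (m := m) (I := I')
  rw [k4, lA] at h1
  rw [k5, lB] at h2
  have h1 := cmp (cc_pos _ _ _) h1
  have h2 := cmp (cc_pos _ _ _) h2
  rw [k2, ← hD]
  rcases lt_trichotomy I I' with hI | hI | hI
  · have := mulstep (N := NN h) hI
    have h4 : I' = I + 1 ∨ I + 1 < I' := by omega
    rcases h4 with h4 | h4
    · subst h4
      rw [add_mul] at *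
      omega
    · have := mulstep (N := NN h) h4
      rw [add_mul] at *
      omega
  · subst hI; omega
  · have := mulstep (N := NN h) hI
    have h4 : I = I' + 1 ∨ I' + 1 < I := by omega
    rcases h4 with h4 | h4
    · subst h4
      rw [add_mul] at *
      omega
    · have := mulstep (N := NN h) h4
      rw [add_mul] at *
      omega

theorem nd_mem_cl {h d m e I A B q a : ℕ} (hh : 1 ≤ h) (he : 2 ≤ e)
    (hv : Valid h d m (nd h m e I q a)) (hB : B ≤ 2 ^ h)
    (hq : 1 ≤ q) (hqh : q ≤ h) (ha : a < 2 ^ q) (h1 : A ≤ a * 2 ^ (h - q)) (h2 : (a + 1) * 2 ^ (h - q) ≤ B) :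
    nd h m e I q a ∈ Cl h d m e I A B := by
  have hH := two_le_H hh
  have hN := NN_eq h
  obtain ⟨x, y, D, hD, k1, k2, k3, k4, k5, k6⟩ := nd_coord d hh hq hqh ha he (m := m) (I := I)
  rw [k2] at h2
  rw [← hD] at h1
  refine ⟨hv, (lam_nd hh hq ha).le, ?_, ?_⟩
  · rw [k4, lA]; apply uncmp; omega
  · rw [k5, lB]; apply uncmp; omega

end Ghdm
namespace Ghdm

theorem valid_cases {h d m : ℕ} {u : Raw} (hv : Valid h d m u) (hu : u ≠ RootR m) :
    (∃ k, u = .path k ∧ k ≤ (d + 1) * NN h ^ (m - 1)) ∨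
    (∃ e I q a, 2 ≤ e ∧ e ≤ m ∧ I < NN h ^ (m - e) ∧ 1 ≤ q ∧ q ≤ h ∧ a < 2 ^ q ∧ u = nd h m e I q a) ∨
    (∃ e I j c f s, SOK h m e I j f ∧ 1 ≤ s ∧ s ≤ d ∧ u = sp e I j c f s) := by
  cases u with
  | path k => exact Or.inl ⟨k, rfl, hv⟩
  | tree j i p =>
    obtain ⟨v1, v2, v3, v4, v5, v6, v7⟩ := hv
    have hp : p ≠ [] := by
      rintro rfl
      obtain ⟨rfl, rfl⟩ := v6 rfl
      exact hu rfl
    refine Or.inr (Or.inl ⟨j, i - 1, p.length, val p, v1, v2, by omega, List.length_pos_iff.mpr hp, v5, val_lt p, ?_⟩)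
    unfold nd
    rw [ntb_val, Nat.sub_add_cancel v3, canon, if_neg hp, if_neg]
    rintro ⟨h1, h2⟩
    have := v7 h1 hp
    omega
  | spine e i k t f s =>
    obtain ⟨I, j, c, rfl, rfl, rfl, h4, h5, h6⟩ := valid_spine hv
    exact Or.inr (Or.inr ⟨e, I, j, c, f, s, h4, h5, h6, rfl⟩)

theorem lo_le_hi {h d m : ℕ} (hh : 1 ≤ h) {u : Raw} (hv : Valid h d m u) (hu : u ≠ RootR m) :
    lo h d u ≤ hi h d u := by
  rcases valid_cases hv hu with ⟨k, rfl, _⟩ | ⟨e, I, q, a, h1, h2, h3, h4, h5, h6, rfl⟩ | ⟨e, I, j, c, f, s, _, _, _, rfl⟩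
  · exact le_rfl
  · obtain ⟨x, y, D, hD, k1, k2, k3, k4, k5, k6⟩ := nd_coord d hh h4 h5 h6 h1 (m := m) (I := I)
    rw [k4, k5]; apply uncmp; omega
  · rw [sp_lo, sp_hi]; apply uncmp; omega

theorem ne_root {m : ℕ} {u : Raw} (hu : lam u ≤ m) : u ≠ RootR m := by
  rintro rfl; rw [lam_root] at hu; omega

theorem lam_le {h d m : ℕ} {u : Raw} (hh : 1 ≤ h) (hm : 1 ≤ m) (hv : Valid h d m u) (hu : u ≠ RootR m) : lam u ≤ m := by
  rcases valid_cases hv hu with ⟨k, rfl, _⟩ | ⟨e, I, q, a, h1, h2, h3, h4, h5, h6, rfl⟩ | ⟨e, I, j, c, f, s, hs, _, _, rfl⟩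
  · exact hm
  · rw [lam_nd hh h4 h6]; exact h2
  · exact hs.em

theorem one_le_lam {h d m : ℕ} {u : Raw} (hv : Valid h d m u) : 1 ≤ lam u := by
  cases u with
  | path k => exact le_rfl
  | tree j i p => have := hv.1; simp only [lam]; split_ifs <;> omega
  | spine e i k t f s => have := hv.1; simp only [lam]; omega

theorem blk_RR {h d m : ℕ} (hh : 1 ≤ h) {u w : Raw} (hR : RR h d m u w) {e' : ℕ} (hem : e' ≤ m)
    (hu : lam u ≤ e') (hw : lam w ≤ e') : ∃ g, InBlk h d e' g u ∧ InBlk h d e' g w := by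
  rcases RR_edge hh hR (ne_root (hu.trans hem)) (ne_root (hw.trans hem)) with h1 | h1
  · exact edge_block hh h1 hu hw
  · obtain ⟨g, h2, h3⟩ := edge_block hh h1 hw hu
    exact ⟨g, h3, h2⟩

/-- symmetric form of the classification -/
theorem RR_three {h d m : ℕ} (hh : 1 ≤ h) {u w : Raw} (hR : RR h d m u w)
    (hu : u ≠ RootR m) (hw : w ≠ RootR m) :
    (lam u = 1 ∧ lam w = 1) ∨
    (∃ e I q a, ∃ b : Bool, 2 ≤ e ∧ e ≤ m ∧ I < NN h ^ (m - e) ∧ 1 ≤ q ∧ q < h ∧ a < 2 ^ q ∧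
      ((u = nd h m e I q a ∧ w = nd h m e I (q + 1) (2 * a + b.toNat)) ∨
       (w = nd h m e I q a ∧ u = nd h m e I (q + 1) (2 * a + b.toNat)))) ∨
    (∃ e I j c f, SOK h m e I j f ∧ OnStar h d m e I j c f u ∧ OnStar h d m e I j c f w) := by
  rcases RR_edge hh hR hu hw with h1 | h1
  · rcases h1.three with ⟨k, rfl, rfl⟩ | ⟨e, I, q, a, b, h1, h2, h3, h4, h5, h6, h7⟩ | h
    · exact Or.inl ⟨rfl, rfl⟩
    · exact Or.inr (Or.inl ⟨e, I, q, a, b, h1, h2, h3, h4, h5, h6, Or.inl h7⟩)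
    · exact Or.inr (Or.inr h)
  · rcases h1.three with ⟨k, rfl, rfl⟩ | ⟨e, I, q, a, b, h1, h2, h3, h4, h5, h6, h7⟩ | ⟨e, I, j, c, f, hs, h1, h2⟩
    · exact Or.inl ⟨rfl, rfl⟩
    · exact Or.inr (Or.inl ⟨e, I, q, a, b, h1, h2, h3, h4, h5, h6, Or.inr h7⟩)
    · exact Or.inr (Or.inr ⟨e, I, j, c, f, hs, h2, h1⟩)

theorem child_lt {q a : ℕ} (b : Bool) (ha : a < 2 ^ q) : 2 * a + b.toNat < 2 ^ (q + 1) := by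
  rw [pow_succ]; cases b <;> simp <;> omega

theorem child_pow {h q : ℕ} (hq : q < h) : 2 ^ (h - q) = 2 * 2 ^ (h - (q + 1)) := by
  rw [← pow_succ']; congr 1; omega

theorem child_rng {h q a : ℕ} (b : Bool) (hq : q < h) :
    a * 2 ^ (h - q) ≤ (2 * a + b.toNat) * 2 ^ (h - (q + 1)) ∧
    (2 * a + b.toNat + 1) * 2 ^ (h - (q + 1)) ≤ (a + 1) * 2 ^ (h - q) := by
  rw [child_pow hq]
  cases b <;> simp <;> constructor <;> nlinarith [Nat.zero_le (2 ^ (h - (q + 1)))]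

/-- low-level exit from a box whose ends are multiples of the block length -/
theorem low_exit {h d m : ℕ} (hh : 1 ≤ h) {e' X Y : ℕ} (hem : e' ≤ m) {u w : Raw} (hR : RR h d m u w)
    (hu : lam u ≤ e') (hw : lam w ≤ e') (h1 : X * cc h d e' ≤ lo h d u) (h2 : hi h d u ≤ Y * cc h d e')
    (h3 : lo h d w < X * cc h d e' ∨ Y * cc h d e' < hi h d w) :
    (lo h d u = X * cc h d e' ∧ hi h d u = X * cc h d e' ∧ lo h d w < X * cc h d e') ∨
    (lo h d u = Y * cc h d e' ∧ hi h d u = Y * cc h d e' ∧ Y * cc h d e' < hi h d w) := by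
  obtain ⟨g, ⟨b1, b2⟩, ⟨b3, b4⟩⟩ := blk_RR hh hR hem hu hw
  have hlh := lo_le_hi hh hR.1 (ne_root (hu.trans hem))
  rcases h3 with h3 | h3
  · left
    have : g * cc h d e' < X * cc h d e' := lt_of_le_of_lt b3 h3
    have := Nat.lt_of_mul_lt_mul_right this
    have : (g + 1) * cc h d e' ≤ X * cc h d e' := Nat.mul_le_mul_right _ this
    omega
  · right
    have : Y * cc h d e' < (g + 1) * cc h d e' := lt_of_lt_of_le h3 b4
    have := Nat.lt_of_mul_lt_mul_right this
    have : Y * cc h d e' ≤ g * cc h d e' := Nat.mul_le_mul_right _ (by omega)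
    omega

theorem foot_mult {h d m e e' I j f : ℕ} {c : Bool} (hh : 1 ≤ h) (hs : SOK h m e' I j f) (he : 1 ≤ e) (hee : e < e') (hf : f ≤ e) :
    ∃ G, lo h d (sfoot h d e' I j c f) = G * cc h d e ∧ hi h d (sfoot h d e' I j c f) = G * cc h d e := by
  refine ⟨(I * NN h + (2 * j + 1 + c.toNat)) * NN h ^ (e' - 1 - e), ?_, ?_⟩
  · rw [sfoot_lo hh hs, cc_add he (by omega : e ≤ e' - 1), mul_assoc]
  · rw [sfoot_hi hh hs, cc_add he (by omega : e ≤ e' - 1), mul_assoc]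

theorem exit_cl {h d m : ℕ} (hh : 1 ≤ h) {e I A B : ℕ} (he : 2 ≤ e) (hem : e ≤ m) (hAB : A < B)
    (hB : B ≤ 2 ^ h) {u w : Raw} (hu : u ∈ Cl h d m e I A B) (hw : w ∉ Cl h d m e I A B)
    (hR : RR h d m u w) (hwr : w ≠ RootR m) :
    (u ∈ SS h d m e I A ∧ (lo h d w < lA h d e I A ∨ e < lam w)) ∨
    (u ∈ TT h d m e I B ∧ (lB h d e I B < hi h d w ∨ e < lam w)) ∨
    (∃ q a, ∃ b : Bool, 1 ≤ q ∧ q < h ∧ a < 2 ^ q ∧ u = nd h m e I (q + 1) (2 * a + b.toNat) ∧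
      w = nd h m e I q a ∧ A ≤ (2 * a + b.toNat) * 2 ^ (h - (q + 1)) ∧
      (2 * a + b.toNat + 1) * 2 ^ (h - (q + 1)) ≤ B ∧
      ¬ (A ≤ a * 2 ^ (h - q) ∧ (a + 1) * 2 ^ (h - q) ≤ B)) := by
  have hu' := hu
  obtain ⟨uv, ul, u1, u2⟩ := hu
  have hur := ne_root (ul.trans hem)
  have hH := two_le_H hh
  have hN := NN_eq h
  have hc := cc_pos h d (e - 1)
  have hw' : lam w ≤ e → lo h d w < lA h d e I A ∨ lB h d e I B < hi h d w := by
    intro hl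
    by_contra hcon
    push Not at hcon
    exact hw ⟨hR.2.1, hl, hcon⟩
  by_cases hlow : lam u < e ∧ lam w < e
  · rcases low_exit hh (e' := e - 1) (by omega) hR (by omega) (by omega) u1 u2 (hw' hlow.2.le) with h1 | h1
    · exact Or.inl ⟨Or.inl ⟨hlow.1, h1.1, h1.2.1⟩, Or.inl h1.2.2⟩
    · exact Or.inr (Or.inl ⟨Or.inl ⟨hlow.1, h1.1, h1.2.1⟩, Or.inl h1.2.2⟩)
  rcases RR_three hh hR hur hwr with ⟨h1, h2⟩ | ⟨e', I', q, a, b, h1, h2, h3, h4, h5, h6, h7⟩ | ⟨e', I', j, c, f, hs, hx, hy⟩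
  · omega
  · have ha' := child_lt b h6
    have hrng := child_rng (a := a) b h5
    have l1 := lam_nd (m := m) (e := e') (I := I') hh h4 h6
    have l2 := lam_nd (m := m) (e := e') (I := I') hh (by omega) ha'
    have hee : e' = e := by
      rcases h7 with ⟨rfl, rfl⟩ | ⟨rfl, rfl⟩ <;> omega
    subst hee
    rcases h7 with ⟨rfl, rfl⟩ | ⟨rfl, rfl⟩
    · exfalso
      rcases nd_in_cl hh he hAB hB h4 h5.le h6 hu' with ⟨rfl, k2, k3⟩ | k | k
      · exact hw (nd_mem_cl hh he hR.2.1 hB (by omega) h5 ha' (k2.trans hrng.1) (hrng.2.trans k3))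
      · omega
      · omega
    · obtain ⟨x, y, D, hD, k1, k2, k3, k4, k5, k6⟩ := nd_coord d hh h4 h5.le h6 he (m := m) (I := I')
      rcases nd_in_cl hh he hAB hB (by omega) h5 ha' hu' with ⟨rfl, k2, k3⟩ | ⟨t1, t2, rfl, t4⟩ | ⟨t1, t2, rfl, t4⟩
      · right; right
        refine ⟨q, a, b, h4, h5, h6, rfl, rfl, k2, k3, ?_⟩
        rintro ⟨s1, s2⟩
        exact hw (nd_mem_cl hh he hR.2.1 hB h4 h5.le h6 s1 s2)
      · right; left
        refine ⟨Or.inr ?_, Or.inl ?_⟩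
        · rw [show q + 1 = h from t1, t2, t4, nd_first (d := d) hh he, nd_last (d := d) hh he]
        · rw [k5, lB]; apply uncmp_lt hc; rw [add_mul]; omega
      · left
        refine ⟨Or.inr ?_, Or.inl ?_⟩
        · have : 2 * a + b.toNat = 2 ^ h - 1 := by omega
          rw [show q + 1 = h from t1, this, t4, nd_first (d := d) hh he, nd_last (d := d) hh he]
        · rw [k4, lA]; apply uncmp_lt hc; rw [add_mul]; omega
  · have hj := hs.hj
    have hfe := hs.fe
    obtain ⟨p, q, k1, k2, k3, k4⟩ := star_coord hh hs hx
    obtain ⟨p', q', l1, l2, l3, l4⟩ := star_coord hh hs hy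
    rcases lt_trichotomy e' e with hee | hee | hee
    · exfalso; omega
    · subst hee
      have hwl : lam w ≤ e' := by omega
      have hw2 := hw' hwl
      rw [k1, lA] at u1
      rw [k2, lB] at u2
      have u1 := cmp hc u1
      have u2 := cmp hc u2
      have hct : c.toNat = 0 ∨ c.toNat = 1 := by cases c <;> simp
      by_cases hII : I' = I
      · subst hII
        have hw3 : p' < 2 * A ∨ 2 * B - 1 < q' := by
          rcases hw2 with hw2 | hw2
          · left; rw [l1, lA] at hw2; have := cmp_lt hw2; omega
          · right; rw [l2, lB] at hw2; have := cmp_lt hw2; omega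
        rcases k4 with ⟨v1, v2, v3⟩ | ⟨v1, v2, v3, v4, v5⟩ | ⟨v1, v2, v3, v4⟩
        · rcases v3 with ⟨rfl, v3, v4⟩ | ⟨rfl, v3, v4⟩
          · right; left
            simp at l4
            have : j + 1 = B := by omega
            refine ⟨Or.inr ?_, Or.inl ?_⟩
            · rw [v1, sleaf, ← this]; simp
            · rw [l2, lB]; apply uncmp_lt hc
              have := hR.2.2.1
              rcases l4 with l4 | l4 | l4
              · exact absurd (v1.trans l4.1.symm) this
              · omega
              · omega
          · left
            simp at l4
            have : j + 1 = A := by omega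
            refine ⟨Or.inr ?_, Or.inl ?_⟩
            · rw [v1, sleaf, ← this]; simp
            · rw [l1, lA]; apply uncmp_lt hc
              have := hR.2.2.1
              rcases l4 with l4 | l4 | l4
              · exact absurd (v1.trans l4.1.symm) this
              · omega
              · omega
        · exfalso
          have hct : (c = true ∧ c.toNat = 1) ∨ (c = false ∧ c.toNat = 0) := by cases c <;> simp
          omega
        · have hct : (c = true ∧ c.toNat = 1) ∨ (c = false ∧ c.toNat = 0) := by cases c <;> simp
          rcases hw3 with hw3 | hw3
          · left
            refine ⟨Or.inl ⟨by omega, ?_, ?_⟩, Or.inl ?_⟩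
            · rw [k1, lA]; congr 2; omega
            · rw [k2, lA]; congr 2; omega
            · rw [l1, lA]; apply uncmp_lt hc; omega
          · right; left
            refine ⟨Or.inl ⟨by omega, ?_, ?_⟩, Or.inl ?_⟩
            · rw [k1, lB]; congr 2; omega
            · rw [k2, lB]; congr 2; omega
            · rw [l2, lB]; apply uncmp_lt hc; omega
      · have hul : u = sleaf h m e' I' j c := by
          rcases k4 with k4 | k4 | k4
          · exact k4.1
          · exfalso
            rcases Nat.lt_or_gt_of_ne hII with hI | hI <;> have := mulstep (N := NN h) hI <;> omega
          · exfalso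
            rcases Nat.lt_or_gt_of_ne hII with hI | hI <;> have := mulstep (N := NN h) hI <;> omega
        have hwl : p' ≠ 0 ∧ q' ≠ 0 ∧ p' < NN h ∧ q' < NN h := by
          have := hR.2.2.1
          rcases l4 with l4 | l4 | l4
          · exact absurd (hul.trans l4.1.symm) this
          · omega
          · omega
        rcases nd_in_cl hh he hAB hB hh le_rfl (leaf_lt (c := c) hs) (hul ▸ hu') with t | ⟨t1, t2, rfl, t4⟩ | ⟨t1, t2, rfl, t4⟩
        · exact absurd t.1 hII
        · right; left
          refine ⟨Or.inr ?_, Or.inl ?_⟩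
          · rw [hul, sleaf, t2, t4, nd_first (d := d) hh he, nd_last (d := d) hh he]
          · rw [l2, lB]; apply uncmp_lt hc; rw [add_mul]; omega
        · left
          refine ⟨Or.inr ?_, Or.inl ?_⟩
          · have : j + (!c).toNat = 2 ^ h - 1 := by omega
            rw [hul, sleaf, this, t4, nd_first (d := d) hh he, nd_last (d := d) hh he]
          · rw [l1, lA]; apply uncmp_lt hc; rw [add_mul]; omega
    · have huf : u = sfoot h d e' I' j c f := by
        rcases k4 with k4 | k4 | k4
        · omega
        · omega
        · exact k4.1
      have huf2 : lam u = f := by rw [huf, sfoot_lam hh]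
      have hwl : e < lam w := by
        have := hR.2.2.1
        rcases l4 with l4 | l4 | l4
        · omega
        · omega
        · exact absurd (huf.trans l4.1.symm) this
      obtain ⟨G, g1, g2⟩ := foot_mult (d := d) (c := c) hh hs (by omega : 1 ≤ e) hee (by omega)
      rw [← huf] at g1 g2
      have hpt : lam u = e → u = pt h d e G := fun hl => pt_unique hh uv (by omega) hem hl g1 g2
      have g1' := g1
      have g2' := g2
      rw [cc_succ he, ← mul_assoc] at g1' g2'
      have u1' := u1
      have u2' := u2
      rw [g1', lA] at u1'
      rw [g2', lB] at u2'
      have u1' := Nat.le_of_mul_le_mul_right u1' hc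
      have u2' := Nat.le_of_mul_le_mul_right u2' hc
      rcases lt_trichotomy I G with hI | hI | hI
      · have h6 : G = I + 1 := by
          by_contra hcon
          have := mulstep (N := NN h) hI
          have := mulstep (N := NN h) (by omega : I + 1 < G)
          rw [add_mul] at this; omega
        subst h6
        rw [add_mul] at u1' u2'
        have hBe : B = 2 ^ h := by omega
        right; left
        refine ⟨?_, Or.inr hwl⟩
        by_cases hl : lam u < e
        · left
          refine ⟨hl, ?_, ?_⟩
          · rw [g1', lB, add_mul]; congr 2; omega
          · rw [g2', lB, add_mul]; congr 2; omega
        · right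
          rw [hpt (by omega), hBe, nd_last (d := d) hh he]
      · subst hI
        have hA0 : A = 0 := by omega
        left
        refine ⟨?_, Or.inr hwl⟩
        by_cases hl : lam u < e
        · left
          refine ⟨hl, ?_, ?_⟩
          · rw [g1', lA, hA0]; rfl
          · rw [g2', lA, hA0]; rfl
        · right
          rw [hpt (by omega), hA0, nd_first (d := d) hh he]
      · have := mulstep (N := NN h) hI
        omega

end Ghdm
namespace Ghdm

theorem dyadic_third {h q a q' a' : ℕ} {b : Bool} (hq : q ≤ h) (hq' : q' < h)
    (h1 : a * 2 ^ (h - q) ≤ (2 * a' + b.toNat) * 2 ^ (h - (q' + 1)))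
    (h2 : (2 * a' + b.toNat + 1) * 2 ^ (h - (q' + 1)) ≤ (a + 1) * 2 ^ (h - q))
    (h3 : ¬ (a * 2 ^ (h - q) ≤ a' * 2 ^ (h - q') ∧ (a' + 1) * 2 ^ (h - q') ≤ (a + 1) * 2 ^ (h - q))) :
    q = q' + 1 ∧ a = 2 * a' + b.toNat := by
  have hr := child_rng (a := a') b hq'
  have hpos : 0 < 2 ^ (h - (q' + 1)) := by positivity
  have hlt : (2 * a' + b.toNat) * 2 ^ (h - (q' + 1)) < (2 * a' + b.toNat + 1) * 2 ^ (h - (q' + 1)) :=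
    Nat.mul_lt_mul_of_pos_right (by omega) hpos
  by_cases hc : q ≤ q'
  · exfalso
    apply h3
    have e1 : 2 ^ (h - q) = 2 ^ (q' - q) * 2 ^ (h - q') := by rw [← pow_add]; congr 1; omega
    rw [e1, ← mul_assoc] at h1
    rw [e1, ← mul_assoc] at h2
    rw [e1, ← mul_assoc, ← mul_assoc]
    constructor
    · apply Nat.mul_le_mul_right
      have : a * 2 ^ (q' - q) * 2 ^ (h - q') < (a' + 1) * 2 ^ (h - q') := by omega
      have := Nat.lt_of_mul_lt_mul_right this
      omega
    · apply Nat.mul_le_mul_right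
      have : a' * 2 ^ (h - q') < (a + 1) * 2 ^ (q' - q) * 2 ^ (h - q') := by omega
      exact Nat.lt_of_mul_lt_mul_right this
  · have h4 : 2 ^ (h - (q' + 1)) ≤ 2 ^ (h - q) := by
      rw [add_mul, one_mul] at h2 
      rw [add_mul a, one_mul] at h2
      omega
    have h5 := (Nat.pow_le_pow_iff_right (by norm_num : 1 < 2)).mp h4
    have h6 : q = q' + 1 := by omega
    subst h6
    refine ⟨rfl, ?_⟩
    have := Nat.le_of_mul_le_mul_right h1 hpos
    have := Nat.le_of_mul_le_mul_right h2 hpos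
    omega

/-- cell of a tree node -/
def Dl (h d m e I q a : ℕ) : Set Raw := Cl h d m e I (a * 2 ^ (h - q)) ((a + 1) * 2 ^ (h - q))

theorem dl_le {h q a : ℕ} (hq : q ≤ h) (ha : a < 2 ^ q) :
    a * 2 ^ (h - q) < (a + 1) * 2 ^ (h - q) ∧ (a + 1) * 2 ^ (h - q) ≤ 2 ^ h := by
  have hp : 0 < 2 ^ (h - q) := by positivity
  constructor
  · exact Nat.mul_lt_mul_of_pos_right (by omega) hp
  · calc (a + 1) * 2 ^ (h - q) ≤ 2 ^ q * 2 ^ (h - q) := Nat.mul_le_mul_right _ ha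
      _ = 2 ^ h := by rw [← pow_add]; congr 1; omega

theorem exit_dl {h d m : ℕ} (hh : 1 ≤ h) {e I q a : ℕ} (he : 2 ≤ e) (hem : e ≤ m) (hq : q ≤ h)
    (ha : a < 2 ^ q) {u w : Raw} (hu : u ∈ Dl h d m e I q a) (hw : w ∉ Dl h d m e I q a)
    (hR : RR h d m u w) (hwr : w ≠ RootR m) :
    (u ∈ SS h d m e I (a * 2 ^ (h - q)) ∧ (lo h d w < lA h d e I (a * 2 ^ (h - q)) ∨ e < lam w)) ∨
    (u ∈ TT h d m e I ((a + 1) * 2 ^ (h - q)) ∧ (lB h d e I ((a + 1) * 2 ^ (h - q)) < hi h d w ∨ e < lam w)) ∨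
    (∃ q' a', ∃ b : Bool, 1 ≤ q' ∧ q = q' + 1 ∧ a = 2 * a' + b.toNat ∧ u = nd h m e I q a ∧
      w = nd h m e I q' a') := by
  obtain ⟨d1, d2⟩ := dl_le hq ha
  rcases exit_cl hh he hem d1 d2 hu hw hR hwr with h1 | h1 | ⟨q', a', b, k1, k2, k3, k4, k5, k6, k7, k8⟩
  · exact Or.inl h1
  · exact Or.inr (Or.inl h1)
  · obtain ⟨rfl, rfl⟩ := dyadic_third hq k2 k6 k7 k8
    exact Or.inr (Or.inr ⟨q', a', b, k1, rfl, rfl, k4, k5⟩)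

structure Cross (h d m e I A B : ℕ) (P : Set Raw) : Prop where
  conn : Conn (RR h d m) P
  sub : P ⊆ Cl h d m e I A B
  S : ∃ s ∈ P, s ∈ SS h d m e I A
  T : ∃ t ∈ P, t ∈ TT h d m e I B

structure HC (h d m e g : ℕ) (P : Set Raw) : Prop where
  conn : Conn (RR h d m) P
  sub : P ⊆ Box h d m e (g * cc h d e) ((g + 1) * cc h d e)
  S : ∃ s ∈ P, lo h d s = g * cc h d e ∧ hi h d s = g * cc h d e
  T : ∃ t ∈ P, lo h d t = (g + 1) * cc h d e ∧ hi h d t = (g + 1) * cc h d e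

theorem leaf_cell {h d m : ℕ} (hh : 1 ≤ h) {e I a : ℕ} (he : 2 ≤ e) (hem : e ≤ m) (ha : a < 2 ^ h)
    {u : Raw} (hu : u ∈ Cl h d m e I a (a + 1)) : lam u < e ∨ u = nd h m e I h a := by
  by_contra hcon
  push Not at hcon
  obtain ⟨hc1, hc2⟩ := hcon
  have hu' := hu
  obtain ⟨uv, ul, u1, u2⟩ := hu
  have hc := cc_pos h d (e - 1)
  have hH := two_le_H hh
  have hN := NN_eq h
  rcases valid_cases uv (ne_root (ul.trans hem)) with ⟨k, rfl, _⟩ | ⟨e', I', q, a', h1, h2, h3, h4, h5, h6, rfl⟩ | ⟨e', I', j, c, f, s, hs, _, _, rfl⟩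
  · simp [lam] at hc1; omega
  · rw [lam_nd hh h4 h6] at hc1 ul
    have : e' = e := by omega
    subst this
    rcases nd_in_cl hh he (by omega) (by omega) h4 h5 h6 hu' with ⟨rfl, k1, k2⟩ | ⟨rfl, rfl, rfl, k3⟩ | ⟨rfl, k1, rfl, k3⟩
    · have hp : 1 ≤ 2 ^ (h - q) := Nat.one_le_two_pow
      rw [add_mul, one_mul] at k2
      have h7 : 2 ^ (h - q) = 1 := by omega
      have h8 : h - q = 0 := by
        by_contra hne
        have := two_le_H (h := h - q) (by omega)
        omega
      have : q = h := by omega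
      subst this
      rw [h7] at k1 k2
      have : a' = a := by omega
      subst this
      exact hc2 rfl
    · apply hc2
      have : a = 2 ^ q - 1 := by omega
      rw [this, nd_first (d := d) hh he, nd_last (d := d) hh he]
    · apply hc2
      have : a' = 2 ^ q - 1 := by omega
      rw [this, k3, nd_first (d := d) hh he, nd_last (d := d) hh he]
  · rw [sp_lam] at hc1 ul
    have : e' = e := by omega
    subst this
    have hj := hs.hj
    rw [sp_lo, lA] at u1
    rw [sp_hi, lB] at u2
    have u1 := cmp hc u1
    have u2 := cmp hc u2
    rcases lt_trichotomy I I' with hI | hI | hI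
    · have := mulstep (N := NN h) hI; omega
    · subst hI; omega
    · have := mulstep (N := NN h) hI; omega

theorem cross_leaf {h d m : ℕ} (hh : 1 ≤ h) {e I a : ℕ} (he : 2 ≤ e) (hem : e ≤ m) (ha : a < 2 ^ h)
    {P : Set Raw} (hP : Cross h d m e I a (a + 1) P) (hx : nd h m e I h a ∉ P) :
    HC h d m (e - 1) (I * NN h + 2 * a) P := by
  have hB : lB h d e I (a + 1) = (I * NN h + 2 * a + 1) * cc h d (e - 1) := by
    unfold lB; congr 1
  refine ⟨hP.conn, ?_, ?_, ?_⟩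
  · intro u hu
    have h1 := hP.sub hu
    have h2 : lam u < e := by
      rcases leaf_cell hh he hem ha h1 with h2 | h2
      · exact h2
      · exact absurd (h2 ▸ hu) hx
    obtain ⟨uv, ul, u1, u2⟩ := h1
    exact ⟨uv, by omega, u1, hB ▸ u2⟩
  · obtain ⟨s, hs, h1 | h1⟩ := hP.S
    · exact ⟨s, hs, h1.2⟩
    · exact absurd (h1 ▸ hs) hx
  · obtain ⟨s, hs, h1 | h1⟩ := hP.T
    · exact ⟨s, hs, hB ▸ h1.2⟩
    · exact absurd (h1 ▸ hs) hx

theorem restrL {h d m : ℕ} (hh : 1 ≤ h) {e I q a B : ℕ} (he : 2 ≤ e) (hem : e ≤ m) (hq : q < h)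
    (ha : a < 2 ^ q) {P : Set Raw} (hP : Cross h d m e I (a * 2 ^ (h - q)) B P)
    (hx : nd h m e I q a ∉ P) (hB : (2 * a + 1) * 2 ^ (h - (q + 1)) < B) (hBh : B ≤ 2 ^ h) :
    ∃ P', P' ⊆ P ∧ Cross h d m e I ((2 * a) * 2 ^ (h - (q + 1))) ((2 * a + 1) * 2 ^ (h - (q + 1))) P' := by
  have ha' := child_lt false ha
  simp only [Bool.toNat_false, add_zero] at ha'
  have hA : a * 2 ^ (h - q) = (2 * a) * 2 ^ (h - (q + 1)) := by rw [child_pow hq]; ring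
  have hc := cc_pos h d (e - 1)
  have hN := NN_eq h
  obtain ⟨d1, d2⟩ := dl_le (h := h) (q := q + 1) (by omega) ha'
  obtain ⟨s, hsP, hsS⟩ := hP.S
  obtain ⟨t, htP, htT⟩ := hP.T
  rw [hA] at hsS hP
  have hlt : lB h d e I ((2 * a + 1) * 2 ^ (h - (q + 1))) < lB h d e I B := by
    unfold lB; apply uncmp_lt hc; omega
  have hsC : s ∈ Dl h d m e I (q + 1) (2 * a) := by
    have hsv := hP.sub hsP
    rcases hsS with hs | hs
    · refine ⟨hsv.1, hsv.2.1, hsv.2.2.1, ?_⟩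
      rw [hs.2.2]; unfold lA lB; apply uncmp; omega
    · rw [hs]
      rw [hs] at hsv
      refine nd_mem_cl hh he hsv.1 d2 hh le_rfl (by omega) ?_ ?_ <;> simp <;> omega
  have htC : t ∉ Dl h d m e I (q + 1) (2 * a) := by
    rintro ⟨_, _, _, h1⟩
    rcases htT with ht | ht
    · rw [ht.2.2] at h1; omega
    · have hin : nd h m e I h (B - 1) ∈ Cl h d m e I ((2 * a) * 2 ^ (h - (q + 1))) ((2 * a + 1) * 2 ^ (h - (q + 1))) := by
        rw [← ht]; exact ⟨(hP.sub htP).1, (hP.sub htP).2.1, (hP.sub htP).2.2.1, h1⟩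
      rcases nd_in_cl hh he d1 d2 hh le_rfl (by omega) hin with h | h | h
      · simp at h; omega
      · omega
      · omega
  obtain ⟨P', h1, h2, h3, h4, u, w, hu, hw, hwC, hR⟩ := comp_exit RR_symm hP.conn _ hsP hsC htP htC
  refine ⟨P', h1, h3, h2, ⟨s, h4, hsS⟩, ?_⟩
  have hwv := hP.sub hw
  rcases exit_dl hh he hem (by omega) ha' (h2 hu) hwC hR (ne_root (hwv.2.1.trans hem)) with k | k | ⟨q', a', b, k1, k2, k3, k4, k5⟩
  · exfalso
    have := hwv.2.2.1
    have := hwv.2.1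
    rcases k.2 with k | k <;> omega
  · exact ⟨u, hu, k.1⟩
  · exfalso
    have e1 : q' = q := by omega
    have e2 : a' = a := by cases b <;> simp at k3 <;> omega
    subst e1; subst e2
    exact hx (k5 ▸ hw)

theorem restrR {h d m : ℕ} (hh : 1 ≤ h) {e I q a A : ℕ} (he : 2 ≤ e) (hem : e ≤ m) (hq : q < h)
    (ha : a < 2 ^ q) {P : Set Raw} (hP : Cross h d m e I A ((a + 1) * 2 ^ (h - q)) P)
    (hx : nd h m e I q a ∉ P) (hB : A < (2 * a + 1) * 2 ^ (h - (q + 1))) :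
    ∃ P', P' ⊆ P ∧ Cross h d m e I ((2 * a + 1) * 2 ^ (h - (q + 1))) ((2 * a + 1 + 1) * 2 ^ (h - (q + 1))) P' := by
  have ha' := child_lt true ha
  simp only [Bool.toNat_true] at ha'
  have hA : (a + 1) * 2 ^ (h - q) = (2 * a + 1 + 1) * 2 ^ (h - (q + 1)) := by rw [child_pow hq]; ring
  have hc := cc_pos h d (e - 1)
  have hN := NN_eq h
  obtain ⟨d1, d2⟩ := dl_le (h := h) (q := q + 1) (by omega) ha'
  obtain ⟨s, hsP, hsS⟩ := hP.S
  obtain ⟨t, htP, htT⟩ := hP.T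
  rw [hA] at htT hP
  have hlt : lA h d e I A < lA h d e I ((2 * a + 1) * 2 ^ (h - (q + 1))) := by
    unfold lA; apply uncmp_lt hc; omega
  have htC : t ∈ Dl h d m e I (q + 1) (2 * a + 1) := by
    have htv := hP.sub htP
    rcases htT with ht | ht
    · refine ⟨htv.1, htv.2.1, ?_, htv.2.2.2⟩
      rw [ht.2.1]; unfold lA lB; apply uncmp; omega
    · rw [ht]
      rw [ht] at htv
      refine nd_mem_cl hh he htv.1 d2 hh le_rfl (by omega) ?_ ?_ <;> simp <;> omega
  have hsC : s ∉ Dl h d m e I (q + 1) (2 * a + 1) := by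
    rintro ⟨_, _, h1, _⟩
    rcases hsS with hs | hs
    · rw [hs.2.1] at h1; omega
    · have hin : nd h m e I h A ∈ Cl h d m e I ((2 * a + 1) * 2 ^ (h - (q + 1))) ((2 * a + 1 + 1) * 2 ^ (h - (q + 1))) := by
        rw [← hs]; exact ⟨(hP.sub hsP).1, (hP.sub hsP).2.1, h1, (hP.sub hsP).2.2.2⟩
      rcases nd_in_cl hh he d1 d2 hh le_rfl (by omega) hin with h | h | h
      · simp at h; omega
      · omega
      · omega
  obtain ⟨P', h1, h2, h3, h4, u, w, hu, hw, hwC, hR⟩ := comp_exit RR_symm hP.conn _ htP htC hsP hsC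
  refine ⟨P', h1, h3, h2, ?_, ⟨t, h4, htT⟩⟩
  have hwv := hP.sub hw
  rcases exit_dl hh he hem (by omega) ha' (h2 hu) hwC hR (ne_root (hwv.2.1.trans hem)) with k | k | ⟨q', a', b, k1, k2, k3, k4, k5⟩
  · exact ⟨u, hu, k.1⟩
  · exfalso
    have := hwv.2.2.2
    have := hwv.2.1
    rcases k.2 with k | k <;> omega
  · exfalso
    have e1 : q' = q := by omega
    have e2 : a' = a := by cases b <;> simp at k3 <;> omega
    subst e1; subst e2
    exact hx (k5 ▸ hw)

def LA (h d m e I q : ℕ) : Prop := ∀ a, a < 2 ^ q → ∀ P Q : Set Raw,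
  Cross h d m e I (a * 2 ^ (h - q)) ((a + 1) * 2 ^ (h - q)) P →
  Cross h d m e I (a * 2 ^ (h - q)) ((a + 1) * 2 ^ (h - q)) Q →
  Far (RR h d m) P Q → nd h m e I q a ∈ P ∨ nd h m e I q a ∈ Q

theorem chainR {h d m : ℕ} (hh : 1 ≤ h) {e I A B : ℕ} (he : 2 ≤ e) (hem : e ≤ m)
    (hI : I < NN h ^ (m - e)) {P Q : Set Raw} (hP : Conn (RR h d m) P) (hPs : P ⊆ Cl h d m e I A B)
    (hf : Far (RR h d m) P Q) (ht : ∃ t ∈ P, t ∈ TT h d m e I B) :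
    ∀ n q a, q + n = h → 1 ≤ q → a < 2 ^ q → (a + 1) * 2 ^ (h - q) = B → 
      (∀ q', q < q' → q' ≤ h → LA h d m e I q') → nd h m e I q a ∈ P →
      (∃ Q', Q' ⊆ Q ∧ Cross h d m e I (a * 2 ^ (h - q)) B Q') →
      nd h m e I h (B - 1) ∈ P ∧ ∃ Q', Q' ⊆ Q ∧ Cross h d m e I (B - 1) (B - 1 + 1) Q' := by
  intro n
  induction n with
  | zero =>
    intro q a hq _ ha hB _ hx hQ
    have : q = h := by omega
    subst this
    simp only [Nat.sub_self, pow_zero, mul_one] at hB hQ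
    subst hB
    simpa using ⟨hx, hQ⟩
  | succ n ih =>
    intro q a hq hq1 ha hB hLA hx ⟨Q', hQ', hQc⟩
    have hqh : q < h := by omega
    have ha' := child_lt true ha
    simp only [Bool.toNat_true] at ha'
    have hA : (a + 1) * 2 ^ (h - q) = (2 * a + 1 + 1) * 2 ^ (h - (q + 1)) := by rw [child_pow hqh]; ring
    have hA2 : a * 2 ^ (h - q) = (2 * a) * 2 ^ (h - (q + 1)) := by rw [child_pow hqh]; ring
    have hp : 0 < 2 ^ (h - (q + 1)) := by positivity
    have hlt : (2 * a) * 2 ^ (h - (q + 1)) < (2 * a + 1) * 2 ^ (h - (q + 1)) :=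
      Nat.mul_lt_mul_of_pos_right (by omega) hp
    obtain ⟨d1, d2⟩ := dl_le (h := h) (q := q + 1) (by omega) ha'
    have hxQ : nd h m e I q a ∉ Q := fun hc => (hf _ _ hx hc).1 rfl
    subst hB
    obtain ⟨Q2, hQ2, hQ2c⟩ := restrR hh he hem hqh ha hQc (fun hc => hxQ (hQ' hc)) (by omega)
    rw [hA] at ht hPs
    have hchild : nd h m e I (q + 1) (2 * a + 1) ∈ P := by
      obtain ⟨t, htP, htT⟩ := ht
      have htC : t ∈ Dl h d m e I (q + 1) (2 * a + 1) := by
        have htv := hPs htP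
        rcases htT with ht | ht
        · refine ⟨htv.1, htv.2.1, ?_, htv.2.2.2⟩
          rw [ht.2.1]; unfold lA lB; apply uncmp; omega
        · rw [ht]
          rw [ht] at htv
          refine nd_mem_cl hh he htv.1 d2 hh le_rfl (by omega) ?_ ?_ <;> simp <;> omega
      have hxC : nd h m e I q a ∉ Dl h d m e I (q + 1) (2 * a + 1) := by
        intro hin
        rcases nd_in_cl hh he d1 d2 hq1 hqh.le ha hin with h | h | h <;> omega
      obtain ⟨P', h1, h2, h3, h4, u, w, hu, hw, hwC, hR⟩ := comp_exit RR_symm hP _ htP htC hx hxC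
      have hwv := hPs hw
      rcases exit_dl hh he hem (by omega) ha' (h2 hu) hwC hR (ne_root (hwv.2.1.trans hem)) with k | k | ⟨q', a', b, k1, k2, k3, k4, k5⟩
      · have := hLA (q + 1) (by omega) (by omega) (2 * a + 1) ha' P' Q2
          ⟨h3, h2, ⟨u, hu, k.1⟩, ⟨t, h4, htT⟩⟩ hQ2c (hf.mono h1 (hQ2.trans hQ'))
        rcases this with h5 | h5
        · exact h1 h5
        · exfalso
          have := (hf _ _ hx (hQ' (hQ2 h5))).2.1
          exact this (RR_tree (b := true) hh hqh ha he hem hI)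
      · exfalso
        have := hwv.2.2.2
        have := hwv.2.1
        rcases k.2 with k | k <;> omega
      · exact k4 ▸ h1 hu
    rw [hA]
    rw [hA] at ih
    exact ih (q + 1) (2 * a + 1) (by omega) (by omega) ha' rfl
      (fun q' h1 h2 => hLA q' (by omega) h2) hchild ⟨Q2, hQ2.trans hQ', hQ2c⟩ 

theorem chainL {h d m : ℕ} (hh : 1 ≤ h) {e I A B : ℕ} (he : 2 ≤ e) (hem : e ≤ m)
    (hI : I < NN h ^ (m - e)) {P Q : Set Raw} (hP : Conn (RR h d m) P) (hPs : P ⊆ Cl h d m e I A B)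
    (hf : Far (RR h d m) P Q) (ht : ∃ t ∈ P, t ∈ SS h d m e I A) :
    ∀ n q a, q + n = h → 1 ≤ q → a < 2 ^ q → a * 2 ^ (h - q) = A → 
      (∀ q', q < q' → q' ≤ h → LA h d m e I q') → nd h m e I q a ∈ P →
      (∃ Q', Q' ⊆ Q ∧ Cross h d m e I A ((a + 1) * 2 ^ (h - q)) Q') →
      nd h m e I h A ∈ P ∧ ∃ Q', Q' ⊆ Q ∧ Cross h d m e I A (A + 1) Q' := by
  intro n
  induction n with
  | zero =>
    intro q a hq _ ha hB _ hx hQ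
    have : q = h := by omega
    subst this
    simp only [Nat.sub_self, pow_zero, mul_one] at hB hQ
    subst hB
    exact ⟨hx, hQ⟩
  | succ n ih =>
    intro q a hq hq1 ha hB hLA hx ⟨Q', hQ', hQc⟩
    have hqh : q < h := by omega
    have ha' := child_lt false ha
    simp only [Bool.toNat_false, add_zero] at ha'
    have hA : (a + 1) * 2 ^ (h - q) = (2 * a + 1 + 1) * 2 ^ (h - (q + 1)) := by rw [child_pow hqh]; ring
    have hA2 : a * 2 ^ (h - q) = (2 * a) * 2 ^ (h - (q + 1)) := by rw [child_pow hqh]; ring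
    have hp : 0 < 2 ^ (h - (q + 1)) := by positivity
    have hlt : (2 * a + 1) * 2 ^ (h - (q + 1)) < (2 * a + 1 + 1) * 2 ^ (h - (q + 1)) :=
      Nat.mul_lt_mul_of_pos_right (by omega) hp
    obtain ⟨d1, d2⟩ := dl_le (h := h) (q := q + 1) (by omega) ha'
    obtain ⟨_, d3⟩ := dl_le (h := h) (q := q) (by omega) ha
    have hxQ : nd h m e I q a ∉ Q := fun hc => (hf _ _ hx hc).1 rfl
    subst hB
    obtain ⟨Q2, hQ2, hQ2c⟩ := restrL hh he hem hqh ha hQc (fun hc => hxQ (hQ' hc)) (by omega) d3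
    rw [hA2] at ht hPs
    have hchild : nd h m e I (q + 1) (2 * a) ∈ P := by
      obtain ⟨t, htP, htT⟩ := ht
      have htC : t ∈ Dl h d m e I (q + 1) (2 * a) := by
        have htv := hPs htP
        rcases htT with ht | ht
        · refine ⟨htv.1, htv.2.1, htv.2.2.1, ?_⟩
          rw [ht.2.2]; unfold lA lB; apply uncmp; omega
        · rw [ht]
          rw [ht] at htv
          refine nd_mem_cl hh he htv.1 d2 hh le_rfl (by omega) ?_ ?_ <;> simp <;> omega
      have hxC : nd h m e I q a ∉ Dl h d m e I (q + 1) (2 * a) := by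
        intro hin
        rcases nd_in_cl hh he d1 d2 hq1 hqh.le ha hin with h | h | h <;> omega
      obtain ⟨P', h1, h2, h3, h4, u, w, hu, hw, hwC, hR⟩ := comp_exit RR_symm hP _ htP htC hx hxC
      have hwv := hPs hw
      rcases exit_dl hh he hem (by omega) ha' (h2 hu) hwC hR (ne_root (hwv.2.1.trans hem)) with k | k | ⟨q', a', b, k1, k2, k3, k4, k5⟩
      · exfalso
        have := hwv.2.2.1
        have := hwv.2.1
        rcases k.2 with k | k <;> omega
      · have := hLA (q + 1) (by omega) (by omega) (2 * a) ha' P' Q2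
          ⟨h3, h2, ⟨t, h4, htT⟩, ⟨u, hu, k.1⟩⟩ hQ2c (hf.mono h1 (hQ2.trans hQ'))
        rcases this with h5 | h5
        · exact h1 h5
        · exfalso
          have := (hf _ _ hx (hQ' (hQ2 h5))).2.1
          exact this (RR_tree (b := false) hh hqh ha he hem hI)
      · exact k4 ▸ h1 hu
    rw [hA2]
    rw [hA2] at ih
    exact ih (q + 1) (2 * a) (by omega) (by omega) ha' rfl
      (fun q' h1 h2 => hLA q' (by omega) h2) hchild ⟨Q2, hQ2.trans hQ', hQ2c⟩ 

end Ghdm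
namespace Ghdm

theorem dyadic_two {h q a q' a' : ℕ} (hq : q < h) (hq' : q' ≤ h)
    (h1 : a * 2 ^ (h - q) ≤ a' * 2 ^ (h - q')) (h2 : (a' + 1) * 2 ^ (h - q') ≤ (a + 1) * 2 ^ (h - q)) :
    (q' = q ∧ a' = a) ∨ (a' + 1) * 2 ^ (h - q') ≤ (2 * a + 1) * 2 ^ (h - (q + 1)) ∨
      (2 * a + 1) * 2 ^ (h - (q + 1)) ≤ a' * 2 ^ (h - q') := by
  have h4 : 2 ^ (h - q') ≤ 2 ^ (h - q) := by
    rw [add_mul, one_mul] at h2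
    rw [add_mul a, one_mul] at h2
    omega
  have h5 := (Nat.pow_le_pow_iff_right (by norm_num : 1 < 2)).mp h4
  have hpos : 0 < 2 ^ (h - q') := by positivity
  by_cases hc : q' = q
  · subst hc
    left
    refine ⟨rfl, ?_⟩
    have := Nat.le_of_mul_le_mul_right h1 hpos
    have := Nat.le_of_mul_le_mul_right h2 hpos
    omega
  · right
    have e1 : 2 ^ (h - (q + 1)) = 2 ^ (q' - (q + 1)) * 2 ^ (h - q') := by rw [← pow_add]; congr 1; omega
    rw [e1, ← mul_assoc]
    rcases Nat.lt_or_ge a' ((2 * a + 1) * 2 ^ (q' - (q + 1))) with h6 | h6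
    · left; exact Nat.mul_le_mul_right _ h6
    · right; exact Nat.mul_le_mul_right _ h6

/-- the cut at the gap `j` -/
def Zc (h d e I j : ℕ) (c0 : Bool) (Y : Set Raw) : Set Raw :=
  {u | (lam u = e ∧ (hi h d u ≤ (I * NN h + (2 * j + 1)) * cc h d (e - 1) ∨
      (ff u ≠ 0 ∧ side u = c0 ∧ lo h d u = (I * NN h + (2 * j + 1)) * cc h d (e - 1) ∧
        hi h d u = (I * NN h + (2 * j + 2)) * cc h d (e - 1)))) ∨ (lam u < e ∧ u ∈ Y)}

theorem muleq {N u I x y : ℕ} (hu : 0 < u) (h : (I * N + x) * u = (I * N + y) * u) : x = y := by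
  have := Nat.eq_of_mul_eq_mul_right hu h; omega

theorem zcut {h d m : ℕ} (hh : 1 ≤ h) {e I q a j : ℕ} (he : 2 ≤ e) (hem : e ≤ m) (hq : q < h)
    (ha : a < 2 ^ q) (hj : j + 1 = (2 * a + 1) * 2 ^ (h - (q + 1))) {P : Set Raw}
    (hPs : P ⊆ Dl h d m e I q a) (hx : nd h m e I q a ∉ P) (c0 : Bool) (Y : Set Raw)
    (hY : ∀ u w, u ∈ P → w ∈ P → lam u < e → lam w < e → RR h d m u w → (u ∈ Y ↔ w ∈ Y))
    (y1 : ∀ u ∈ P, lam u < e → hi h d u ≤ (I * NN h + 2 * j) * cc h d (e - 1) → u ∈ Y)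
    (y4 : ∀ u ∈ P, lam u < e → (I * NN h + (2 * j + 3)) * cc h d (e - 1) ≤ lo h d u → u ∉ Y)
    (y2 : ∀ u ∈ P, lam u < e → lo h d u = (I * NN h + (2 * j + 1)) * cc h d (e - 1) →
      hi h d u = (I * NN h + (2 * j + 1)) * cc h d (e - 1) → (u ∈ Y ↔ c0 = false))
    (y3 : ∀ u ∈ P, lam u < e → lo h d u = (I * NN h + (2 * j + 2)) * cc h d (e - 1) →
      hi h d u = (I * NN h + (2 * j + 2)) * cc h d (e - 1) → (u ∈ Y ↔ c0 = true))
    (hl : c0 = false → nd h m e I h j ∉ P ∧ nd h m e I h (j + 1) ∉ P) :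
    ∀ u w, u ∈ P → w ∈ P → RR h d m u w → (u ∈ Zc h d e I j c0 Y ↔ w ∈ Zc h d e I j c0 Y) := by
  have hc := cc_pos h d (e - 1)
  have hH := two_le_H hh
  have hN := NN_eq h
  obtain ⟨d1, d2⟩ := dl_le hq.le ha
  have hstar : ∀ (I' j' : ℕ) (c : Bool) (f : ℕ) (x : Raw), SOK h m e I' j' f → OnStar h d m e I' j' c f x → x ∈ P →
      I' = I → (x ∈ Zc h d e I j c0 Y ↔ (j' < j ∨ (j' = j ∧ c = c0))) := by
    intro I' j' c f x hs hxs hxP hI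
    subst hI
    have hf := hs.fe
    have hf1 := hs.f1
    obtain ⟨p, r, h1, h2, h3, ⟨h4, h5, h6⟩ | ⟨h4, h5, h6, h7, h8⟩ | ⟨h4, h5, h6, h7⟩⟩ := star_coord hh hs hxs
    · have hff : ff x = 0 := by rw [h4]; exact nd_ff hh (leaf_lt hs)
      have hz : x ∈ Zc h d e I' j c0 Y ↔ hi h d x ≤ (I' * NN h + (2 * j + 1)) * cc h d (e - 1) := by
        simp [Zc, h5, hff]
      rw [hz, h2, Nat.mul_le_mul_right_iff hc]
      by_cases hjj : j' = j
      · subst hjj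
        cases c0
        · exfalso
          obtain ⟨l1, l2⟩ := hl rfl
          cases c
          · simp only [sleaf, Bool.not_false, Bool.toNat_true] at h4
            exact l2 (h4 ▸ hxP)
          · simp only [sleaf, Bool.not_true, Bool.toNat_false] at h4
            exact l1 (h4 ▸ hxP)
        · rcases h6 with ⟨rfl, h6, h7⟩ | ⟨rfl, h6, h7⟩
          · simp; omega
          · simp; omega
      · rcases h6 with ⟨rfl, h6, h7⟩ | ⟨rfl, h6, h7⟩ <;> omega
    · have hff : ff x ≠ 0 := by omega
      have hz : x ∈ Zc h d e I' j c0 Y ↔ (hi h d x ≤ (I' * NN h + (2 * j + 1)) * cc h d (e - 1) ∨ 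
          (c = c0 ∧ lo h d x = (I' * NN h + (2 * j + 1)) * cc h d (e - 1) ∧
        hi h d x = (I' * NN h + (2 * j + 2)) * cc h d (e - 1))) := by
        simp [Zc, h6, hff, h5]
      have e1 : (I' * NN h + p) * cc h d (e - 1) = (I' * NN h + (2 * j + 1)) * cc h d (e - 1) ↔ p = 2 * j + 1 :=
        ⟨muleq hc, fun h => by rw [h]⟩
      have e2 : (I' * NN h + r) * cc h d (e - 1) = (I' * NN h + (2 * j + 2)) * cc h d (e - 1) ↔ r = 2 * j + 2 :=
        ⟨muleq hc, fun h => by rw [h]⟩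
      rw [hz, h1, h2, Nat.mul_le_mul_right_iff hc, e1, e2]
      by_cases hcc : c = c0 <;> simp [hcc] <;> omega
    · have hz : x ∈ Zc h d e I' j c0 Y ↔ x ∈ Y := by
        have g1 : lam x ≠ e := by omega
        have g2 : lam x < e := by omega
        simp only [Zc, Set.mem_setOf_eq]; tauto
      rw [hz]
      have hlx : lam x < e := by omega
      rcases lt_trichotomy j' j with hjj | hjj | hjj
      · have : x ∈ Y := y1 x hxP hlx (by rw [h2]; apply uncmp; cases c <;> simp at h7 <;> omega)
        simp [this, hjj]
      · subst hjj
        cases c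
        · rw [h6] at h1
          rw [h7] at h2
          rw [y2 x hxP hlx h1 h2]; simp [eq_comm]
        · rw [h6] at h1
          rw [h7] at h2
          rw [y3 x hxP hlx h1 h2]; simp [eq_comm]
      · have : x ∉ Y := y4 x hxP hlx (by rw [h1]; apply uncmp; omega)
        simp [this]; omega
  have hnode : ∀ q' a', 1 ≤ q' → q' ≤ h → a' < 2 ^ q' → nd h m e I q' a' ∈ P →
      a * 2 ^ (h - q) ≤ a' * 2 ^ (h - q') → (a' + 1) * 2 ^ (h - q') ≤ (a + 1) * 2 ^ (h - q) →
      ((a' + 1) * 2 ^ (h - q') ≤ j + 1 ∧ nd h m e I q' a' ∈ Zc h d e I j c0 Y) ∨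
      (j + 1 ≤ a' * 2 ^ (h - q') ∧ nd h m e I q' a' ∉ Zc h d e I j c0 Y) := by
    intro q' a' k1 k2 k3 hP r1 r2
    have hff : ff (nd h m e I q' a') = 0 := nd_ff k1 k3
    have hz : nd h m e I q' a' ∈ Zc h d e I j c0 Y ↔
        hi h d (nd h m e I q' a') ≤ (I * NN h + (2 * j + 1)) * cc h d (e - 1) := by
      simp [Zc, hff, lam_nd hh k1 k3]
    obtain ⟨x, y, D, hD, g1, g2, g3, g4, g5, g6⟩ := nd_coord d hh k1 k2 k3 he (m := m) (I := I)
    rcases dyadic_two hq k2 r1 r2 with ⟨rfl, rfl⟩ | h1 | h1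
    · exact absurd hP hx
    · left
      rw [← hj] at h1
      refine ⟨h1, ?_⟩
      rw [hz, g5]; apply uncmp
      have := hj ▸ (show (2 * a + 1) * 2 ^ (h - (q + 1)) ≤ 2 ^ h by
        have := child_rng (a := a) false hq; simp at this; omega)
      rcases g6 with ⟨g6, g7⟩ | ⟨g6, g7, g8, g9, g10, g11⟩ | ⟨g6, g7, g8, g9, g10, g11⟩
      · omega
      · omega
      · exfalso
        have := child_rng (a := a) true hq
        have hp : 0 < 2 ^ (h - (q + 1)) := by positivity
        simp only [Bool.toNat_true] at this
        rw [add_mul (2 * a + 1) 1, one_mul] at this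
        omega
    · right
      rw [← hj] at h1
      refine ⟨h1, ?_⟩
      rw [hz, g5, Nat.mul_le_mul_right_iff hc]
      rw [← hD] at h1
      omega
  intro u w hu hw hR
  by_cases hlow : lam u < e ∧ lam w < e
  · have := hY u w hu hw hlow.1 hlow.2 hR
    have e1 : lam u ≠ e := by omega
    have e2 : lam w ≠ e := by omega
    simp [Zc, e1, e2, hlow, this]
  have hPu := hPs hu
  have hPw := hPs hw
  rcases RR_three hh hR (ne_root ((hPs hu).2.1.trans hem)) (ne_root ((hPs hw).2.1.trans hem)) with h1 | ⟨e', I', q', a', b, h1, h2, h3, h4, h5, h6, h7⟩ | ⟨e', I', j', c, f, hs, h1, h2⟩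
  · omega
  · have hb := child_lt b h6
    have hcr := child_rng (a := a') b h5
    have hsym : ∀ u w : Raw, u ∈ P → w ∈ P → ¬ (lam u < e ∧ lam w < e) → u = nd h m e' I' q' a' → w = nd h m e' I' (q' + 1) (2 * a' + b.toNat) →
        (u ∈ Zc h d e I j c0 Y ↔ w ∈ Zc h d e I j c0 Y) := by
      intro u w hu hw hlow hu1 hw1
      have hl : lam u = e' := by rw [hu1]; exact lam_nd hh h4 h6
      have hl2 : lam w = e' := by rw [hw1]; exact lam_nd hh (by omega) hb
      have : e' = e := by have := (hPs hu).2.1; omega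
      subst this
      subst hu1 hw1
      have hlt : (2 * a' + b.toNat) * 2 ^ (h - (q' + 1)) < (2 * a' + b.toNat + 1) * 2 ^ (h - (q' + 1)) :=
        Nat.mul_lt_mul_of_pos_right (by omega) (by positivity)
      rcases nd_in_cl hh he d1 d2 h4 h5.le h6 (hPs hu) with ⟨rfl, k1, k2⟩ | ⟨k1, _⟩ | ⟨k1, _⟩
      · rcases hnode q' a' h4 h5.le h6 hu k1 k2 with ⟨n1, n2⟩ | ⟨n1, n2⟩ <;>
        rcases hnode (q' + 1) _ (by omega) (by omega) hb hw (by omega) (by omega) with ⟨n3, n4⟩ | ⟨n3, n4⟩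
        · simp [n2, n4]
        · omega
        · omega
        · simp [n2, n4]
      · omega
      · omega
    rcases h7 with ⟨h7, h8⟩ | ⟨h7, h8⟩
    · exact hsym u w hu hw hlow h7 h8
    · exact (hsym w u hw hu (by tauto) h7 h8).symm
  · have hne := hR.2.2.1
    have hfe := hs.fe
    have hu2 := (hPs hu).2.1
    have hw2 := (hPs hw).2.1
    obtain ⟨p, r, a1, a2, a3, a4⟩ := star_coord hh hs h1
    obtain ⟨p', r', b1, b2, b3, b4⟩ := star_coord hh hs h2
    have he' : e' = e := by
      by_contra hcon
      rcases a4 with a4 | a4 | a4 <;> rcases b4 with b4 | b4 | b4 <;> 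
        first
        | exact hne (a4.1.trans b4.1.symm)
        | omega
    subst he'
    have hI : I' = I := by
      have u1 := (hPs hu).2.2.1
      have u2 := (hPs hu).2.2.2
      have w1 := (hPs hw).2.2.1
      have w2 := (hPs hw).2.2.2
      rw [a1, lA] at u1
      rw [a2, lB] at u2
      rw [b1, lA] at w1
      rw [b2, lB] at w2
      have u1 := cmp hc u1
      have u2 := cmp hc u2
      have w1 := cmp hc w1
      have w2 := cmp hc w2
      have hj' := hs.hj
      by_contra hcon
      rcases Nat.lt_or_gt_of_ne hcon with hI | hI
      · have := mulstep (N := NN h) hI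
        rcases a4 with ⟨a4, a5, a6⟩ | a4 | ⟨a4, a5, a6, a7⟩ <;> rcases b4 with ⟨b4, b5, b6⟩ | b4 | ⟨b4, b5, b6, b7⟩ <;> 
          first
          | exact hne (a4.trans b4.symm)
          | omega
          | (cases c <;> simp at * <;> omega)
      · have := mulstep (N := NN h) hI
        rcases a4 with ⟨a4, a5, a6⟩ | a4 | ⟨a4, a5, a6, a7⟩ <;> rcases b4 with ⟨b4, b5, b6⟩ | b4 | ⟨b4, b5, b6, b7⟩ <;> 
          first
          | exact hne (a4.trans b4.symm)
          | omega
          | (cases c <;> simp at * <;> omega)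
    rw [hstar I' j' c f u hs h1 hu hI, hstar I' j' c f w hs h2 hw hI]
end Ghdm
namespace Ghdm

theorem blkcol {h d m e' g : ℕ} {P : Set Raw} (hno : ∀ P', P' ⊆ P → HC h d m e' g P' → False) :
    ∃ X : Set Raw, (∀ u ∈ P, Valid h d m u → lam u ≤ e' → lo h d u = g * cc h d e' → hi h d u = g * cc h d e' → u ∈ X) ∧
      (∀ u ∈ P, Valid h d m u → lam u ≤ e' → lo h d u = (g + 1) * cc h d e' → hi h d u = (g + 1) * cc h d e' → u ∉ X) ∧
      (∀ u w, u ∈ P → w ∈ P → RR h d m u w → lam u ≤ e' → lam w ≤ e' → InBlk h d e' g u → InBlk h d e' g w →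
        (u ∈ X ↔ w ∈ X)) := by
  obtain ⟨X, x1, x2, x3⟩ := coloring (RR_symm (h := h) (d := d) (m := m))
    (P ∩ Box h d m e' (g * cc h d e') ((g + 1) * cc h d e'))
    {s | lo h d s = g * cc h d e' ∧ hi h d s = g * cc h d e'}
    {s | lo h d s = (g + 1) * cc h d e' ∧ hi h d s = (g + 1) * cc h d e'}
    (fun P' c1 c2 c3 c4 => hno P' (fun x hx => (c2 hx).1) ⟨c1, fun x hx => (c2 hx).2, c3, c4⟩)
  have hle : g * cc h d e' ≤ (g + 1) * cc h d e' := Nat.mul_le_mul_right _ (by omega)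
  refine ⟨X, ?_, ?_, ?_⟩
  · intro u hu hv hl h1 h2
    exact x1 u ⟨hu, hv, hl, h1.ge, h2.le.trans hle⟩ ⟨h1, h2⟩
  · intro u hu hv hl h1 h2
    exact x2 u ⟨hu, hv, hl, hle.trans h1.ge, h2.le⟩ ⟨h1, h2⟩
  · intro u w hu hw hR hlu hlw b1 b2
    exact x3 u w ⟨hu, hR.1, hlu, b1.1, b1.2⟩ ⟨hw, hR.2.1, hlw, b2.1, b2.2⟩ hR

theorem crossM {h d m : ℕ} (hh : 1 ≤ h) {e I q a j : ℕ} (he : 2 ≤ e) (hem : e ≤ m) (hq : q < h)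
    (ha : a < 2 ^ q) (hj : j + 1 = (2 * a + 1) * 2 ^ (h - (q + 1))) {P : Set Raw}
    (hP : Conn (RR h d m) P)
    (hPs : P ⊆ Dl h d m e I q a) (hx : nd h m e I q a ∉ P)
    (hl : nd h m e I h j ∉ P ∧ nd h m e I h (j + 1) ∉ P)
    {s t : Raw} (hs : s ∈ P) (hsl : lam s < e) (hs1 : hi h d s = (I * NN h + 2 * j) * cc h d (e - 1))
    (ht : t ∈ P) (htl : lam t < e) (ht1 : lo h d t = (I * NN h + 2 * j + 3) * cc h d (e - 1)) :
    ∃ P', P' ⊆ P ∧ HC h d m (e - 1) (I * NN h + 2 * j + 1) P' := by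
  by_contra hcon
  obtain ⟨X, x1, x2, x3⟩ := blkcol (P := P) (fun P' h1 h2 => hcon ⟨P', h1, h2⟩)
  have hc := cc_pos h d (e - 1)
  set n := I * NN h + 2 * j with hn
  set c := cc h d (e - 1) with hcc
  have p2 : (n + 1) * c = n * c + c := by ring
  have p3 : (n + 1 + 1) * c = n * c + 2 * c := by ring
  have p4 : (n + 3) * c = n * c + 3 * c := by ring
  have q2 : (I * NN h + (2 * j + 1)) * c = n * c + c := by rw [hn]; ring
  have q3 : (I * NN h + (2 * j + 2)) * c = n * c + 2 * c := by rw [hn]; ring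
  have q4 : (I * NN h + (2 * j + 3)) * c = n * c + 3 * c := by rw [hn]; ring
  have w1 : (I * NN h + 2 * j) * cc h d (e - 1) = n * c := rfl
  have w2 : (I * NN h + (2 * j + 1)) * cc h d (e - 1) = n * c + c := q2
  have w3 : (I * NN h + (2 * j + 2)) * cc h d (e - 1) = n * c + 2 * c := q3
  have w4 : (I * NN h + (2 * j + 3)) * cc h d (e - 1) = n * c + 3 * c := q4
  have hlh : ∀ u ∈ P, lo h d u ≤ hi h d u := fun u hu =>
    lo_le_hi hh (hPs hu).1 (ne_root ((hPs hu).2.1.trans hem))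
  have key := zcut hh he hem hq ha hj hPs hx false
    {u | hi h d u ≤ n * c + c ∨ (n * c + c ≤ lo h d u ∧ hi h d u ≤ n * c + 2 * c ∧ u ∈ X)} (by
      intro u w hu hw hlu hlw hR
      obtain ⟨g, b1, b2⟩ := blk_RR hh hR (e' := e - 1) (by omega) (by omega) (by omega)
      have := hlh u hu
      have := hlh w hw
      rcases lt_trichotomy g (n + 1) with hg | hg | hg
      · have h1 : (g + 1) * c ≤ (n + 1) * c := Nat.mul_le_mul_right _ hg
        have : hi h d u ≤ (g + 1) * c := b1.2
        have : hi h d w ≤ (g + 1) * c := b2.2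
        simp only [Set.mem_setOf_eq]
        constructor <;> intro _ <;> left <;> omega
      · subst hg
        have hI : ∀ u ∈ P, InBlk h d (e - 1) (n + 1) u → lam u < e →
            (u ∈ {u | hi h d u ≤ n * c + c ∨ (n * c + c ≤ lo h d u ∧ hi h d u ≤ n * c + 2 * c ∧ u ∈ X)} ↔ u ∈ X) := by
          intro u hu b hl
          have b1 : (n + 1) * c ≤ lo h d u := b.1
          have b2 : hi h d u ≤ (n + 1 + 1) * c := b.2
          have := hlh u hu
          simp only [Set.mem_setOf_eq]
          constructor
          · rintro (h1 | h1)
            · exact x1 u hu (hPs hu).1 (by omega) (by omega) (by omega)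
            · exact h1.2.2
          · intro h1
            exact Or.inr ⟨by omega, by omega, h1⟩
        rw [hI u hu b1 hlu, hI w hw b2 hlw]
        exact x3 u w hu hw hR (by omega) (by omega) b1 b2
      · have h1 : (n + 1 + 1) * c ≤ g * c := Nat.mul_le_mul_right _ hg
        have hI : ∀ u ∈ P, InBlk h d (e - 1) g u → lam u < e →
            ¬ (u ∈ {u | hi h d u ≤ n * c + c ∨ (n * c + c ≤ lo h d u ∧ hi h d u ≤ n * c + 2 * c ∧ u ∈ X)}) := by
          intro u hu b hl
          have b1 : g * c ≤ lo h d u := b.1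
          have := hlh u hu
          rintro (h2 | h2)
          · omega
          · exact x2 u hu (hPs hu).1 (by omega) (by omega) (by omega) h2.2.2
        simp [hI u hu b1 hlu, hI w hw b2 hlw])
    (by intro u hu hl h1; left; omega)
    (by
      intro u hu hl h1
      have := hlh u hu
      rintro (h2 | h2) <;> omega)
    (by
      intro u hu hl h1 h2
      simp only [Set.mem_setOf_eq, iff_true]
      left; omega)
    (by
      intro u hu hl h1 h2
      simp only [Set.mem_setOf_eq, Bool.false_eq_true, iff_false]
      rintro (h3 | h3)
      · omega
      · exact x2 u hu (hPs hu).1 (by omega) (by omega) (by omega) h3.2.2)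
    (fun _ => hl)
  obtain ⟨u, w, k1, k2, k3, k4, k5⟩ := hP (Zc h d e I j false
    {u | hi h d u ≤ n * c + c ∨ (n * c + c ≤ lo h d u ∧ hi h d u ≤ n * c + 2 * c ∧ u ∈ X)}) s t hs
    (Or.inr ⟨hsl, Or.inl (by omega)⟩) ht (by
      rintro (h1 | h1)
      · omega
      · have := hlh t ht
        rcases h1.2 with h2 | h2 <;> omega)
  exact k4 ((key u w k1 k3 k5).mp k2)

set_option maxHeartbeats 1000000 in
theorem gapP {h d m : ℕ} (hh : 1 ≤ h) {e I q a j : ℕ} (he : 2 ≤ e) (hem : e ≤ m) (hq : q < h)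
    (ha : a < 2 ^ q) (hj : j + 1 = (2 * a + 1) * 2 ^ (h - (q + 1))) {P : Set Raw}
    (hP : Conn (RR h d m) P)
    (hPs : P ⊆ Dl h d m e I q a) (hx : nd h m e I q a ∉ P)
    (n1 : ∀ P', P' ⊆ P → HC h d m (e - 1) (I * NN h + 2 * j) P' → False)
    (n2 : ∀ P', P' ⊆ P → HC h d m (e - 1) (I * NN h + 2 * j + 1) P' → False)
    (n3 : ∀ P', P' ⊆ P → HC h d m (e - 1) (I * NN h + 2 * j + 1 + 1) P' → False)
    (hs : nd h m e I h j ∈ P) (ht : nd h m e I h (j + 1) ∈ P) : False := by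
  obtain ⟨X1, x1, x2, x3⟩ := blkcol n1
  obtain ⟨X2, y1, y2, y3⟩ := blkcol n2
  obtain ⟨X3, z1, z2, z3⟩ := blkcol n3
  have hj2 : j + 1 + 1 ≤ 2 ^ h := by
    have := child_rng (a := a) true hq
    have hp : 0 < 2 ^ (h - (q + 1)) := by positivity
    simp only [Bool.toNat_true] at this
    rw [add_mul (2 * a + 1) 1, one_mul] at this
    have := (dl_le hq.le ha).2
    omega
  have hc := cc_pos h d (e - 1)
  obtain ⟨lx, ly, lD, l1, l2, l3, l4, l5, l6, l7⟩ := nd_coord d hh hh le_rfl (show j < 2 ^ h by omega) he (m := m) (I := I)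
  obtain ⟨rx, ry, rD, r1, r2, r3, r4, r5, r6, r7⟩ := nd_coord d hh hh le_rfl (show j + 1 < 2 ^ h by omega) he (m := m) (I := I)
  have hN := NN_eq h
  simp only [Nat.sub_self, pow_zero] at l1 r1
  subst l1 r1
  set n := I * NN h + 2 * j with hn
  set c := cc h d (e - 1) with hcc
  have p2 : (n + 1) * c = n * c + c := by ring
  have p3 : (n + 1 + 1) * c = n * c + 2 * c := by ring
  have p4 : (n + 1 + 1 + 1) * c = n * c + 3 * c := by ring
  have q2 : (I * NN h + (2 * j + 1)) * c = n * c + c := by rw [hn]; ring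
  have q3 : (I * NN h + (2 * j + 2)) * c = n * c + 2 * c := by rw [hn]; ring
  have q4 : (I * NN h + (2 * j + 3)) * c = n * c + 3 * c := by rw [hn]; ring
  have w1 : (I * NN h + 2 * j) * cc h d (e - 1) = n * c := rfl
  have w2 : (I * NN h + (2 * j + 1)) * cc h d (e - 1) = n * c + c := q2
  have w3 : (I * NN h + (2 * j + 2)) * cc h d (e - 1) = n * c + 2 * c := q3
  have w4 : (I * NN h + (2 * j + 3)) * cc h d (e - 1) = n * c + 3 * c := q4
  have lr : hi h d (nd h m e I h j) ≤ n * c + c := by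
    rw [l6, ← q2]; apply uncmp; omega
  have rr : hi h d (nd h m e I h (j + 1)) = n * c + 3 * c := by
    rw [r6, ← q4]; congr 2; omega
  have hlh : ∀ u ∈ P, lo h d u ≤ hi h d u := fun u hu =>
    lo_le_hi hh (hPs hu).1 (ne_root ((hPs hu).2.1.trans hem))
  let Y : Set Raw := {u | hi h d u ≤ n * c ∨ (n * c ≤ lo h d u ∧ hi h d u ≤ n * c + c ∧ u ∈ X1) ∨
    (n * c + c ≤ lo h d u ∧ hi h d u ≤ n * c + 2 * c ∧ u ∉ X2) ∨
    (n * c + 2 * c ≤ lo h d u ∧ hi h d u ≤ n * c + 3 * c ∧ u ∈ X3)}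
  have a2 : ∀ u ∈ P, lam u < e → lo h d u = n * c + c → hi h d u = n * c + c → u ∉ X1 ∧ u ∈ X2 :=
    fun u hu hl h1 h2 => ⟨x2 u hu (hPs hu).1 (by omega) (by omega) (by omega),
      y1 u hu (hPs hu).1 (by omega) (by omega) (by omega)⟩
  have a3 : ∀ u ∈ P, lam u < e → lo h d u = n * c + 2 * c → hi h d u = n * c + 2 * c → u ∉ X2 ∧ u ∈ X3 :=
    fun u hu hl h1 h2 => ⟨y2 u hu (hPs hu).1 (by omega) (by omega) (by omega),
      z1 u hu (hPs hu).1 (by omega) (by omega) (by omega)⟩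
  have a1 : ∀ u ∈ P, lam u < e → lo h d u = n * c → hi h d u = n * c → u ∈ X1 :=
    fun u hu hl h1 h2 => x1 u hu (hPs hu).1 (by omega) (by omega) (by omega)
  have a4 : ∀ u ∈ P, lam u < e → lo h d u = n * c + 3 * c → hi h d u = n * c + 3 * c → u ∉ X3 :=
    fun u hu hl h1 h2 => z2 u hu (hPs hu).1 (by omega) (by omega) (by omega)
  have Y0 : ∀ u ∈ P, hi h d u ≤ n * c → u ∈ Y := fun u hu h1 => Or.inl h1
  have Y1 : ∀ u ∈ P, lam u < e → n * c ≤ lo h d u → hi h d u ≤ n * c + c → (u ∈ Y ↔ u ∈ X1) := by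
    intro u hu hl h1 h2
    have := hlh u hu
    constructor
    · rintro (h3 | h3 | h3 | h3)
      · exact a1 u hu hl (by omega) (by omega)
      · exact h3.2.2
      · exact absurd (a2 u hu hl (by omega) (by omega)).2 h3.2.2
      · omega
    · intro h3; exact Or.inr (Or.inl ⟨h1, h2, h3⟩)
  have Y2 : ∀ u ∈ P, lam u < e → n * c + c ≤ lo h d u → hi h d u ≤ n * c + 2 * c → (u ∈ Y ↔ u ∉ X2) := by
    intro u hu hl h1 h2
    have := hlh u hu
    constructor
    · rintro (h3 | h3 | h3 | h3)
      · omega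
      · exact absurd h3.2.2 (a2 u hu hl (by omega) (by omega)).1
      · exact h3.2.2
      · exact (a3 u hu hl (by omega) (by omega)).1
    · intro h3; exact Or.inr (Or.inr (Or.inl ⟨h1, h2, h3⟩))
  have Y3 : ∀ u ∈ P, lam u < e → n * c + 2 * c ≤ lo h d u → hi h d u ≤ n * c + 3 * c → (u ∈ Y ↔ u ∈ X3) := by
    intro u hu hl h1 h2
    have := hlh u hu
    constructor
    · rintro (h3 | h3 | h3 | h3)
      · omega
      · omega
      · exact (a3 u hu hl (by omega) (by omega)).2
      · exact h3.2.2
    · intro h3; exact Or.inr (Or.inr (Or.inr ⟨h1, h2, h3⟩))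
  have Y4 : ∀ u ∈ P, lam u < e → n * c + 3 * c ≤ lo h d u → u ∉ Y := by
    intro u hu hl h1
    have := hlh u hu
    rintro (h3 | h3 | h3 | h3)
    · omega
    · omega
    · omega
    · exact a4 u hu hl (by omega) (by omega) h3.2.2
  have key := zcut hh he hem hq ha hj hPs hx true Y (by
      intro u w hu hw hlu hlw hR
      obtain ⟨g, b1, b2⟩ := blk_RR hh hR (e' := e - 1) (by omega) (by omega) (by omega)
      have f1 : g * c ≤ lo h d u := b1.1
      have f2 : hi h d u ≤ (g + 1) * c := b1.2
      have f3 : g * c ≤ lo h d w := b2.1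
      have f4 : hi h d w ≤ (g + 1) * c := b2.2
      rcases lt_or_ge g n with hg | hg
      · have h1 : (g + 1) * c ≤ n * c := Nat.mul_le_mul_right _ hg
        simp [Y0 u hu (by omega), Y0 w hw (by omega)]
      by_cases g0 : g = n
      · subst g0
        rw [Y1 u hu hlu (by omega) (by omega), Y1 w hw hlw (by omega) (by omega)]
        exact x3 u w hu hw hR (by omega) (by omega) b1 b2
      by_cases g1 : g = n + 1
      · subst g1
        rw [Y2 u hu hlu (by omega) (by omega), Y2 w hw hlw (by omega) (by omega)]
        exact not_congr (y3 u w hu hw hR (by omega) (by omega) b1 b2)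
      by_cases g2 : g = n + 1 + 1
      · subst g2
        rw [Y3 u hu hlu (by omega) (by omega), Y3 w hw hlw (by omega) (by omega)]
        exact z3 u w hu hw hR (by omega) (by omega) b1 b2
      · have h1 : (n + 1 + 1 + 1) * c ≤ g * c := Nat.mul_le_mul_right _ (by omega)
        simp [Y4 u hu hlu (by omega), Y4 w hw hlw (by omega)])
    (by intro u hu hl h1; exact Y0 u hu h1)
    (by intro u hu hl h1; exact Y4 u hu hl (by omega))
    (by
      intro u hu hl h1 h2
      rw [Y1 u hu hl (by omega) (by omega)]
      simp [(a2 u hu hl (by omega) (by omega)).1])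
    (by
      intro u hu hl h1 h2
      rw [Y3 u hu hl (by omega) (by omega)]
      simp [(a3 u hu hl (by omega) (by omega)).2])
    (fun hf => by simp at hf)
  obtain ⟨u, w, k1, k2, k3, k4, k5⟩ := hP (Zc h d e I j true Y) _ _ hs
    (Or.inl ⟨lam_nd hh hh (by omega), Or.inl (by omega)⟩) ht (by
      have := lam_nd (h := h) (m := m) (e := e) (I := I) hh hh (show j + 1 < 2 ^ h by omega)
      rintro (h1 | h1)
      · rcases h1.2 with h2 | h2
        · omega
        · exact h2.1 (nd_ff hh (by omega))
      · omega)
  exact k4 ((key u w k1 k3 k5).mp k2)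

def HNo (h d m e : ℕ) : Prop := ∀ g, g < NN h ^ (m - e) → ∀ P Q : Set Raw,
  HC h d m e g P → HC h d m e g Q → Far (RR h d m) P Q → False

theorem gidx {h m e I k : ℕ} (he : 2 ≤ e) (hem : e ≤ m) (hI : I < NN h ^ (m - e)) (hk : k < NN h) :
    I * NN h + k < NN h ^ (m - (e - 1)) := by
  have : NN h ^ (m - (e - 1)) = NN h ^ (m - e) * NN h := by rw [← pow_succ]; congr 1; omega
  rw [this]
  have := mulstep (N := NN h) hI
  omega

theorem coreA {h d m : ℕ} (hh : 1 ≤ h) {e I q a : ℕ} (he : 2 ≤ e) (hem : e ≤ m) (hI : I < NN h ^ (m - e)) (hq : q < h)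
    (ha : a < 2 ^ q) (hno : HNo h d m (e - 1)) (hLA : ∀ q', q < q' → q' ≤ h → LA h d m e I q')
    {P Q P0 P1 Q0 Q1 : Set Raw} (hP : Conn (RR h d m) P) (hPs : P ⊆ Dl h d m e I q a)
    (hQ : Conn (RR h d m) Q) (hQs : Q ⊆ Dl h d m e I q a) (hxP : nd h m e I q a ∉ P) (hxQ : nd h m e I q a ∉ Q)
    (hf : Far (RR h d m) P Q) (sP0 : P0 ⊆ P) (sP1 : P1 ⊆ P) (sQ0 : Q0 ⊆ Q) (sQ1 : Q1 ⊆ Q)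
    (cP0 : Cross h d m e I ((2 * a) * 2 ^ (h - (q + 1))) ((2 * a + 1) * 2 ^ (h - (q + 1))) P0)
    (cQ0 : Cross h d m e I ((2 * a) * 2 ^ (h - (q + 1))) ((2 * a + 1) * 2 ^ (h - (q + 1))) Q0)
    (cP1 : Cross h d m e I ((2 * a + 1) * 2 ^ (h - (q + 1))) ((2 * a + 1 + 1) * 2 ^ (h - (q + 1))) P1)
    (cQ1 : Cross h d m e I ((2 * a + 1) * 2 ^ (h - (q + 1))) ((2 * a + 1 + 1) * 2 ^ (h - (q + 1))) Q1)
    (x0 : nd h m e I (q + 1) (2 * a) ∈ P0) (x1 : nd h m e I (q + 1) (2 * a + 1) ∈ P1) : False := by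
  have l0 := child_lt false ha
  have l1 := child_lt true ha
  simp only [Bool.toNat_false, Bool.toNat_true, add_zero] at l0 l1
  obtain ⟨r1, Q0', sQ0', cQ0'⟩ := chainR hh he hem hI cP0.conn cP0.sub (hf.mono sP0 sQ0) cP0.T (h - (q + 1)) (q + 1) (2 * a)
    (by omega) (by omega) l0 rfl (fun q' h1 h2 => hLA q' (by omega) h2) x0 ⟨Q0, le_rfl, cQ0⟩
  obtain ⟨r2, Q1', sQ1', cQ1'⟩ := chainL hh he hem hI cP1.conn cP1.sub (hf.mono sP1 sQ1) cP1.S (h - (q + 1)) (q + 1) (2 * a + 1)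
    (by omega) (by omega) l1 rfl (fun q' h1 h2 => hLA q' (by omega) h2) x1 ⟨Q1, le_rfl, cQ1⟩
  have hB : 1 ≤ (2 * a + 1) * 2 ^ (h - (q + 1)) := Nat.succ_le_of_lt (by positivity)
  obtain ⟨j, hj⟩ : ∃ j, j + 1 = (2 * a + 1) * 2 ^ (h - (q + 1)) := ⟨(2 * a + 1) * 2 ^ (h - (q + 1)) - 1, by omega⟩
  rw [← hj] at r1 r2 cQ0' cQ1'
  simp only [Nat.add_sub_cancel] at r1 cQ0'
  have hj2 : j + 1 + 1 ≤ 2 ^ h := by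
    have := child_rng (a := a) true hq
    have hp : 0 < 2 ^ (h - (q + 1)) := by positivity
    simp only [Bool.toNat_true] at this
    rw [add_mul (2 * a + 1) 1, one_mul] at this
    have := (dl_le hq.le ha).2
    omega
  have nQ : ∀ z, z ∈ P → z ∉ Q := fun z h1 h2 => (hf z z h1 h2).1 rfl
  have r1P := sP0 r1
  have r2P := sP1 r2
  have hc0 := cross_leaf hh he hem (by omega) cQ0' (fun hc => nQ _ r1P (sQ0 (sQ0' hc)))
  have hc1 := cross_leaf hh he hem (by omega) cQ1' (fun hc => nQ _ r2P (sQ1 (sQ1' hc)))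
  have e2 : I * NN h + 2 * (j + 1) = I * NN h + 2 * j + 1 + 1 := by ring
  rw [e2] at hc1
  obtain ⟨s, s1, s2, s3⟩ := hc0.S
  obtain ⟨t, t1, t2, t3⟩ := hc1.T
  have hs := (hc0.sub s1).2.1
  have ht := (hc1.sub t1).2.1
  obtain ⟨Q', sQ', cQ'⟩ := crossM hh he hem hq ha hj hQ hQs hxQ ⟨nQ _ r1P, nQ _ r2P⟩
    (sQ0 (sQ0' s1)) (by omega) s3 (sQ1 (sQ1' t1)) (by omega) t2
  have hN := NN_eq h
  refine gapP hh he hem hq ha hj hP hPs hxP ?_ ?_ ?_ r1P r2P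
  · intro P' h1 h2
    exact hno _ (gidx he hem hI (by omega)) P' Q0' h2 hc0 (hf.mono h1 (sQ0'.trans sQ0))
  · intro P' h1 h2
    exact hno _ (gidx (k := 2 * j + 1) he hem hI (by omega)) P' Q' h2 cQ' (hf.mono h1 sQ')
  · intro P' h1 h2
    exact hno _ (gidx (k := 2 * j + 1 + 1) he hem hI (by omega)) P' Q1' h2 hc1 (hf.mono h1 (sQ1'.trans sQ1))

theorem LA_all {h d m : ℕ} (hh : 1 ≤ h) {e I : ℕ} (he : 2 ≤ e) (hem : e ≤ m) (hI : I < NN h ^ (m - e))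
    (hno : HNo h d m (e - 1)) : ∀ n q, q + n = h → ∀ q', q ≤ q' → q' ≤ h → LA h d m e I q' := by
  intro n
  induction n with
  | zero =>
    intro q hq q' h1 h2 a ha P Q cP cQ hf
    have : q' = h := by omega
    subst this
    simp only [Nat.sub_self, pow_zero, mul_one] at cP cQ
    by_contra hcon
    push Not at hcon
    have hN := NN_eq q'
    exact hno _ (gidx he hem hI (by omega)) P Q (cross_leaf hh he hem ha cP hcon.1) (cross_leaf hh he hem ha cQ hcon.2) hf
  | succ n ih =>
    intro q hq q' h1 h2
    by_cases hqq : q + 1 ≤ q'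
    · exact ih (q + 1) (by omega) q' hqq h2
    have : q' = q := by omega
    subst this
    intro a ha P Q cP cQ hf
    by_contra hcon
    push Not at hcon
    have hq' : q' < h := by omega
    have hLA : ∀ q'', q' < q'' → q'' ≤ h → LA h d m e I q'' := fun q'' k1 k2 => ih (q' + 1) (by omega) q'' k1 k2
    obtain ⟨d1, d2⟩ := dl_le h2 ha
    have hp : 0 < 2 ^ (h - (q' + 1)) := by positivity
    have m1 : (2 * a + 1) * 2 ^ (h - (q' + 1)) < (a + 1) * 2 ^ (h - q') := by
      rw [child_pow hq', ← mul_assoc]; exact Nat.mul_lt_mul_of_pos_right (by omega) hp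
    have m2 : a * 2 ^ (h - q') < (2 * a + 1) * 2 ^ (h - (q' + 1)) := by
      rw [child_pow hq', ← mul_assoc]; exact Nat.mul_lt_mul_of_pos_right (by omega) hp
    obtain ⟨P0, sP0, cP0⟩ := restrL hh he hem hq' ha cP hcon.1 m1 d2
    obtain ⟨Q0, sQ0, cQ0⟩ := restrL hh he hem hq' ha cQ hcon.2 m1 d2
    obtain ⟨P1, sP1, cP1⟩ := restrR hh he hem hq' ha cP hcon.1 m2
    obtain ⟨Q1, sQ1, cQ1⟩ := restrR hh he hem hq' ha cQ hcon.2 m2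
    have l0 := child_lt false ha
    have l1 := child_lt true ha
    have t0 := RR_tree (d := d) (b := false) hh hq' ha he hem hI
    have t1 := RR_tree (d := d) (b := true) hh hq' ha he hem hI
    simp only [Bool.toNat_false, Bool.toNat_true, add_zero] at l0 l1 t0 t1
    have hf' := hf.symm RR_symm
    rcases hLA (q' + 1) (by omega) (by omega) (2 * a) l0 P0 Q0 cP0 cQ0 (hf.mono sP0 sQ0) with g0 | g0 <;>
    rcases hLA (q' + 1) (by omega) (by omega) (2 * a + 1) l1 P1 Q1 cP1 cQ1 (hf.mono sP1 sQ1) with g1 | g1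
    · exact coreA hh he hem hI hq' ha hno hLA cP.conn cP.sub cQ.conn cQ.sub hcon.1 hcon.2 hf sP0 sP1 sQ0 sQ1 cP0 cQ0 cP1 cQ1 g0 g1
    · exact (hf _ _ (sP0 g0) (sQ1 g1)).2.2 _ (RR_symm _ _ t0) t1
    · exact (hf _ _ (sP1 g1) (sQ0 g0)).2.2 _ (RR_symm _ _ t1) t0
    · exact coreA hh he hem hI hq' ha hno hLA cQ.conn cQ.sub cP.conn cP.sub hcon.2 hcon.1 hf' sQ0 sQ1 sP0 sP1 cQ0 cP0 cQ1 cP1 g0 g1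

theorem HNo_all {h d m : ℕ} (hh : 1 ≤ h) : ∀ e, 1 ≤ e → e ≤ m → HNo h d m e := by
  intro e he
  induction e, he using Nat.le_induction with
  | base =>
    intro hm g hg P Q hP hQ hf
    obtain ⟨s, s1, s2, s3⟩ := hP.S
    obtain ⟨t, t1, t2, t3⟩ := hQ.S
    have a1 := hP.sub s1
    have a2 := hQ.sub t1
    have b1 := one_le_lam a1.1
    have b2 := one_le_lam a2.1
    have e1 := pt_unique hh a1.1 le_rfl hm (le_antisymm a1.2.1 b1) s2 s3
    have e2 := pt_unique hh a2.1 le_rfl hm (le_antisymm a2.2.1 b2) t2 t3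
    exact (hf s t s1 t1).1 (e1.trans e2.symm)
  | succ e he ih =>
    intro hm g hg P Q hP hQ hf
    have hLA := LA_all hh (by omega : 2 ≤ e + 1) hm hg (ih (by omega)) h 0 (by omega) 0 le_rfl (by omega)
    have hN := NN_eq h
    have hH := two_le_H hh
    have hA : lA h d (e + 1) g 0 = g * cc h d (e + 1) := by
      rw [lA, cc_succ (by omega : 2 ≤ e + 1)]; ring
    have hB : lB h d (e + 1) g (2 ^ h) = (g + 1) * cc h d (e + 1) := by
      rw [lB, cc_succ (by omega : 2 ≤ e + 1)]
      have : 2 * 2 ^ h - 1 = NN h := by omega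
      rw [this]; ring
    have conv : ∀ P, HC h d m (e + 1) g P → Cross h d m (e + 1) g (0 * 2 ^ (h - 0)) ((0 + 1) * 2 ^ (h - 0)) P := by
      intro P hP
      simp only [zero_mul, zero_add, one_mul, Nat.sub_zero]
      refine ⟨hP.conn, ?_, ?_, ?_⟩
      · have := hP.sub
        rwa [Cl, hA, hB]
      · obtain ⟨s, s1, s2, s3⟩ := hP.S
        refine ⟨s, s1, ?_⟩
        have a1 := hP.sub s1
        by_cases hl : lam s < e + 1
        · left; rw [hA]; exact ⟨hl, s2, s3⟩
        · right
          rw [nd_first (d := d) hh (by omega)]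
          exact pt_unique hh a1.1 (by omega) hm (by have := a1.2.1; omega) s2 s3
      · obtain ⟨s, s1, s2, s3⟩ := hP.T
        refine ⟨s, s1, ?_⟩
        have a1 := hP.sub s1
        by_cases hl : lam s < e + 1
        · left; rw [hB]; exact ⟨hl, s2, s3⟩
        · right
          rw [nd_last (d := d) hh (by omega)]
          exact pt_unique hh a1.1 (by omega) hm (by have := a1.2.1; omega) s2 s3
    rcases hLA 0 (by norm_num) P Q (conv P hP) (conv Q hQ) hf with h1 | h1
    · rw [nd_root] at h1
      exact ne_root ((hP.sub h1).2.1.trans hm) rfl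
    · rw [nd_root] at h1
      exact ne_root ((hQ.sub h1).2.1.trans hm) rfl

/-- Lemma A: at most two far sets cross the cell of a node. -/
theorem lemmaA {h d m : ℕ} (hh : 1 ≤ h) {e I q a : ℕ} (he : 2 ≤ e) (hem : e ≤ m) (hI : I < NN h ^ (m - e))
    (hq : q ≤ h) (ha : a < 2 ^ q) (P : Fin 3 → Set Raw)
    (hP : ∀ i, Cross h d m e I (a * 2 ^ (h - q)) ((a + 1) * 2 ^ (h - q)) (P i))
    (hf : ∀ i j, i ≠ j → Far (RR h d m) (P i) (P j)) : False := by
  have hL := LA_all hh he hem hI (HNo_all (d := d) hh (e - 1) (by omega) (by omega)) h 0 (by omega) q (by omega) hq a ha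
  have h0 : ∀ i j, i ≠ j → nd h m e I q a ∈ P i → nd h m e I q a ∈ P j → False :=
    fun i j hij h1 h2 => (hf i j hij _ _ h1 h2).1 rfl
  have h01 := hL (P 0) (P 1) (hP 0) (hP 1) (hf 0 1 (by decide))
  have h02 := hL (P 0) (P 2) (hP 0) (hP 2) (hf 0 2 (by decide))
  have h12 := hL (P 1) (P 2) (hP 1) (hP 2) (hf 1 2 (by decide))
  have k01 := h0 0 1 (by decide)
  have k02 := h0 0 2 (by decide)
  have k12 := h0 1 2 (by decide)
  tauto

end Ghdm
namespace Ghdm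

theorem sp_inj {e I j f s e' I' j' f' s' : ℕ} {c c' : Bool} (h : sp e I j c f s = sp e' I' j' c' f' s') :
    e = e' ∧ I = I' ∧ j = j' ∧ c = c' ∧ f = f' ∧ s = s' := by
  have hs := congrArg side h
  rw [sp_side, sp_side] at hs
  subst hs
  cases c <;> simp [sp] at h <;> simp <;> omega

theorem sleaf_ff {h m e I j f : ℕ} {c : Bool} (hh : 1 ≤ h) (hs : SOK h m e I j f) : ff (sleaf h m e I j c) = 0 :=
  nd_ff hh (leaf_lt hs)

theorem onstar_sp {h d m e I j f s e' I' j' f' : ℕ} {c c' : Bool} (hh : 1 ≤ h) (hs : SOK h m e I j f)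
    (hs' : SOK h m e' I' j' f') (hO : OnStar h d m e' I' j' c' f' (sp e I j c f s)) :
    e = e' ∧ I = I' ∧ j = j' ∧ c = c' ∧ f = f' := by
  have := hs.f1
  rcases hO with h1 | ⟨s', _, _, h1⟩ | h1
  · have := congrArg ff h1
    rw [sp_ff, sleaf_ff hh hs'] at this; omega
  · obtain ⟨a, b, c, d, e, _⟩ := sp_inj h1
    exact ⟨a, b, c, d, e⟩
  · have := congrArg ff h1
    rw [sp_ff, sfoot, pt_ff] at this; omega

theorem sp_nbr {h d m e I j f s : ℕ} {c : Bool} {w : Raw} (hh : 1 ≤ h) (hs : SOK h m e I j f)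
    (hR : RR h d m (sp e I j c f s) w) (hw : w ≠ RootR m) : OnStar h d m e I j c f w := by
  have h0 := hs.e2
  have h0' := hs.f1
  rcases RR_three hh hR (ne_root (by rw [sp_lam]; exact hs.em)) hw with h1 | ⟨e', I', q', a', b, h1, h2, h3, h4, h5, h6, h7⟩ | ⟨e', I', j', c', f', hs', h1, h2⟩
  · rw [sp_lam] at h1; omega
  · exfalso
    rcases h7 with ⟨h7, _⟩ | ⟨_, h7⟩
    · have := congrArg ff h7
      rw [sp_ff, nd_ff h4 h6] at this; omega
    · have := congrArg ff h7
      rw [sp_ff, nd_ff (by omega) (child_lt b h6)] at this; omega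
  · obtain ⟨rfl, rfl, rfl, rfl, rfl⟩ := onstar_sp hh hs hs' h1
    exact h2

/-- position of the foot of a star -/
def fpos (h d e I j : ℕ) (c : Bool) : ℕ := (I * NN h + (2 * j + 1 + c.toNat)) * cc h d (e - 1)

theorem fpos_lt_absurd {h d e I j e' I' j' : ℕ} {c c' : Bool} (he : 2 ≤ e) (hlt : e < e') (hj : j + 1 < 2 ^ h)
    (hE : fpos h d e I j c = fpos h d e' I' j' c') : False := by
  unfold fpos at hE
  rw [cc_add (by omega : 1 ≤ e) (by omega : e ≤ e' - 1), cc_succ he, ← mul_assoc, ← mul_assoc] at hE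
  have := Nat.eq_of_mul_eq_mul_right (cc_pos h d (e - 1)) hE
  have hN := NN_eq h
  have h2 := congrArg (· % NN h) this
  simp only [Nat.mul_mod_left, Nat.mul_add_mod_self_right] at h2
  rw [Nat.mod_eq_of_lt (by cases c <;> simp <;> omega)] at h2
  omega

theorem fpos_inj {h d e I j e' I' j' : ℕ} {c c' : Bool} (he : 2 ≤ e) (he' : 2 ≤ e') (hj : j + 1 < 2 ^ h) (hj' : j' + 1 < 2 ^ h)
    (hE : fpos h d e I j c = fpos h d e' I' j' c') : e = e' ∧ I = I' ∧ j = j' ∧ c = c' := by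
  rcases lt_trichotomy e e' with h1 | h1 | h1
  · exact (fpos_lt_absurd he h1 hj hE).elim
  · subst h1
    have := Nat.eq_of_mul_eq_mul_right (cc_pos h d (e - 1)) hE
    have hN := NN_eq h
    have hI : I = I' := by
      rcases lt_trichotomy I I' with h2 | h2 | h2
      · have := mulstep (N := NN h) h2
        cases c <;> cases c' <;> simp at * <;> omega
      · exact h2
      · have := mulstep (N := NN h) h2
        cases c <;> cases c' <;> simp at * <;> omega
    subst hI
    cases c <;> cases c' <;> simp at * <;> omega
  · exact (fpos_lt_absurd he' h1 hj' hE.symm).elim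

/-- the leaf whose spines end at position `pos` -/
def Lf (h d m pos : ℕ) : Set Raw :=
  {x | ∃ e I j c f, SOK h m e I j f ∧ fpos h d e I j c = pos ∧ x = sleaf h m e I j c}

theorem lf_sub {h d m pos : ℕ} {x y : Raw} (hx : x ∈ Lf h d m pos) (hy : y ∈ Lf h d m pos) : x = y := by
  obtain ⟨e, I, j, c, f, hs, h1, rfl⟩ := hx
  obtain ⟨e', I', j', c', f', hs', h1', rfl⟩ := hy
  obtain ⟨rfl, rfl, rfl, rfl⟩ := fpos_inj hs.e2 hs'.e2 hs.hj hs'.hj (h1.trans h1'.symm)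
  rfl

/-- box part of the neighbourhood -/
def NB0 (h d m j pos : ℕ) : Set Raw :=
  {u | Valid h d m u ∧ lam u ≤ j ∧ pos ≤ lo h d u + cc h d j ∧ hi h d u ≤ pos + cc h d j ∧
    (hi h d u ≤ pos ∨ pos ≤ lo h d u)}

/-- spine part of the neighbourhood -/
def NB1 (h d m j pos : ℕ) : Set Raw :=
  {u | ∃ e I i c f s, SOK h m e I i f ∧ fpos h d e I i c = pos ∧ f ≤ j ∧ u = sp e I i c f s}

def NB (h d m j pos : ℕ) : Set Raw := NB0 h d m j pos ∪ NB1 h d m j pos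

theorem cc_mono {h d j j' : ℕ} (hj : j ≤ j') : cc h d j ≤ cc h d j' := by
  unfold cc
  exact Nat.mul_le_mul_right _ (Nat.pow_le_pow_right (NN_pos h) (by omega))

theorem NB_mono {h d m j j' pos : ℕ} (hj : j ≤ j') : NB h d m j pos ⊆ NB h d m j' pos := by
  have := cc_mono (h := h) (d := d) hj
  rintro u (⟨h1, h2, h3, h4, h5⟩ | ⟨e, I, i, c, f, s, h1, h2, h3, h4⟩)
  · exact Or.inl ⟨h1, by omega, by omega, by omega, h5⟩
  · exact Or.inr ⟨e, I, i, c, f, s, h1, h2, by omega, h4⟩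

theorem sfoot_fpos {h d m e I j f : ℕ} {c : Bool} (hh : 1 ≤ h) (hs : SOK h m e I j f) :
    lo h d (sfoot h d e I j c f) = fpos h d e I j c ∧ hi h d (sfoot h d e I j c f) = fpos h d e I j c :=
  ⟨sfoot_lo hh hs, sfoot_hi hh hs⟩

theorem NB1_nbr {h d m j pos : ℕ} (hh : 1 ≤ h) {u w : Raw} (hu : u ∈ NB1 h d m j pos) (hR : RR h d m u w)
    (hw : w ≠ RootR m) (hl : w ∉ Lf h d m pos) :
    w ∈ NB1 h d m j pos ∨ (w ∈ NB0 h d m j pos ∧ lo h d w = pos ∧ hi h d w = pos) := by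
  obtain ⟨e, I, i, c, f, s, h1, h2, h3, rfl⟩ := hu
  rcases sp_nbr hh h1 hR hw with k | ⟨s', _, _, k⟩ | k
  · exact absurd ⟨e, I, i, c, f, h1, h2, k⟩ hl
  · exact Or.inl ⟨e, I, i, c, f, s', h1, h2, h3, k⟩
  · right
    obtain ⟨a1, a2⟩ := sfoot_fpos (d := d) (c := c) hh h1
    have a3 : lam w = f := by rw [k]; exact sfoot_lam hh
    rw [← k, h2] at a1 a2
    exact ⟨⟨hR.2.1, by omega, by omega, by omega, by omega⟩, a1, a2⟩

theorem NB0_exit {h d m j pos G : ℕ} (hh : 1 ≤ h) (hj : 1 ≤ j) (hjm : j ≤ m) (hpos : pos = G * cc h d j) {u w : Raw}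
    (hu : u ∈ NB0 h d m j pos) (hR : RR h d m u w)
    (hw : w ≠ RootR m) (hl : w ∉ Lf h d m pos) (hwn : w ∉ NB h d m j pos) :
    (lo h d u = pos + cc h d j ∧ hi h d u = pos + cc h d j) ∨
    (lo h d u + cc h d j = pos ∧ hi h d u + cc h d j = pos) := by
  obtain ⟨uv, ul, u1, u2, u3⟩ := hu
  have hlu := lo_le_hi hh uv (ne_root (ul.trans hjm))
  have hlw := lo_le_hi hh hR.2.1 hw
  have hc := cc_pos h d j
  have hG : ∀ g, pos + cc h d j < (g + 1) * cc h d j → pos + cc h d j ≤ g * cc h d j := by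
    intro g hg
    have : (G + 1) * cc h d j < (g + 1) * cc h d j := by rw [add_mul, one_mul, ← hpos]; exact hg
    have := Nat.lt_of_mul_lt_mul_right this
    have : (G + 1) * cc h d j ≤ g * cc h d j := Nat.mul_le_mul_right _ (by omega)
    rw [add_mul, one_mul, ← hpos] at this
    exact this
  have hG2 : ∀ g, g * cc h d j + cc h d j < pos → (g + 1) * cc h d j + cc h d j ≤ pos := by
    intro g hg
    have : (g + 1) * cc h d j < G * cc h d j := by rw [add_mul, one_mul, ← hpos]; exact hg
    have := Nat.lt_of_mul_lt_mul_right this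
    have : (g + 1 + 1) * cc h d j ≤ G * cc h d j := Nat.mul_le_mul_right _ (by omega)
    rw [add_mul (g + 1), one_mul, ← hpos] at this
    exact this
  by_cases hlam : lam w ≤ j
  · obtain ⟨g, ⟨b1, b2⟩, ⟨b3, b4⟩⟩ := blk_RR hh hR hjm ul hlam
    have hside : hi h d w ≤ pos ∨ pos ≤ lo h d w := by
      rcases Nat.lt_or_ge g G with hg | hg
      · left
        have : (g + 1) * cc h d j ≤ G * cc h d j := Nat.mul_le_mul_right _ hg
        omega
      · right
        have : G * cc h d j ≤ g * cc h d j := Nat.mul_le_mul_right _ hg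
        omega
    by_cases hA : pos ≤ lo h d w + cc h d j
    · by_cases hB : hi h d w ≤ pos + cc h d j
      · exact absurd (Or.inl ⟨hR.2.1, hlam, hA, hB, hside⟩) hwn
      · left
        have := hG g (by omega)
        omega
    · right
      have := hG2 g (by omega)
      omega
  · rcases RR_three hh hR (ne_root (ul.trans hjm)) hw with h1 | ⟨e', I', q', a', b, h1, h2, h3, h4, h5, h6, h7⟩ | ⟨e', I', j', c', f', hs', h1, h2⟩
    · omega
    · exfalso
      have l1 := lam_nd (h := h) (m := m) (e := e') (I := I') hh h4 h6
      have l2 := lam_nd (h := h) (m := m) (e := e') (I := I') hh (by omega) (child_lt b h6)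
      rcases h7 with ⟨rfl, rfl⟩ | ⟨rfl, rfl⟩ <;> omega
    · have hfe := hs'.fe
      have hlw' : lam w = e' ∨ lam w = f' := by
        rcases h2 with rfl | ⟨s, _, _, rfl⟩ | rfl
        · exact Or.inl (sleaf_lam hh hs')
        · exact Or.inl sp_lam
        · exact Or.inr (sfoot_lam hh)
      have huf : u = sfoot h d e' I' j' c' f' := by
        rcases h1 with rfl | ⟨s, _, _, rfl⟩ | h1
        · rw [sleaf_lam hh hs'] at ul; omega
        · rw [sp_lam] at ul; omega
        · exact h1
      have hluf : lam u = f' := by rw [huf]; exact sfoot_lam hh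
      have hwe : lam w = e' := by omega
      obtain ⟨G', g1, g2⟩ := foot_mult (d := d) (c := c') hh hs' hj (by omega) (by omega : f' ≤ j)
      rw [← huf] at g1 g2
      obtain ⟨a1, a2⟩ := sfoot_fpos (d := d) (c := c') hh hs'
      rw [← huf] at a1 a2
      rcases lt_trichotomy G' G with hg | hg | hg
      · right
        have : (G' + 1) * cc h d j ≤ G * cc h d j := Nat.mul_le_mul_right _ hg
        rw [add_mul, one_mul] at this
        omega
      · exfalso
        subst hg
        rcases h2 with h2 | ⟨s, _, _, h2⟩ | h2
        · exact hl ⟨e', I', j', c', f', hs', by omega, h2⟩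
        · exact hwn (Or.inr ⟨e', I', j', c', f', s, hs', by omega, by omega, h2⟩)
        · have : lam w = f' := by rw [h2]; exact sfoot_lam hh
          omega
      · left
        have : (G + 1) * cc h d j ≤ G' * cc h d j := Nat.mul_le_mul_right _ hg
        rw [add_mul, one_mul] at this
        omega
end Ghdm
namespace Ghdm

theorem blk_le {h d m e I x : ℕ} (he : 2 ≤ e) (hem : e ≤ m) (hI : I < NN h ^ (m - e)) (hx : x ≤ NN h) :
    (I * NN h + x) * cc h d (e - 1) ≤ cc h d m := by
  rw [cc_add (h := h) (d := d) (by omega : 1 ≤ e) hem, cc_succ he, ← mul_assoc]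
  apply Nat.mul_le_mul_right
  have := mulstep (N := NN h) hI
  omega

theorem hi_le {h d m : ℕ} {u : Raw} (hh : 1 ≤ h) (hv : Valid h d m u) (hu : u ≠ RootR m) : hi h d u ≤ cc h d m := by
  have hN := NN_eq h
  rcases valid_cases hv hu with ⟨k, rfl, hk⟩ | ⟨e, I, q, a, h1, h2, h3, h4, h5, h6, rfl⟩ | ⟨e, I, j, c, f, s, h1, h2, h3, rfl⟩
  · show k ≤ _
    unfold cc; rw [mul_comm]; exact hk
  · obtain ⟨x, y, D, k1, k2, k3, k4, k5, k6, k7⟩ := nd_coord (m := m) (I := I) d hh h4 h5 h6 h1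
    rw [k6]
    exact blk_le h1 h2 h3 (by omega)
  · rw [sp_hi]
    have := h1.hj
    exact blk_le h1.e2 h1.em h1.hI (by omega)

theorem tt_coord {h d m e I : ℕ} {u : Raw} (hh : 1 ≤ h) (he : 2 ≤ e) (hu : u ∈ TT h d m e I (2 ^ h)) :
    lo h d u = (I + 1) * cc h d e ∧ hi h d u = (I + 1) * cc h d e := by
  have hN := NN_eq h
  have hl : lB h d e I (2 ^ h) = (I + 1) * cc h d e := by
    unfold lB; rw [cc_succ he, ← mul_assoc]; congr 1
    rw [add_mul]; omega
  rcases hu with ⟨_, h1, h2⟩ | h1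
  · rw [h1, h2, hl]; simp
  · rw [h1, nd_last (d := d) hh he, lo_pt hh (by omega), hi_pt hh (by omega)]; simp

theorem ss_coord {h d m e I : ℕ} {u : Raw} (hh : 1 ≤ h) (he : 2 ≤ e) (hu : u ∈ SS h d m e I 0) :
    lo h d u = I * cc h d e ∧ hi h d u = I * cc h d e := by
  have hl : lA h d e I 0 = I * cc h d e := by
    unfold lA; rw [cc_succ he, ← mul_assoc]; simp
  rcases hu with ⟨_, h1, h2⟩ | h1
  · rw [h1, h2, hl]; simp
  · rw [h1, nd_first (d := d) hh he, lo_pt hh (by omega), hi_pt hh (by omega)]; simp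

theorem tt_mem {h d m e I : ℕ} {u : Raw} (hh : 1 ≤ h) (he : 2 ≤ e) (hem : e ≤ m) (hv : Valid h d m u) (hl : lam u ≤ e)
    (h1 : lo h d u = (I + 1) * cc h d e) (h2 : hi h d u = (I + 1) * cc h d e) : u ∈ TT h d m e I (2 ^ h) := by
  have hN := NN_eq h
  have hL : lB h d e I (2 ^ h) = (I + 1) * cc h d e := by
    unfold lB; rw [cc_succ he, ← mul_assoc]; congr 1
    rw [add_mul]; omega
  rcases Nat.lt_or_ge (lam u) e with h3 | h3
  · exact Or.inl ⟨h3, by rw [hL, h1], by rw [hL, h2]⟩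
  · right
    rw [nd_last (d := d) hh he]
    exact pt_unique hh hv (by omega) hem (by omega) h1 h2

theorem ss_mem {h d m e I : ℕ} {u : Raw} (hh : 1 ≤ h) (he : 2 ≤ e) (hem : e ≤ m) (hv : Valid h d m u) (hl : lam u ≤ e)
    (h1 : lo h d u = I * cc h d e) (h2 : hi h d u = I * cc h d e) : u ∈ SS h d m e I 0 := by
  have hL : lA h d e I 0 = I * cc h d e := by
    unfold lA; rw [cc_succ he, ← mul_assoc]; simp
  rcases Nat.lt_or_ge (lam u) e with h3 | h3
  · exact Or.inl ⟨h3, by rw [hL, h1], by rw [hL, h2]⟩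
  · right
    rw [nd_first (d := d) hh he]
    exact pt_unique hh hv (by omega) hem (by omega) h1 h2

theorem NB1_lt {h d m j pos : ℕ} {u : Raw} (hu : u ∈ NB1 h d m j pos) : lo h d u < hi h d u := by
  obtain ⟨e, I, i, c, f, s, h1, h2, h3, rfl⟩ := hu
  rw [sp_lo, sp_hi]
  exact Nat.mul_lt_mul_of_pos_right (by omega) (cc_pos _ _ _)

theorem X_one {h d m j G pos : ℕ} (hh : 1 ≤ h) (hj : 1 ≤ j) (hjm : j + 1 ≤ m)
    (hpos : pos = G * cc h d (j + 1)) (hG : G ≤ NN h ^ (m - (j + 1))) {C : Set Raw} (hC : Conn (RR h d m) C)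
    (hV : ∀ u ∈ C, Valid h d m u) (hr : RootR m ∉ C) (hLf : ∀ x ∈ C, x ∉ Lf h d m pos)
    {a b : Raw} (ha : a ∈ C) (haN : a ∈ NB h d m j pos) (hb : b ∈ C) (hbN : b ∉ NB h d m (j + 1) pos) :
    (∃ P, P ⊆ C ∧ G < NN h ^ (m - (j + 1)) ∧ Cross h d m (j + 1) G (1 * 2 ^ (h - 1)) ((1 + 1) * 2 ^ (h - 1)) P) ∨
    (∃ P, P ⊆ C ∧ 1 ≤ G ∧ Cross h d m (j + 1) (G - 1) (0 * 2 ^ (h - 1)) ((0 + 1) * 2 ^ (h - 1)) P) := by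
  have hnr : ∀ x ∈ C, x ≠ RootR m := fun x hx hh => hr (hh ▸ hx)
  have haN0 : ∃ a ∈ C, a ∈ NB0 h d m j pos := by
    rcases haN with h1 | h1
    · exact ⟨a, ha, h1⟩
    · obtain ⟨u, w, k1, k2, k3, k4, k5⟩ := hC (NB1 h d m j pos) a b ha h1 hb
        (fun hx => hbN (NB_mono (by omega : j ≤ j + 1) (Or.inr hx)))
      rcases NB1_nbr hh k2 k5 (hnr w k3) (hLf w k3) with k6 | k6
      · exact absurd k6 k4
      · exact ⟨w, k3, k6.1⟩
  clear haN ha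
  obtain ⟨a, ha, haN⟩ := haN0
  obtain ⟨C', c1, c2, c3, c4, u, w, c5, c6, c7, c8⟩ := comp_exit RR_symm hC (NB h d m (j + 1) pos) ha
    (NB_mono (by omega : j ≤ j + 1) (Or.inl haN)) hb hbN
  have hu0 : u ∈ NB0 h d m (j + 1) pos := by
    rcases c2 c5 with k | k
    · exact k
    · exfalso
      rcases NB1_nbr hh k c8 (hnr w c6) (hLf w c6) with k6 | k6
      · exact c7 (Or.inr k6)
      · exact c7 (Or.inl k6.1)
  have hex := NB0_exit hh (by omega) hjm hpos hu0 c8 (hnr w c6) (hLf w c6) c7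
  obtain ⟨av, al, a1, a2, a3⟩ := haN
  have ahl := lo_le_hi hh av (hnr a ha)
  have hN := NN_eq h
  have hK : 2 ^ h = 2 * 2 ^ (h - 1) := by
    rw [← pow_succ']; congr 1; omega
  have hK1 : 1 ≤ 2 ^ (h - 1) := Nat.one_le_two_pow
  have hcs : cc h d (j + 1) = NN h * cc h d j := by
    rw [cc_succ (by omega)]; rfl
  have hc := cc_pos h d j
  have e0 : NN h * cc h d j + cc h d j = 4 * (2 ^ (h - 1) * cc h d j) := by
    calc NN h * cc h d j + cc h d j = (NN h + 1) * cc h d j := by ring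
      _ = _ := by rw [hN, hK]; ring
  have e1 : cc h d j ≤ 2 ^ (h - 1) * cc h d j := Nat.le_mul_of_pos_left _ hK1
  have uv := hu0.1
  have ul := hu0.2.1
  have hgb : ∀ g, hi h d u = g * cc h d (j + 1) → g ≤ NN h ^ (m - (j + 1)) := by
    intro g hg
    have h1 := hi_le hh uv (hnr u (c1 c5))
    rw [cc_add (h := h) (d := d) (by omega : 1 ≤ j + 1) hjm, hg] at h1
    exact Nat.le_of_mul_le_mul_right h1 (cc_pos _ _ _)
  rcases hex with ⟨u1, u2⟩ | ⟨u1, u2⟩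
  · left
    have p1 : pos + cc h d (j + 1) = (G + 1) * cc h d (j + 1) := by rw [hpos]; ring
    have hB : (1 + 1) * 2 ^ (h - 1) = 2 ^ h := by omega
    have hlA : lA h d (j + 1) G (1 * 2 ^ (h - 1)) = pos + 2 * (2 ^ (h - 1) * cc h d j) := by
      unfold lA; rw [hpos, hcs, Nat.add_sub_cancel]; ring
    have hlB : lB h d (j + 1) G ((1 + 1) * 2 ^ (h - 1)) = pos + cc h d (j + 1) := by
      unfold lB; rw [hpos, hcs, Nat.add_sub_cancel, hB, show 2 * 2 ^ h - 1 = NN h by omega]; ring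
    have hGlt : G < NN h ^ (m - (j + 1)) := hgb (G + 1) (by omega)
    have huT : u ∈ TT h d m (j + 1) G ((1 + 1) * 2 ^ (h - 1)) := by
      rw [hB]; exact tt_mem hh (by omega) hjm uv ul (by omega) (by omega)
    have huD : u ∈ Dl h d m (j + 1) G 1 1 := ⟨uv, ul, by omega, by omega⟩
    have haD : a ∉ Dl h d m (j + 1) G 1 1 := by
      rintro ⟨_, _, k1, k2⟩; omega
    obtain ⟨P, q1, q2, q3, q4, u', w', q5, q6, q7, q8⟩ := comp_exit RR_symm c3 _ c5 huD c4 haD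
    refine ⟨P, fun x hx => c1 (q1 hx), hGlt, q3, q2, ?_, u, q4, huT⟩
    rcases exit_dl hh (by omega) hjm hh (by norm_num) (q2 q5) q7 q8 (hnr w' (c1 q6)) with r | ⟨r1, r2⟩ | ⟨q', a', b', r1, r2, _⟩
    · exact ⟨u', q5, r.1⟩
    · exfalso
      have hu'D := q2 q5
      rw [hB] at r1
      obtain ⟨t1, t2⟩ := tt_coord hh (by omega) r1
      rcases c2 q6 with k | k
      · obtain ⟨_, k1, _, k2, _⟩ := k
        omega
      · rcases NB1_nbr hh k (RR_symm _ _ q8) (hnr u' (c1 (q1 q5))) (hLf u' (c1 (q1 q5))) with k6 | k6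
        · have := NB1_lt k6; omega
        · have := cc_pos h d (j + 1); omega
    · omega
  · right
    have hc1 := cc_pos h d (j + 1)
    obtain ⟨G, rfl⟩ : ∃ G', G = G' + 1 := ⟨G - 1, by
      rcases Nat.eq_zero_or_pos G with rfl | h0
      · simp at hpos; omega
      · omega⟩
    rw [Nat.add_sub_cancel]
    have p1 : pos = G * cc h d (j + 1) + cc h d (j + 1) := by rw [hpos]; ring
    have hB : (0 + 1) * 2 ^ (h - 1) = 2 ^ (h - 1) := by omega
    have hA : 0 * 2 ^ (h - 1) = 0 := by omega
    have hlA : lA h d (j + 1) G (0 * 2 ^ (h - 1)) = G * cc h d (j + 1) := by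
      unfold lA; rw [hcs, Nat.add_sub_cancel]; ring
    have hlB : lB h d (j + 1) G ((0 + 1) * 2 ^ (h - 1)) + cc h d j = G * cc h d (j + 1) + 2 * (2 ^ (h - 1) * cc h d j) := by
      unfold lB; rw [hcs, Nat.add_sub_cancel, hB]
      obtain ⟨K, hK'⟩ : ∃ K, 2 ^ (h - 1) = K + 1 := ⟨2 ^ (h - 1) - 1, by omega⟩
      rw [hK', show 2 * (K + 1) - 1 = 2 * K + 1 by omega]; ring
    have huS : u ∈ SS h d m (j + 1) G (0 * 2 ^ (h - 1)) := by
      rw [hA]; exact ss_mem hh (by omega) hjm uv ul (by omega) (by omega)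
    have huD : u ∈ Dl h d m (j + 1) G 1 0 := ⟨uv, ul, by omega, by omega⟩
    have haD : a ∉ Dl h d m (j + 1) G 1 0 := by
      rintro ⟨_, _, k1, k2⟩; omega
    obtain ⟨P, q1, q2, q3, q4, u', w', q5, q6, q7, q8⟩ := comp_exit RR_symm c3 _ c5 huD c4 haD
    refine ⟨P, fun x hx => c1 (q1 hx), by omega, q3, q2, ⟨u, q4, huS⟩, ?_⟩
    rcases exit_dl hh (by omega) hjm hh (by norm_num) (q2 q5) q7 q8 (hnr w' (c1 q6)) with ⟨r1, r2⟩ | r | ⟨q', a', b', r1, r2, _⟩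
    · exfalso
      rw [hA] at r1
      obtain ⟨t1, t2⟩ := ss_coord hh (by omega) r1
      rcases c2 q6 with k | k
      · obtain ⟨_, k1, k2, _, _⟩ := k
        omega
      · rcases NB1_nbr hh k (RR_symm _ _ q8) (hnr u' (c1 (q1 q5))) (hLf u' (c1 (q1 q5))) with k6 | k6
        · have := NB1_lt k6; omega
        · omega
    · exact ⟨u', q5, r.1⟩
    · omega

/-- pigeonhole: a 2-colouring of `Fin 5` -/
theorem pig5 (p q : Fin 5 → Prop) (hp : ∀ i, p i ∨ q i) :
    (∃ f : Fin 3 → Fin 5, Function.Injective f ∧ ∀ i, p (f i)) ∨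
    (∃ f : Fin 3 → Fin 5, Function.Injective f ∧ ∀ i, q (f i)) := by
  classical
  have key : ∀ r : Fin 5 → Prop, 3 ≤ (Finset.univ.filter r).card →
      ∃ f : Fin 3 → Fin 5, Function.Injective f ∧ ∀ i, r (f i) := by
    intro r hc
    obtain ⟨t, h1, h2⟩ := Finset.exists_subset_card_eq hc
    refine ⟨t.orderEmbOfFin h2, (t.orderEmbOfFin h2).injective, fun i => ?_⟩
    have := h1 (Finset.orderEmbOfFin_mem t h2 i)
    simpa using this
  by_cases h1 : 3 ≤ (Finset.univ.filter p).card
  · exact Or.inl (key p h1)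
  · right
    apply key
    have h2 : (Finset.univ : Finset (Fin 5)) ⊆ Finset.univ.filter p ∪ Finset.univ.filter q := by
      intro i _
      simpa using hp i
    have h3 := Finset.card_le_card h2
    have h4 := Finset.card_union_le (Finset.univ.filter p) (Finset.univ.filter q)
    simp at h3
    omega

theorem lemX {h d m j G pos : ℕ} (hh : 1 ≤ h) (hj : 1 ≤ j) (hjm : j + 1 ≤ m)
    (hpos : pos = G * cc h d (j + 1)) (hG : G ≤ NN h ^ (m - (j + 1))) {C : Fin 5 → Set Raw}
    (hC : ∀ i, Conn (RR h d m) (C i)) (hf : ∀ i k, i ≠ k → Far (RR h d m) (C i) (C k))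
    (hV : ∀ i, ∀ u ∈ C i, Valid h d m u) (hr : ∀ i, RootR m ∉ C i) (hLf : ∀ i, ∀ x ∈ C i, x ∉ Lf h d m pos)
    (ha : ∀ i, ∃ a ∈ C i, a ∈ NB h d m j pos) (hb : ∀ i, ∃ b ∈ C i, b ∉ NB h d m (j + 1) pos) : False := by
  have hone := fun i => (ha i).elim fun a ha => (hb i).elim fun b hb =>
    X_one hh hj hjm hpos hG (hC i) (hV i) (hr i) (hLf i) ha.1 ha.2 hb.1 hb.2
  rcases pig5 _ _ hone with ⟨f, f1, f2⟩ | ⟨f, f1, f2⟩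
  · choose P p1 p2 p3 using f2
    exact lemmaA hh (by omega) hjm (p2 0) hh (by norm_num) P p3
      (fun i k hik => (hf (f i) (f k) (fun hx => hik (f1 hx))).mono (p1 i) (p1 k))
  · choose P p1 p2 p3 using f2
    exact lemmaA hh (by omega) hjm (by have := p2 0; omega) hh (by norm_num) P p3
      (fun i k hik => (hf (f i) (f k) (fun hx => hik (f1 hx))).mono (p1 i) (p1 k))

end Ghdm
namespace Ghdm

theorem lemC_sorted {h d m e g pos : ℕ} (hh : 1 ≤ h) (hem : e ≤ m)
    (hpos : pos = g * cc h d e) (hg : g ≤ NN h ^ (m - e)) {A : Fin 13 → Set Raw} {B : Fin 5 → Set Raw}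
    (cA : ∀ i, Conn (RR h d m) (A i)) (cB : ∀ i, Conn (RR h d m) (B i))
    (fA : ∀ i k, i ≠ k → Far (RR h d m) (A i) (A k)) (fB : ∀ i k, i ≠ k → Far (RR h d m) (B i) (B k))
    (vA : ∀ i, ∀ u ∈ A i, Valid h d m u) (vB : ∀ i, ∀ u ∈ B i, Valid h d m u)
    (rA : ∀ i, RootR m ∉ A i) (rB : ∀ i, RootR m ∉ B i)
    (lA : ∀ i, ∀ x ∈ A i, x ∉ Lf h d m pos) (lB : ∀ i, ∀ x ∈ B i, x ∉ Lf h d m pos)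
    (hAB : ∀ i k, ∃ x, x ∈ A i ∧ x ∈ B k)
    (x : Fin 13 → Raw) (xA : ∀ i, x i ∈ A i) (xl : ∀ i, lam (x i) ≤ e)
    (x1 : ∀ i, lo h d (x i) = pos) (x2 : ∀ i, hi h d (x i) = pos)
    (hmono : StrictMono fun i => lam (x i)) : False := by
  have hP : ∀ j, 1 ≤ j → j + 1 ≤ e → pos = (g * NN h ^ (e - (j + 1))) * cc h d (j + 1) ∧
      g * NN h ^ (e - (j + 1)) ≤ NN h ^ (m - (j + 1)) := by
    intro j hj hje
    constructor
    · rw [hpos, cc_add (by omega : 1 ≤ j + 1) hje, mul_assoc]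
    · calc g * NN h ^ (e - (j + 1)) ≤ NN h ^ (m - e) * NN h ^ (e - (j + 1)) := Nat.mul_le_mul_right _ hg
        _ = NN h ^ (m - (j + 1)) := by rw [← pow_add]; congr 1; omega
  have L1 : ∀ i, 1 ≤ lam (x i) := fun i => one_le_lam (vA i _ (xA i))
  have Lm : ∀ i k : Fin 13, i < k → lam (x i) + 1 ≤ lam (x k) := fun i k hik => hmono hik
  have hin : ∀ i j, lam (x i) ≤ j → x i ∈ NB h d m j pos := fun i j hij =>
    Or.inl ⟨vA i _ (xA i), hij, by rw [x1]; omega, by rw [x2]; omega, by rw [x1, x2]; omega⟩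
  have hout : ∀ i j, j < lam (x i) → x i ∉ NB h d m j pos := by
    rintro i j hij (k | k)
    · have := k.2.1; omega
    · have := NB1_lt k; rw [x1, x2] at this; omega
  -- low part
  have hlo : ∃ i, A i ⊆ NB h d m (lam (x 5)) pos := by
    by_contra hcon
    push Not at hcon
    obtain ⟨p1, p2⟩ := hP (lam (x 4)) (L1 4) (by have := Lm 4 5 (by decide); have := xl 5; omega)
    have h45 := Lm 4 5 (by decide)
    let f : Fin 5 → Fin 13 := fun i => ⟨i.1, by omega⟩
    have fi : ∀ i k, i ≠ k → f i ≠ f k := fun i k hik hx => hik (by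
      have := congrArg Fin.val hx; exact Fin.ext this)
    refine lemX (C := fun i => A (f i)) hh (L1 4) (by have := xl 5; omega) p1 p2 (fun i => cA _)
      (fun i k hik => fA _ _ (fi i k hik)) (fun i => vA _) (fun i => rA _) (fun i => lA _) ?_ ?_
    · intro i
      refine ⟨x (f i), xA _, hin _ _ (hmono.monotone ?_)⟩
      show i.1 ≤ 4
      omega
    · intro i
      obtain ⟨b, b1, b2⟩ := Set.not_subset.1 (hcon (f i))
      exact ⟨b, b1, fun hx => b2 (NB_mono h45 hx)⟩
  have hhi : ∃ i, ∀ y ∈ A i, y ∉ NB h d m (lam (x 6)) pos := by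
    by_contra hcon
    push Not at hcon
    have h67 := Lm 6 7 (by decide)
    have h78 := Lm 7 8 (by decide)
    have := xl 8
    obtain ⟨p1, p2⟩ := hP (lam (x 6)) (L1 6) (by omega)
    let f : Fin 5 → Fin 13 := fun i => ⟨i.1 + 8, by omega⟩
    have fi : ∀ i k, i ≠ k → f i ≠ f k := fun i k hik hx => hik (by
      have := congrArg Fin.val hx; simp [f] at this; exact Fin.ext this)
    refine lemX (C := fun i => A (f i)) hh (L1 6) (by omega) p1 p2 (fun i => cA _)
      (fun i k hik => fA _ _ (fi i k hik)) (fun i => vA _) (fun i => rA _) (fun i => lA _) ?_ ?_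
    · intro i
      obtain ⟨b, b1, b2⟩ := hcon (f i)
      exact ⟨b, b1, b2⟩
    · intro i
      refine ⟨x (f i), xA _, hout _ _ ?_⟩
      have : lam (x 8) ≤ lam (x (f i)) := hmono.monotone (by show 8 ≤ i.1 + 8; omega)
      omega
  obtain ⟨i1, h1⟩ := hlo
  obtain ⟨i2, h2⟩ := hhi
  have h56 := Lm 5 6 (by decide)
  have := xl 6
  obtain ⟨p1, p2⟩ := hP (lam (x 5)) (L1 5) (by omega)
  refine lemX (C := B) hh (L1 5) (by omega) p1 p2 cB fB vB rB lB ?_ ?_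
  · intro k
    obtain ⟨y, y1, y2⟩ := hAB i1 k
    exact ⟨y, y2, h1 y1⟩
  · intro k
    obtain ⟨y, y1, y2⟩ := hAB i2 k
    exact ⟨y, y2, fun hx => h2 y y1 (NB_mono h56 hx)⟩

theorem lemC {h d m e g pos : ℕ} (hh : 1 ≤ h) (hem : e ≤ m)
    (hpos : pos = g * cc h d e) (hg : g ≤ NN h ^ (m - e)) {A : Fin 13 → Set Raw} {B : Fin 5 → Set Raw}
    (cA : ∀ i, Conn (RR h d m) (A i)) (cB : ∀ i, Conn (RR h d m) (B i))
    (fA : ∀ i k, i ≠ k → Far (RR h d m) (A i) (A k)) (fB : ∀ i k, i ≠ k → Far (RR h d m) (B i) (B k))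
    (vA : ∀ i, ∀ u ∈ A i, Valid h d m u) (vB : ∀ i, ∀ u ∈ B i, Valid h d m u)
    (rA : ∀ i, RootR m ∉ A i) (rB : ∀ i, RootR m ∉ B i)
    (lA : ∀ i, ∀ x ∈ A i, x ∉ Lf h d m pos) (lB : ∀ i, ∀ x ∈ B i, x ∉ Lf h d m pos)
    (hAB : ∀ i k, ∃ x, x ∈ A i ∧ x ∈ B k)
    (hx : ∀ i, ∃ x ∈ A i, lam x ≤ e ∧ lo h d x = pos ∧ hi h d x = pos) : False := by
  choose x xA xl x1 x2 using hx
  have hinj : Function.Injective fun i => lam (x i) := by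
    intro i k hik
    by_contra hne
    have h0 := one_le_lam (vA i _ (xA i))
    have hp : pos = (g * NN h ^ (e - lam (x i))) * cc h d (lam (x i)) := by
      rw [hpos, cc_add h0 (xl i), mul_assoc]
    have e1 := pt_unique hh (vA i _ (xA i)) h0 ((xl i).trans hem) rfl ((x1 i).trans hp) ((x2 i).trans hp)
    have e2 := pt_unique hh (vA k _ (xA k)) h0 ((xl i).trans hem) hik.symm ((x1 k).trans hp) ((x2 k).trans hp)
    exact (fA i k hne _ _ (xA i) (xA k)).1 (e1.trans e2.symm)
  let σ := Tuple.sort fun i => lam (x i)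
  have hm : Monotone ((fun i => lam (x i)) ∘ σ) := Tuple.monotone_sort _
  have hs : StrictMono ((fun i => lam (x i)) ∘ σ) := hm.strictMono_of_injective (hinj.comp σ.injective)
  exact lemC_sorted (A := fun i => A (σ i)) (B := B) hh hem hpos hg (fun i => cA _) cB
    (fun i k hik => fA _ _ (fun hx => hik (σ.injective hx))) fB (fun i => vA _) vB (fun i => rA _) rB
    (fun i => lA _) lB (fun i k => hAB _ k) (fun i => x (σ i)) (fun i => xA _) (fun i => xl _)
    (fun i => x1 _) (fun i => x2 _) hs

structure Grid (h d m : ℕ) (A B : Fin 154 → Set Raw) : Prop where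
  cA : ∀ i, Conn (RR h d m) (A i)
  cB : ∀ i, Conn (RR h d m) (B i)
  fA : ∀ i k, i ≠ k → Far (RR h d m) (A i) (A k)
  fB : ∀ i k, i ≠ k → Far (RR h d m) (B i) (B k)
  vA : ∀ i, ∀ u ∈ A i, Valid h d m u
  vB : ∀ i, ∀ u ∈ B i, Valid h d m u
  hAB : ∀ i k, ∃ x, x ∈ A i ∧ x ∈ B k

theorem Grid.symm {h d m : ℕ} {A B : Fin 154 → Set Raw} (g : Grid h d m A B) : Grid h d m B A :=
  ⟨g.cB, g.cA, g.fB, g.fA, g.vB, g.vA, fun i k => (g.hAB k i).imp fun _ hx => ⟨hx.2, hx.1⟩⟩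

open Classical in
noncomputable def hit (A : Fin 154 → Set Raw) (S : Set Raw) : Finset (Fin 154) :=
  Finset.univ.filter fun i => ∃ x ∈ A i, x ∈ S

theorem mem_hit {A : Fin 154 → Set Raw} {S : Set Raw} {i : Fin 154} : i ∈ hit A S ↔ ∃ x ∈ A i, x ∈ S := by
  simp [hit]

theorem hit_union {A : Fin 154 → Set Raw} {S T : Set Raw} : (hit A (S ∪ T)).card ≤ (hit A S).card + (hit A T).card := by
  classical
  refine (Finset.card_le_card ?_).trans (Finset.card_union_le _ _)
  intro i hi
  rw [mem_hit] at hi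
  rw [Finset.mem_union, mem_hit, mem_hit]
  obtain ⟨x, h1, h2 | h2⟩ := hi
  · exact Or.inl ⟨x, h1, h2⟩
  · exact Or.inr ⟨x, h1, h2⟩

theorem hit_sub {h d m : ℕ} {A B : Fin 154 → Set Raw} (g : Grid h d m A B) {S : Set Raw}
    (hS : ∀ x y, x ∈ S → y ∈ S → x = y) : (hit A S).card ≤ 1 := by
  rw [Finset.card_le_one]
  intro i hi k hk
  rw [mem_hit] at hi hk
  obtain ⟨x, x1, x2⟩ := hi
  obtain ⟨y, y1, y2⟩ := hk
  by_contra hne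
  exact (g.fA i k hne x y x1 y1).1 (hS x y x2 y2)

theorem hit_one {h d m : ℕ} {A B : Fin 154 → Set Raw} (g : Grid h d m A B) (x : Raw) : (hit A {x}).card ≤ 1 :=
  hit_sub g (by rintro a b rfl rfl; rfl)

def VV (h d e pos : ℕ) : Set Raw := {u | lam u ≤ e ∧ lo h d u = pos ∧ hi h d u = pos}

theorem hit_VV {h d m : ℕ} {A B : Fin 154 → Set Raw} (gr : Grid h d m A B) (hh : 1 ≤ h) {e g pos : ℕ} (hem : e ≤ m)
    (hpos : pos = g * cc h d e) (hg : g ≤ NN h ^ (m - e)) : (hit A (VV h d e pos)).card ≤ 14 := by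
  classical
  by_contra hcon
  push Not at hcon
  have hW : ∀ {A B : Fin 154 → Set Raw} (_ : Grid h d m A B), (hit A ({RootR m} ∪ Lf h d m pos)).card ≤ 2 := by
    intro A B gr
    have h1 := hit_union (A := A) (S := {RootR m}) (T := Lf h d m pos)
    have h2 := hit_one gr (RootR m)
    have h3 := hit_sub gr (S := Lf h d m pos) (fun x y => lf_sub)
    omega
  have hn : ∀ {A : Fin 154 → Set Raw} {i}, i ∉ hit A ({RootR m} ∪ Lf h d m pos) →
      RootR m ∉ A i ∧ ∀ x ∈ A i, x ∉ Lf h d m pos := by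
    intro A i hi
    rw [mem_hit] at hi
    push Not at hi
    exact ⟨fun hx => hi _ hx (Or.inl rfl), fun x hx hl => hi _ hx (Or.inr hl)⟩
  have hA := hW gr
  have hB := hW gr.symm
  have h1 := Finset.le_card_sdiff (hit A ({RootR m} ∪ Lf h d m pos)) (hit A (VV h d e pos))
  have h2 := Finset.le_card_sdiff (hit B ({RootR m} ∪ Lf h d m pos)) (Finset.univ : Finset (Fin 154))
  simp only [Finset.card_univ, Fintype.card_fin] at h2
  obtain ⟨s, s1, s2⟩ := Finset.exists_subset_card_eq (show 13 ≤ _ from by omega : 13 ≤ (hit A (VV h d e pos) \ hit A ({RootR m} ∪ Lf h d m pos)).card)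
  obtain ⟨t, t1, t2⟩ := Finset.exists_subset_card_eq (show 5 ≤ _ from by omega : 5 ≤ (Finset.univ \ hit B ({RootR m} ∪ Lf h d m pos)).card)
  have hs : ∀ i, s.orderEmbOfFin s2 i ∈ hit A (VV h d e pos) ∧ s.orderEmbOfFin s2 i ∉ hit A ({RootR m} ∪ Lf h d m pos) :=
    fun i => Finset.mem_sdiff.1 (s1 (Finset.orderEmbOfFin_mem s s2 i))
  have ht : ∀ i, t.orderEmbOfFin t2 i ∉ hit B ({RootR m} ∪ Lf h d m pos) :=
    fun i => (Finset.mem_sdiff.1 (t1 (Finset.orderEmbOfFin_mem t t2 i))).2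
  exact lemC (A := fun i => A (s.orderEmbOfFin s2 i)) (B := fun i => B (t.orderEmbOfFin t2 i)) hh hem hpos hg
    (fun i => gr.cA _) (fun i => gr.cB _)
    (fun i k hik => gr.fA _ _ (fun hx => hik ((s.orderEmbOfFin s2).injective hx)))
    (fun i k hik => gr.fB _ _ (fun hx => hik ((t.orderEmbOfFin t2).injective hx)))
    (fun i => gr.vA _) (fun i => gr.vB _) (fun i => (hn (hs i).2).1) (fun i => (hn (ht i)).1)
    (fun i => (hn (hs i).2).2) (fun i => (hn (ht i)).2) (fun i k => gr.hAB _ _) (fun i => mem_hit.1 (hs i).1)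

/-- a connected set with no exit stays inside -/
theorem stay {h d m : ℕ} {P Y W : Set Raw} (hP : Conn (RR h d m) P) (hW : ∀ x ∈ P, x ∉ W)
    (hY : ∀ u w, u ∈ Y → w ∉ Y → RR h d m u w → u ∈ W ∨ w ∈ W) {a : Raw} (ha : a ∈ P) (haY : a ∈ Y) : P ⊆ Y := by
  intro b hb
  by_contra hbY
  obtain ⟨u, w, h1, h2, h3, h4, h5⟩ := hP Y a b ha haY hb hbY
  rcases hY u w h2 h4 h5 with k | k
  · exact hW _ h1 k
  · exact hW _ h3 k

theorem not_hit {A : Fin 154 → Set Raw} {W : Set Raw} {i : Fin 154} (hi : i ∉ hit A W) : ∀ x ∈ A i, x ∉ W := by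
  intro x hx hw
  exact hi (mem_hit.2 ⟨x, hx, hw⟩)

theorem exists_not_hit {A : Fin 154 → Set Raw} {W : Set Raw} (hc : (hit A W).card < 154) : ∃ i, i ∉ hit A W := by
  by_contra hcon
  push Not at hcon
  have : hit A W = Finset.univ := Finset.eq_univ_iff_forall.2 hcon
  rw [this] at hc
  simp at hc

theorem enclB {h d m : ℕ} {A B : Fin 154 → Set Raw} (gr : Grid h d m A B) {Y W : Set Raw}
    (hY : ∀ u w, u ∈ Y → w ∉ Y → RR h d m u w → u ∈ W ∨ w ∈ W) {i : Fin 154} (hi : A i ⊆ Y) :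
    ∀ j, j ∉ hit B W → B j ⊆ Y := by
  intro j hj
  obtain ⟨x, x1, x2⟩ := gr.hAB i j
  exact stay (gr.cB j) (not_hit hj) hY x2 (hi x1)

theorem enclA {h d m : ℕ} {A B : Fin 154 → Set Raw} (gr : Grid h d m A B) {Y W : Set Raw}
    (hY : ∀ u w, u ∈ Y → w ∉ Y → RR h d m u w → u ∈ W ∨ w ∈ W) {i : Fin 154} (hi : A i ⊆ Y)
    (hB : (hit B W).card < 154) : ∀ k, k ∉ hit A W → A k ⊆ Y := by
  intro k hk
  obtain ⟨j, hj⟩ := exists_not_hit hB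
  exact enclB gr.symm hY (enclB gr hY hi j hj) k hk

theorem ivt {h d m : ℕ} {P Y : Set Raw} (hP : Conn (RR h d m) P) (hPY : P ⊆ Y) (κ : Raw → ℕ)
    (hκ : ∀ u w, u ∈ Y → w ∈ Y → RR h d m u w → κ w ≤ κ u + 1) {x z : Raw} (hx : x ∈ P) (hz : z ∈ P) {t : ℕ}
    (h1 : κ x ≤ t) (h2 : t ≤ κ z) : ∃ y ∈ P, κ y = t := by
  rcases Nat.eq_or_lt_of_le h2 with h3 | h3
  · exact ⟨z, hz, h3.symm⟩
  obtain ⟨u, w, k1, k2, k3, k4, k5⟩ := hP {y | κ y ≤ t} x z hx h1 hz (by simp; omega)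
  simp only [Set.mem_setOf_eq] at k2 k4
  have := hκ u w (hPY k1) (hPY k3) k5
  rcases Nat.lt_or_ge (κ u) t with h4 | h4
  · omega
  · exact ⟨u, k1, by omega⟩

theorem exists_two {A : Fin 154 → Set Raw} {W : Set Raw} (hc : (hit A W).card ≤ 100) :
    ∃ i k, i ≠ k ∧ i ∉ hit A W ∧ k ∉ hit A W := by
  classical
  have h2 := Finset.le_card_sdiff (hit A W) (Finset.univ : Finset (Fin 154))
  simp only [Finset.card_univ, Fintype.card_fin] at h2
  obtain ⟨i, hi, k, hk, hne⟩ := Finset.one_lt_card.1 (show 1 < (Finset.univ \ hit A W).card by omega)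
  exact ⟨i, k, hne, (Finset.mem_sdiff.1 hi).2, (Finset.mem_sdiff.1 hk).2⟩

theorem path_no {h d m : ℕ} {A B : Fin 154 → Set Raw} (gr : Grid h d m A B) {Y W : Set Raw}
    (hY : ∀ u w, u ∈ Y → w ∉ Y → RR h d m u w → u ∈ W ∨ w ∈ W) {i : Fin 154} (hi : A i ⊆ Y)
    (hA : (hit A W).card ≤ 100) (hB : (hit B W).card ≤ 100) (κ : Raw → ℕ)
    (hκ : ∀ u w, u ∈ Y → w ∈ Y → RR h d m u w → κ w ≤ κ u + 1)
    (hinj : ∀ u w, u ∈ Y → w ∈ Y → κ u = κ w → u = w) : False := by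
  obtain ⟨i1, i2, hne, hi1, hi2⟩ := exists_two hA
  obtain ⟨j1, j2, hnj, hj1, hj2⟩ := exists_two hB
  have sA := enclA gr hY hi (by omega)
  have sB := enclB gr hY hi
  obtain ⟨b1, p1, p1'⟩ := gr.hAB i1 j1
  obtain ⟨b2, p2, p2'⟩ := gr.hAB i1 j2
  obtain ⟨c1, q1, q1'⟩ := gr.hAB i2 j1
  obtain ⟨c2, q2, q2'⟩ := gr.hAB i2 j2
  have dA : ∀ x y, x ∈ A i1 → y ∈ A i2 → κ x ≠ κ y := fun x y hx hy he =>
    (gr.fA i1 i2 hne x y hx hy).1 (hinj x y (sA i1 hi1 hx) (sA i2 hi2 hy) he)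
  have dB : ∀ x y, x ∈ B j1 → y ∈ B j2 → κ x ≠ κ y := fun x y hx hy he =>
    (gr.fB j1 j2 hnj x y hx hy).1 (hinj x y (sB j1 hj1 hx) (sB j2 hj2 hy) he)
  have iA1 : ∀ x z, x ∈ A i1 → z ∈ A i1 → ∀ y ∈ A i2, ¬ (κ x ≤ κ y ∧ κ y ≤ κ z) := by
    rintro x z hx hz y hy ⟨h1, h2⟩
    obtain ⟨w, w1, w2⟩ := ivt (gr.cA i1) (sA i1 hi1) κ hκ hx hz h1 h2
    exact dA w y w1 hy w2
  have iA2 : ∀ x z, x ∈ A i2 → z ∈ A i2 → ∀ y ∈ A i1, ¬ (κ x ≤ κ y ∧ κ y ≤ κ z) := by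
    rintro x z hx hz y hy ⟨h1, h2⟩
    obtain ⟨w, w1, w2⟩ := ivt (gr.cA i2) (sA i2 hi2) κ hκ hx hz h1 h2
    exact dA y w hy w1 w2.symm
  have iB1 : ∀ x z, x ∈ B j1 → z ∈ B j1 → ∀ y ∈ B j2, ¬ (κ x ≤ κ y ∧ κ y ≤ κ z) := by
    rintro x z hx hz y hy ⟨h1, h2⟩
    obtain ⟨w, w1, w2⟩ := ivt (gr.cB j1) (sB j1 hj1) κ hκ hx hz h1 h2
    exact dB w y w1 hy w2
  have iB2 : ∀ x z, x ∈ B j2 → z ∈ B j2 → ∀ y ∈ B j1, ¬ (κ x ≤ κ y ∧ κ y ≤ κ z) := by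
    rintro x z hx hz y hy ⟨h1, h2⟩
    obtain ⟨w, w1, w2⟩ := ivt (gr.cB j2) (sB j2 hj2) κ hκ hx hz h1 h2
    exact dB y w hy w1 w2.symm
  have a1 := iA1 b1 b2 p1 p2 c1 q1
  have a2 := iA1 b1 b2 p1 p2 c2 q2
  have a3 := iA1 b2 b1 p2 p1 c1 q1
  have a4 := iA1 b2 b1 p2 p1 c2 q2
  have a5 := iA2 c1 c2 q1 q2 b1 p1
  have a6 := iA2 c1 c2 q1 q2 b2 p2
  have a7 := iA2 c2 c1 q2 q1 b1 p1
  have a8 := iA2 c2 c1 q2 q1 b2 p2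
  have e1 := iB1 b1 c1 p1' q1' b2 p2'
  have e2 := iB1 b1 c1 p1' q1' c2 q2'
  have e3 := iB1 c1 b1 q1' p1' b2 p2'
  have e4 := iB1 c1 b1 q1' p1' c2 q2'
  have e5 := iB2 b2 c2 p2' q2' b1 p1'
  have e6 := iB2 b2 c2 p2' q2' c1 q1'
  have e7 := iB2 c2 b2 q2' p2' b1 p1'
  have e8 := iB2 c2 b2 q2' p2' c1 q1'
  generalize κ b1 = x1 at *
  generalize κ b2 = x2 at *
  generalize κ c1 = x3 at *
  generalize κ c2 = x4 at *
  omega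

end Ghdm
namespace Ghdm

theorem canon_path {h m k : ℕ} {a : Raw} (ha : .path k = canon h m a) : a = .path k := by
  cases a with
  | path _ => exact ha.symm
  | tree j i p => simp only [canon] at ha; split_ifs at ha
  | spine => simp [canon] at ha

theorem canon_spine {h m j i k t e s : ℕ} {a : Raw} (ha : .spine j i k t e s = canon h m a) : a = .spine j i k t e s := by
  cases a with
  | path _ => simp [canon] at ha
  | tree j i p => simp only [canon] at ha; split_ifs at ha
  | spine => exact ha.symm

theorem rel_path {h d m k k' : ℕ} (hr : rel h d m (.path k) (.path k')) : k' = k + 1 := by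
  obtain ⟨a, b, h1, h2, h3⟩ := hr
  have := canon_path h2
  have := canon_path h3
  subst_vars
  cases h1
  rfl

theorem RR_path {h d m k k' : ℕ} (hr : RR h d m (.path k) (.path k')) : k' ≤ k + 1 := by
  rcases hr.2.2.2 with h1 | h1
  · have := rel_path h1; omega
  · have := rel_path h1; omega

theorem rel_spine {h d m j i k t e s s' : ℕ} (hr : rel h d m (.spine j i k t e s) (.spine j i k t e s')) : s' = s + 1 := by
  obtain ⟨a, b, h1, h2, h3⟩ := hr
  have e1 := canon_spine h2
  have e2 := canon_spine h3
  subst e1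
  generalize hb : Raw.spine j i k t e s' = b' at e2
  subst e2
  cases h1 with
  | step => simp at hb; omega
  | toV => unfold VsetElem at hb; split_ifs at hb

theorem RR_spine {h d m j i k t e s s' : ℕ} (hr : RR h d m (.spine j i k t e s) (.spine j i k t e s')) : s' ≤ s + 1 := by
  rcases hr.2.2.2 with h1 | h1
  · have := rel_spine h1; omega
  · have := rel_spine h1; omega

def BX (h d m e g : ℕ) : Set Raw := Box h d m e (g * cc h d e) ((g + 1) * cc h d e)

theorem box_exit {h d m e g : ℕ} (hh : 1 ≤ h) (he : 1 ≤ e) (hem : e ≤ m) {u w : Raw} (hu : u ∈ BX h d m e g)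
    (hw : w ∉ BX h d m e g) (hR : RR h d m u w) (hwr : w ≠ RootR m) :
    u ∈ VV h d e (g * cc h d e) ∪ VV h d e ((g + 1) * cc h d e) := by
  obtain ⟨uv, ul, u1, u2⟩ := hu
  have hur := ne_root (ul.trans hem)
  have hlu := lo_le_hi hh uv hur
  by_cases hl : lam w ≤ e
  · have h3 : lo h d w < g * cc h d e ∨ (g + 1) * cc h d e < hi h d w := by
      by_contra hcon
      push Not at hcon
      exact hw ⟨hR.2.1, hl, hcon.1, hcon.2⟩
    rcases low_exit hh hem hR ul hl u1 u2 h3 with k | k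
    · exact Or.inl ⟨ul, k.1, k.2.1⟩
    · exact Or.inr ⟨ul, k.1, k.2.1⟩
  · rcases RR_three hh hR hur hwr with h1 | ⟨e', I', q', a', b, h1, h2, h3, h4, h5, h6, h7⟩ | ⟨e', I', j', c', f', hs', h1, h2⟩
    · omega
    · exfalso
      have l1 := lam_nd (h := h) (m := m) (e := e') (I := I') hh h4 h6
      have l2 := lam_nd (h := h) (m := m) (e := e') (I := I') hh (by omega) (child_lt b h6)
      rcases h7 with ⟨rfl, rfl⟩ | ⟨rfl, rfl⟩ <;> omega
    · have hfe := hs'.fe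
      have hlw' : lam w = e' ∨ lam w = f' := by
        rcases h2 with rfl | ⟨s, _, _, rfl⟩ | rfl
        · exact Or.inl (sleaf_lam hh hs')
        · exact Or.inl sp_lam
        · exact Or.inr (sfoot_lam hh)
      have huf : u = sfoot h d e' I' j' c' f' := by
        rcases h1 with rfl | ⟨s, _, _, rfl⟩ | h1
        · rw [sleaf_lam hh hs'] at ul; omega
        · rw [sp_lam] at ul; omega
        · exact h1
      have hluf : lam u = f' := by rw [huf]; exact sfoot_lam hh
      obtain ⟨G', g1, g2⟩ := foot_mult (d := d) (c := c') hh hs' he (by omega) (by omega : f' ≤ e)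
      rw [← huf] at g1 g2
      have k1 : g ≤ G' := Nat.le_of_mul_le_mul_right (by omega : g * cc h d e ≤ G' * cc h d e) (cc_pos _ _ _)
      have k2 : G' ≤ g + 1 := Nat.le_of_mul_le_mul_right (by omega : G' * cc h d e ≤ (g + 1) * cc h d e) (cc_pos _ _ _)
      rcases (by omega : G' = g ∨ G' = g + 1) with rfl | rfl
      · exact Or.inl ⟨ul, g1, g2⟩
      · exact Or.inr ⟨ul, g1, g2⟩

theorem base_no {h d m : ℕ} {A B : Fin 154 → Set Raw} (gr : Grid h d m A B) (hh : 1 ≤ h) (hm : 1 ≤ m) {g : ℕ}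
    (hg : g < NN h ^ (m - 1)) {i : Fin 154} (hi : A i ⊆ BX h d m 1 g) : False := by
  have hcount : ∀ {A B : Fin 154 → Set Raw} (_ : Grid h d m A B),
      (hit A ((VV h d 1 (g * cc h d 1) ∪ VV h d 1 ((g + 1) * cc h d 1)) ∪ {RootR m})).card ≤ 100 := by
    intro A B gr
    have h1 := hit_union (A := A) (S := VV h d 1 (g * cc h d 1) ∪ VV h d 1 ((g + 1) * cc h d 1)) (T := {RootR m})
    have h2 := hit_union (A := A) (S := VV h d 1 (g * cc h d 1)) (T := VV h d 1 ((g + 1) * cc h d 1))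
    have h3 := hit_VV gr hh (e := 1) (g := g) hm rfl (by omega)
    have h4 := hit_VV gr hh (e := 1) (g := g + 1) hm rfl (by omega)
    have h5 := hit_one gr (RootR m)
    omega
  have hpath : ∀ u ∈ BX h d m 1 g, ∃ k, u = .path k := by
    rintro u ⟨h1, h2, _, _⟩
    rcases valid_cases h1 (ne_root (h2.trans hm)) with ⟨k, hk, _⟩ | ⟨e, I, q, a, k1, k2, k3, k4, k5, k6, rfl⟩ | ⟨e, I, j, c, f, s, k1, k2, k3, rfl⟩
    · exact ⟨k, hk⟩
    · rw [lam_nd hh k4 k6] at h2; omega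
    · rw [sp_lam] at h2; have := k1.e2; omega
  refine path_no gr (Y := BX h d m 1 g) ?_ hi (hcount gr) (hcount gr.symm) (lo h d) ?_ ?_
  · intro u w hu hw hR
    by_cases hwr : w = RootR m
    · exact Or.inr (Or.inr hwr)
    · exact Or.inl (Or.inl (box_exit hh le_rfl hm hu hw hR hwr))
  · intro u w hu hw hR
    obtain ⟨k, rfl⟩ := hpath u hu
    obtain ⟨k', rfl⟩ := hpath w hw
    exact RR_path hR
  · intro u w hu hw he
    obtain ⟨k, rfl⟩ := hpath u hu
    obtain ⟨k', rfl⟩ := hpath w hw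
    exact congrArg Raw.path he

def sidx : Raw → ℕ
  | .spine _ _ _ _ _ s => s
  | _ => 0

def SPS (d e I j : ℕ) (c : Bool) (f : ℕ) : Set Raw := {u | ∃ s, 1 ≤ s ∧ s ≤ d ∧ u = sp e I j c f s}

theorem sps_exit {h d m e I j f : ℕ} {c : Bool} (hh : 1 ≤ h) (hs : SOK h m e I j f) {u w : Raw} (hu : u ∈ SPS d e I j c f)
    (hw : w ∉ SPS d e I j c f) (hR : RR h d m u w) (hwr : w ≠ RootR m) :
    w = sleaf h m e I j c ∨ w ∈ VV h d (e - 1) (fpos h d e I j c) := by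
  obtain ⟨s, _, _, rfl⟩ := hu
  rcases sp_nbr hh hs hR hwr with k | ⟨s', k1, k2, k⟩ | k
  · exact Or.inl k
  · exact absurd ⟨s', k1, k2, k⟩ hw
  · right
    obtain ⟨a1, a2⟩ := sfoot_fpos (d := d) (c := c) hh hs
    rw [k]
    exact ⟨by rw [sfoot_lam hh]; have := hs.fe; omega, a1, a2⟩

theorem sps_no {h d m : ℕ} {A B : Fin 154 → Set Raw} (gr : Grid h d m A B) (hh : 1 ≤ h)
    {e I j f : ℕ} {c : Bool} (hs : SOK h m e I j f) {i : Fin 154} (hi : A i ⊆ SPS d e I j c f) : False := by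
  have he2 := hs.e2
  have hem := hs.em
  have hcount : ∀ {A B : Fin 154 → Set Raw} (_ : Grid h d m A B),
      (hit A (({sleaf h m e I j c} ∪ VV h d (e - 1) (fpos h d e I j c)) ∪ {RootR m})).card ≤ 100 := by
    intro A B gr
    have h1 := hit_union (A := A) (S := {sleaf h m e I j c} ∪ VV h d (e - 1) (fpos h d e I j c)) (T := {RootR m})
    have h2 := hit_union (A := A) (S := {sleaf h m e I j c}) (T := VV h d (e - 1) (fpos h d e I j c))
    have hN := NN_eq h
    have hj := hs.hj
    have h3 := hit_VV gr hh (e := e - 1) (g := I * NN h + (2 * j + 1 + c.toNat)) (pos := fpos h d e I j c) (by omega) rfl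
      (gidx he2 hem hs.hI (by cases c <;> simp <;> omega)).le
    have h4 := hit_one gr (sleaf h m e I j c)
    have h5 := hit_one gr (RootR m)
    omega
  refine path_no gr (Y := SPS d e I j c f) ?_ hi (hcount gr) (hcount gr.symm) sidx ?_ ?_
  · intro u w hu hw hR
    by_cases hwr : w = RootR m
    · exact Or.inr (Or.inr hwr)
    · rcases sps_exit hh hs hu hw hR hwr with k | k
      · exact Or.inr (Or.inl (Or.inl k))
      · exact Or.inr (Or.inl (Or.inr k))
  · rintro u w ⟨s, _, _, rfl⟩ ⟨s', _, _, rfl⟩ hR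
    exact RR_spine hR
  · rintro u w ⟨s, _, _, rfl⟩ ⟨s', _, _, rfl⟩ hE
    have : s = s' := hE
    rw [this]

/-- single vertices lie in blocks -/
theorem blk_vtx {h d m : ℕ} (hh : 1 ≤ h) {u : Raw} (hv : Valid h d m u) {e : ℕ} (hem : e ≤ m) (hl : lam u ≤ e) :
    ∃ g, InBlk h d e g u := by
  have hN := NN_eq h
  suffices hs : ∃ e0 g0, 1 ≤ e0 ∧ e0 ≤ e ∧ InBlk h d e0 g0 u by
    obtain ⟨e0, g0, h1, h2, h3, h4⟩ := hs
    obtain ⟨g, k1, k2⟩ := block_lift (h := h) (d := d) (g0 := g0) h1 h2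
    exact ⟨g, k1.trans h3, h4.trans k2⟩
  rcases valid_cases hv (ne_root (hl.trans hem)) with ⟨k, rfl, hk⟩ | ⟨e', I, q, a, h1, h2, h3, h4, h5, h6, rfl⟩ | ⟨e', I, j, c, f, s, h1, h2, h3, rfl⟩
  · refine ⟨1, k / (d + 1), le_rfl, hl, ?_, ?_⟩
    · show _ * (_ ^ 0 * _) ≤ k
      rw [pow_zero, one_mul]; exact Nat.div_mul_le_self _ _
    · show k ≤ _ * (_ ^ 0 * _)
      rw [pow_zero, one_mul]
      have := Nat.lt_div_mul_add (a := k) (b := d + 1) (by omega)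
      rw [add_mul]; omega
  · rw [lam_nd hh h4 h6] at hl
    obtain ⟨x, y, D, k1, k2, k3, k4, k5, k6, k7⟩ := nd_coord (m := m) (I := I) d hh h4 h5 h6 h1
    refine ⟨e', I, by omega, hl, ?_, ?_⟩
    · rw [k5, cc_succ h1, ← mul_assoc]
      exact Nat.mul_le_mul_right _ (by omega)
    · rw [k6, cc_succ h1, ← mul_assoc, add_mul I 1 (NN h)]
      exact Nat.mul_le_mul_right _ (by omega)
  · rw [sp_lam] at hl
    have := h1.e2
    have := h1.hj
    refine ⟨e', I, by omega, hl, ?_, ?_⟩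
    · rw [sp_lo, cc_succ h1.e2, ← mul_assoc]
      exact Nat.mul_le_mul_right _ (by omega)
    · rw [sp_hi, cc_succ h1.e2, ← mul_assoc, add_mul I 1 (NN h)]
      exact Nat.mul_le_mul_right _ (by omega)

theorem bx_dl {h d m e g : ℕ} (he : 2 ≤ e) : BX h d m e g = Dl h d m e g 0 0 := by
  have hN := NN_eq h
  unfold BX Dl Cl
  congr 1
  · unfold lA; rw [cc_succ he, ← mul_assoc]; simp
  · unfold lB; rw [cc_succ he, ← mul_assoc]; congr 1
    simp only [Nat.sub_zero, add_mul]; omega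

/-- boundary of a cell -/
def WD (h d m e I q a A B : ℕ) : Set Raw :=
  ((VV h d (e - 1) (lA h d e I A) ∪ VV h d (e - 1) (lB h d e I B)) ∪
    ({nd h m e I h A} ∪ {nd h m e I h (B - 1)})) ∪ ({nd h m e I q a} ∪ {RootR m})

theorem WD_card {h d m : ℕ} {A B : Fin 154 → Set Raw} (gr : Grid h d m A B) (hh : 1 ≤ h) {e I q a α β : ℕ}
    (he : 2 ≤ e) (hem : e ≤ m) (hI : I < NN h ^ (m - e)) (hαβ : α < β) (hβ : β ≤ 2 ^ h) :
    (hit A (WD h d m e I q a α β)).card ≤ 32 := by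
  have hN := NN_eq h
  unfold WD
  have h1 := hit_union (A := A) (S := ((VV h d (e - 1) (lA h d e I α) ∪ VV h d (e - 1) (lB h d e I β)) ∪
    ({nd h m e I h α} ∪ {nd h m e I h (β - 1)}))) (T := ({nd h m e I q a} ∪ {RootR m}))
  have h2 := hit_union (A := A) (S := (VV h d (e - 1) (lA h d e I α) ∪ VV h d (e - 1) (lB h d e I β))) (T := 
    ({nd h m e I h α} ∪ {nd h m e I h (β - 1)}))
  have h3 := hit_union (A := A) (S := VV h d (e - 1) (lA h d e I α)) (T := VV h d (e - 1) (lB h d e I β))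
  have h4 := hit_union (A := A) (S := {nd h m e I h α}) (T := {nd h m e I h (β - 1)})
  have h5 := hit_union (A := A) (S := {nd h m e I q a}) (T := {RootR m})
  have s1 := hit_one gr (nd h m e I h α)
  have s2 := hit_one gr (nd h m e I h (β - 1))
  have s3 := hit_one gr (nd h m e I q a)
  have s4 := hit_one gr (RootR m)
  have v1 := hit_VV gr hh (e := e - 1) (g := I * NN h + 2 * α) (pos := lA h d e I α) (by omega) rfl
    (gidx he hem hI (by omega)).le
  have hle : I * NN h + (2 * β - 1) ≤ NN h ^ (m - (e - 1)) := by
    have := gidx he hem hI (k := 2 * β - 2) (by omega)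
    omega
  have v2 := hit_VV gr hh (e := e - 1) (g := I * NN h + (2 * β - 1)) (pos := lB h d e I β) (by omega) rfl hle
  omega

theorem dl_exit {h d m : ℕ} (hh : 1 ≤ h) {e I q a : ℕ} (he : 2 ≤ e) (hem : e ≤ m) (hq : q ≤ h)
    (ha : a < 2 ^ q) : ∀ u w, u ∈ Dl h d m e I q a → w ∉ Dl h d m e I q a → RR h d m u w →
    u ∈ WD h d m e I q a (a * 2 ^ (h - q)) ((a + 1) * 2 ^ (h - q)) ∨
    w ∈ WD h d m e I q a (a * 2 ^ (h - q)) ((a + 1) * 2 ^ (h - q)) := by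
  intro u w hu hw hR
  by_cases hwr : w = RootR m
  · exact Or.inr (Or.inr (Or.inr hwr))
  · left
    rcases exit_dl hh he hem hq ha hu hw hR hwr with ⟨k, _⟩ | ⟨k, _⟩ | ⟨q', a', b, _, _, _, k, _⟩
    · rcases k with ⟨k1, k2, k3⟩ | k
      · exact Or.inl (Or.inl (Or.inl ⟨by omega, k2, k3⟩))
      · exact Or.inl (Or.inr (Or.inl k))
    · rcases k with ⟨k1, k2, k3⟩ | k
      · exact Or.inl (Or.inl (Or.inr ⟨by omega, k2, k3⟩))
      · exact Or.inl (Or.inr (Or.inr k))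
    · exact Or.inr (Or.inl k)

end Ghdm
namespace Ghdm

theorem cover {h d m : ℕ} (hh : 1 ≤ h) {e I q a α μ β : ℕ} (he : 2 ≤ e) (hem : e ≤ m) (hI : I < NN h ^ (m - e)) (hq : q < h)
    (ha : a < 2 ^ q) (hα : α = a * 2 ^ (h - q)) (hβ : β = (a + 1) * 2 ^ (h - q))
    (hμ : μ = (2 * a + 1) * 2 ^ (h - (q + 1))) (h1 : α < μ) (h2 : μ < β) (h3 : β ≤ 2 ^ h) {x : Raw}
    (hx : x ∈ Cl h d m e I α β) (hn : x ∉ WD h d m e I q a α β) :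
    x ∈ Cl h d m e I α μ ∨ x ∈ Cl h d m e I μ β ∨ x ∈ BX h d m (e - 1) (I * NN h + (2 * μ - 1)) ∨
    ∃ c f, SOK h m e I (μ - 1) f ∧ x ∈ SPS d e I (μ - 1) c f := by
  have hx' := hx
  obtain ⟨xv, xl, x1, x2⟩ := hx
  have hN := NN_eq h
  have hc := cc_pos h d (e - 1)
  rcases Nat.lt_or_ge (lam x) e with hl | hl
  · obtain ⟨g, g1, g2⟩ := blk_vtx hh xv (by omega : e - 1 ≤ m) (by omega)
    rcases lt_trichotomy g (I * NN h + (2 * μ - 1)) with k | k | k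
    · left
      exact ⟨xv, xl, x1, g2.trans (Nat.mul_le_mul_right _ k)⟩
    · right; right; left
      subst k
      exact ⟨xv, by omega, g1, g2⟩
    · right; left
      refine ⟨xv, xl, le_trans (Nat.mul_le_mul_right _ (by omega)) g1, x2⟩
  · rcases valid_cases xv (ne_root (xl.trans hem)) with ⟨k, rfl, hk⟩ | ⟨e', I', q', a', k1, k2, k3, k4, k5, k6, rfl⟩ | ⟨e', I', j, c, f, s, k1, k2, k3, rfl⟩
    · have : lam (.path k) = 1 := rfl
      omega
    · rw [lam_nd hh k4 k6] at hl xl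
      obtain rfl : e' = e := by omega
      rcases nd_in_cl hh he (h1.trans h2) h3 k4 k5 k6 hx' with ⟨rfl, r1, r2⟩ | ⟨rfl, rfl, rfl, r1⟩ | ⟨rfl, r0, rfl, r1⟩
      · rcases dyadic_two hq k5 (hα ▸ r1) (hβ ▸ r2) with ⟨rfl, rfl⟩ | r | r
        · exact absurd (Or.inr (Or.inl rfl)) hn
        · left
          exact nd_mem_cl hh he xv (by omega) k4 k5 k6 r1 (by omega)
        · right; left
          exact nd_mem_cl hh he xv (by omega) k4 k5 k6 (by omega) r2
      · exfalso
        apply hn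
        refine Or.inl (Or.inr (Or.inr ?_))
        show _ = _
        rw [r1, nd_first (d := d) hh he, nd_last (d := d) hh he]
      · exfalso
        apply hn
        refine Or.inl (Or.inr (Or.inl ?_))
        show _ = _
        rw [r1, nd_first (d := d) hh he, show a' = 2 ^ q' - 1 by omega, nd_last (d := d) hh he]
    · rw [sp_lam] at hl xl
      obtain rfl : e' = e := by omega
      have hj := k1.hj
      rw [sp_lo] at x1
      rw [sp_hi] at x2
      have y1 := cmp hc x1
      have y2 := cmp hc x2
      have hII : I' = I := by
        rcases lt_trichotomy I' I with k | k | k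
        · have := mulstep (N := NN h) k; omega
        · exact k
        · have := mulstep (N := NN h) k; omega
      subst hII
      rcases lt_trichotomy (j + 1) μ with k | k | k
      · left
        refine ⟨xv, by rw [sp_lam], by rw [sp_lo]; exact x1, ?_⟩
        rw [sp_hi]
        exact Nat.mul_le_mul_right _ (by omega)
      · right; right; right
        subst k
        exact ⟨c, f, k1, s, k2, k3, rfl⟩
      · right; left
        refine ⟨xv, by rw [sp_lam], ?_, by rw [sp_hi]; exact x2⟩
        rw [sp_lo]
        exact Nat.mul_le_mul_right _ (by omega)

theorem step_no {h d m : ℕ} {A B : Fin 154 → Set Raw} (gr : Grid h d m A B) (hh : 1 ≤ h) {e I q a : ℕ}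
    (he : 2 ≤ e) (hem : e ≤ m) (hI : I < NN h ^ (m - e)) (hq : q < h) (ha : a < 2 ^ q)
    (hL : ∀ i, ¬ A i ⊆ Dl h d m e I (q + 1) (2 * a)) (hR : ∀ i, ¬ A i ⊆ Dl h d m e I (q + 1) (2 * a + 1))
    (hM : ∀ g, g < NN h ^ (m - (e - 1)) → ∀ i, ¬ A i ⊆ BX h d m (e - 1) g) (i : Fin 154) :
    ¬ A i ⊆ Dl h d m e I q a := by
  intro hi
  have hN := NN_eq h
  obtain ⟨d1, d2⟩ := dl_le hq.le ha
  obtain ⟨l1, l2⟩ := dl_le (h := h) (q := q + 1) (a := 2 * a) hq (by rw [pow_succ]; omega)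
  obtain ⟨r1, r2⟩ := dl_le (h := h) (q := q + 1) (a := 2 * a + 1) hq (by rw [pow_succ]; omega)
  have eα : 2 * a * 2 ^ (h - (q + 1)) = a * 2 ^ (h - q) := by rw [child_pow hq]; ring
  have eβ : (2 * a + 1 + 1) * 2 ^ (h - (q + 1)) = (a + 1) * 2 ^ (h - q) := by rw [child_pow hq]; ring
  have xL := dl_exit (d := d) (I := I) hh he hem (show q + 1 ≤ h from hq) (show 2 * a < 2 ^ (q + 1) by rw [pow_succ]; omega)
  have xR := dl_exit (d := d) (I := I) hh he hem (show q + 1 ≤ h from hq) (show 2 * a + 1 < 2 ^ (q + 1) by rw [pow_succ]; omega)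
  have xX := dl_exit (d := d) (I := I) hh he hem hq.le ha
  have n1 := WD_card gr hh (q := q) (a := a) he hem hI d1 d2
  have n1' := WD_card gr.symm hh (q := q) (a := a) he hem hI d1 d2
  have n2 := WD_card gr hh (q := q + 1) (a := 2 * a) he hem hI l1 l2
  have n3 := WD_card gr hh (q := q + 1) (a := 2 * a + 1) he hem hI r1 r2
  have hcov := fun x => cover (d := d) (x := x) hh he hem hI hq ha rfl rfl rfl (eα ▸ l1) (eβ ▸ r1) d2
  simp only [Dl] at *
  rw [eα] at hL xL n2 l1
  rw [eβ] at hR xR n3 r1 r2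
  generalize a * 2 ^ (h - q) = α at *
  generalize (a + 1) * 2 ^ (h - q) = β at *
  generalize (2 * a + 1) * 2 ^ (h - (q + 1)) = μ at *
  set W1 := WD h d m e I q a α β
  set W2 := WD h d m e I (q + 1) (2 * a) α μ with hW2
  set W3 := WD h d m e I (q + 1) (2 * a + 1) μ β with hW3
  have n4 := hit_union (A := A) (S := W1) (T := W2 ∪ W3)
  have n5 := hit_union (A := A) (S := W2) (T := W3)
  obtain ⟨k, hk⟩ := exists_not_hit (A := A) (W := W1 ∪ (W2 ∪ W3)) (by omega)
  have hkn := not_hit hk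
  have hk1 : k ∉ hit A W1 := fun hx => by
    obtain ⟨x, x1, x2⟩ := mem_hit.1 hx
    exact hkn x x1 (Or.inl x2)
  have hkX := enclA gr xX hi (by omega) k hk1
  have hn2 : ∀ x ∈ A k, x ∉ W2 := fun x hx hw => hkn x hx (Or.inr (Or.inl hw))
  have hn3 : ∀ x ∈ A k, x ∉ W3 := fun x hx hw => hkn x hx (Or.inr (Or.inr hw))
  obtain ⟨x, xA, _⟩ := gr.hAB k k
  have n3' : RootR m ∈ W2 := Or.inr (Or.inr rfl)
  rcases hcov x (hkX xA) (fun hw => hkn x xA (Or.inl hw)) with c1 | c1 | c1 | ⟨c, f, c0, c1⟩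
  · exact hL k (stay (gr.cA k) hn2 xL xA c1)
  · exact hR k (stay (gr.cA k) hn3 xR xA c1)
  · refine hM _ (gidx he hem hI (by omega)) k (stay (W := W2 ∪ W3) (gr.cA k) ?_ ?_ xA c1)
    · rintro y hy (hw | hw)
      · exact hn2 y hy hw
      · exact hn3 y hy hw
    · intro u w hu hw hRR
      by_cases hwr : w = RootR m
      · exact Or.inr (Or.inl (hwr ▸ n3'))
      · left
        rcases box_exit hh (by omega) (by omega) hu hw hRR hwr with t | t
        · exact Or.inl (Or.inl (Or.inl (Or.inr t)))
        · rw [show I * NN h + (2 * μ - 1) + 1 = I * NN h + 2 * μ by omega] at t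
          exact Or.inr (Or.inl (Or.inl (Or.inl t)))
  · refine sps_no gr hh c0 (i := k) (c := c) (stay (W := W2 ∪ W3) (gr.cA k) ?_ ?_ xA c1)
    · rintro y hy (hw | hw)
      · exact hn2 y hy hw
      · exact hn3 y hy hw
    · intro u w hu hw hRR
      by_cases hwr : w = RootR m
      · exact Or.inr (Or.inl (hwr ▸ n3'))
      · right
        have hp1 : 2 * (μ - 1) + 1 = 2 * μ - 1 := by omega
        have hp2 : 2 * (μ - 1) + 1 + 1 = 2 * μ := by omega
        have hp3 : μ - 1 + 1 = μ := by omega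
        rcases sps_exit hh c0 hu hw hRR hwr with t | t
        · cases c
          · simp only [sleaf, Bool.not_false, Bool.toNat_true, hp3] at t
            exact Or.inr (Or.inl (Or.inr (Or.inl t)))
          · simp only [sleaf, Bool.not_true, Bool.toNat_false, add_zero] at t
            exact Or.inl (Or.inl (Or.inr (Or.inr t)))
        · cases c
          · simp only [fpos, Bool.toNat_false, add_zero, hp1] at t
            exact Or.inl (Or.inl (Or.inl (Or.inr t)))
          · simp only [fpos, Bool.toNat_true, hp2] at t
            exact Or.inr (Or.inl (Or.inl (Or.inl t)))

theorem leaf_no {h d m : ℕ} {A B : Fin 154 → Set Raw} (gr : Grid h d m A B) (hh : 1 ≤ h) {e I a : ℕ}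
    (he : 2 ≤ e) (hem : e ≤ m) (hI : I < NN h ^ (m - e)) (ha : a < 2 ^ h)
    (hM : ∀ g, g < NN h ^ (m - (e - 1)) → ∀ i, ¬ A i ⊆ BX h d m (e - 1) g) (i : Fin 154) :
    ¬ A i ⊆ Dl h d m e I h a := by
  intro hi
  have hN := NN_eq h
  obtain ⟨d1, d2⟩ := dl_le le_rfl ha
  have xX := dl_exit (d := d) (I := I) hh he hem le_rfl ha
  have n1 := WD_card gr hh (q := h) (a := a) he hem hI d1 d2
  have n1' := WD_card gr.symm hh (q := h) (a := a) he hem hI d1 d2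
  obtain ⟨k, hk⟩ := exists_not_hit (A := A) (W := WD h d m e I h a (a * 2 ^ (h - h)) ((a + 1) * 2 ^ (h - h))) (by omega)
  have hkX := enclA gr xX hi (by omega) k hk
  have hkn := not_hit hk
  refine hM (I * NN h + 2 * a) (gidx he hem hI (by omega)) k ?_
  intro x hx
  have hxX := hkX hx
  unfold Dl at hxX
  rw [Nat.sub_self, pow_zero, mul_one, mul_one] at hxX
  have hl : lam x < e := by
    rcases leaf_cell hh he hem ha hxX with t | t
    · exact t
    · exact absurd (Or.inr (Or.inl t)) (hkn x hx)
  obtain ⟨xv, xl, x1, x2⟩ := hxX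
  refine ⟨xv, by omega, x1, ?_⟩
  unfold lB at x2
  rw [show I * NN h + (2 * (a + 1) - 1) = I * NN h + 2 * a + 1 by omega] at x2
  exact x2

theorem dl_no {h d m : ℕ} {A B : Fin 154 → Set Raw} (gr : Grid h d m A B) (hh : 1 ≤ h) (k : ℕ) (hem : k + 2 ≤ m) :
    ∀ n, n ≤ h → ∀ I, I < NN h ^ (m - (k + 2)) → ∀ a, a < 2 ^ (h - n) → ∀ i, ¬ A i ⊆ Dl h d m (k + 2) I (h - n) a := by
  induction k with
  | zero =>
    have hM : ∀ g, g < NN h ^ (m - (0 + 2 - 1)) → ∀ i, ¬ A i ⊆ BX h d m (0 + 2 - 1) g :=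
      fun g hg i hi => base_no gr hh (by omega) hg hi
    intro n
    induction n with
    | zero =>
      intro _ I hI a ha i
      exact leaf_no gr hh (by omega) hem hI ha hM i
    | succ n ih =>
      intro hn I hI a ha i
      have hs : h - (n + 1) + 1 = h - n := by omega
      have hp : 2 ^ (h - n) = 2 * 2 ^ (h - (n + 1)) := by rw [← hs, pow_succ']
      refine step_no gr hh (by omega) hem hI (by omega) ha ?_ ?_ hM i
      · rw [hs]; exact ih (by omega) I hI _ (by omega)
      · rw [hs]; exact ih (by omega) I hI _ (by omega)
  | succ k ihk =>
    have hM : ∀ g, g < NN h ^ (m - (k + 1 + 2 - 1)) → ∀ i, ¬ A i ⊆ BX h d m (k + 1 + 2 - 1) g := by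
      intro g hg i
      rw [show k + 1 + 2 - 1 = k + 2 by omega] at *
      rw [bx_dl (by omega)]
      have := ihk (by omega) h le_rfl g hg 0 (by simp) i
      rwa [Nat.sub_self] at this
    intro n
    induction n with
    | zero =>
      intro _ I hI a ha i
      exact leaf_no gr hh (by omega) hem hI ha hM i
    | succ n ih =>
      intro hn I hI a ha i
      have hs : h - (n + 1) + 1 = h - n := by omega
      have hp : 2 ^ (h - n) = 2 * 2 ^ (h - (n + 1)) := by rw [← hs, pow_succ']
      refine step_no gr hh (by omega) hem hI (by omega) ha ?_ ?_ hM i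
      · rw [hs]; exact ih (by omega) I hI _ (by omega)
      · rw [hs]; exact ih (by omega) I hI _ (by omega)

theorem grid_no_pos {h d m : ℕ} {A B : Fin 154 → Set Raw} (gr : Grid h d m A B) (hh : 1 ≤ h) (hm : 2 ≤ m) : False := by
  obtain ⟨i, hi⟩ := exists_not_hit (A := A) (W := {RootR m}) (by have := hit_one gr (RootR m); omega)
  have hin := not_hit hi
  have h0 := dl_no gr hh (m - 2) (by omega) h le_rfl 0 (by have := NN_pos h; positivity) 0 (by simp) i
  rw [Nat.sub_self, show m - 2 + 2 = m by omega, ← bx_dl hm] at h0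
  apply h0
  intro x hx
  have xr : x ≠ RootR m := fun he => hin x hx he
  have xv := gr.vA i x hx
  exact ⟨xv, lam_le hh (by omega) xv xr, by simp, by have := hi_le hh xv xr; simpa using this⟩

theorem valid_zero {d m : ℕ} {u : Raw} (hv : Valid 0 d m u) (hu : u ≠ RootR m) : ∃ k, u = .path k := by
  cases u with
  | path k => exact ⟨k, rfl⟩
  | tree j i p =>
    exfalso
    obtain ⟨h1, h2, h3, h4, h5, h6, h7⟩ := hv
    have hp : p = [] := List.length_eq_zero_iff.1 (by omega)
    obtain ⟨rfl, rfl⟩ := h6 hp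
    subst hp
    exact hu rfl
  | spine j i k t e s =>
    exfalso
    obtain ⟨h1, h2, h3, h4, h5, h6, h7, h8, h9, _⟩ := hv
    simp at h6 h9
    omega

theorem grid_no_zero {d m : ℕ} {A B : Fin 154 → Set Raw} (gr : Grid 0 d m A B) : False := by
  have c1 := hit_one gr (RootR m)
  have c2 := hit_one gr.symm (RootR m)
  obtain ⟨i, hi⟩ := exists_not_hit (A := A) (W := {RootR m}) (by omega)
  have hin := not_hit hi
  refine path_no gr (Y := {u | ∃ k, u = .path k}) (W := {RootR m}) ?_ (i := i) ?_ (by omega) (by omega) (lo 0 d) ?_ ?_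
  · intro u w hu hw hR
    right
    by_contra hne
    exact hw (valid_zero hR.2.1 hne)
  · intro x hx
    exact valid_zero (gr.vA i x hx) (hin x hx)
  · rintro u w ⟨k, rfl⟩ ⟨k', rfl⟩ hR
    exact RR_path hR
  · rintro u w ⟨k, rfl⟩ ⟨k', rfl⟩ he
    exact congrArg Raw.path he

theorem grid_no {h d m : ℕ} {A B : Fin 154 → Set Raw} (gr : Grid h d m A B) (hm : 2 ≤ m) : False := by
  rcases Nat.eq_zero_or_pos h with rfl | hh
  · exact grid_no_zero gr
  · exact grid_no_pos gr hh hm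

end Ghdm
namespace Ghdm

theorem adj_RR {h d m : ℕ} {u w : Verts h d m} :
    (G h d m).Adj u w ↔ RR h d m u.1 w.1 := by
  unfold G RR
  simp only [SimpleGraph.comap_adj, SimpleGraph.fromRel_adj, Function.Embedding.subtype_apply]
  exact ⟨fun t => ⟨u.2, w.2, t⟩, fun t => t.2.2⟩

theorem walk_inv {V : Type*} {H : SimpleGraph V} {L X : Set V}
    (hc : ∀ u w, u ∈ L → w ∈ L → H.Adj u w → (u ∈ X ↔ w ∈ X)) {a b : V} (p : H.Walk a b)
    (hp : ∀ v ∈ p.support, v ∈ L) : ∀ v ∈ p.support, (a ∈ X ↔ v ∈ X) := by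
  induction p with
  | nil => intro v hv; simp at hv; rw [hv]
  | cons e q ih =>
    intro v hv
    have hp' : ∀ v ∈ q.support, v ∈ L := fun v hv => hp v (by simp [hv])
    rw [SimpleGraph.Walk.support_cons, List.mem_cons] at hv
    rcases hv with rfl | hv
    · rfl
    · rw [hc _ _ (hp _ (SimpleGraph.Walk.start_mem_support _)) (hp' _ (SimpleGraph.Walk.start_mem_support _)) e]
      exact ih hp' v hv

theorem branch_inv {V : Type*} {H : SimpleGraph V} {L X U : Set V}
    (hc : ∀ u w, u ∈ L → w ∈ L → H.Adj u w → (u ∈ X ↔ w ∈ X)) (hU : CGT.SetConn H U)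
    (hL : U ⊆ L) {a b : V} (ha : a ∈ U) (hb : b ∈ U) : a ∈ X ↔ b ∈ X := by
  obtain ⟨p⟩ := hU.preconnected ⟨a, ha⟩ ⟨b, hb⟩
  exact walk_inv (H := H.induce U) (L := Set.univ) (X := {x | x.1 ∈ X})
    (fun u w _ _ e => hc u.1 w.1 (hL u.2) (hL w.2) e) p (fun _ _ => trivial) _
    (SimpleGraph.Walk.end_mem_support p)

theorem far_of_sDist {h d m : ℕ} {P Q : Set (Verts h d m)}
    (hf : ((3 : ℕ) : ℕ∞) ≤ CGT.sDist (G h d m) P Q) {u w : Verts h d m} (hu : u ∈ P) (hw : w ∈ Q) :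
    u.1 ≠ w.1 ∧ ¬ RR h d m u.1 w.1 ∧ ∀ z, RR h d m u.1 z → RR h d m z w.1 → False := by
  have key : ∀ p : (G h d m).Walk u w, 3 ≤ p.length := by
    intro p
    have h1 : CGT.sDist (G h d m) P Q ≤ (G h d m).edist u w :=
      iInf₂_le (f := fun (u : P) (v : Q) => (G h d m).edist u.1 v.1) ⟨u, hu⟩ ⟨w, hw⟩
    have h2 := (hf.trans h1).trans (SimpleGraph.edist_le p)
    exact_mod_cast h2
  refine ⟨?_, ?_, ?_⟩
  · intro e
    obtain rfl := Subtype.ext e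
    have := key .nil
    simp at this
  · intro e
    have := key (.cons (adj_RR.2 e) .nil)
    simp at this
  · intro z e1 e2
    have := key (.cons (v := ⟨z, e1.2.1⟩) (adj_RR.2 e1) (.cons (adj_RR.2 e2) .nil))
    simp at this

section Line
variable {h d m : ℕ} (M : CGT.FatModel (G h d m) (CGT.gridGraph 154 154) 3)
  (φ : Fin 154 → Fin 154 → Fin 154 × Fin 154)

def line (i : Fin 154) : Set (Verts h d m) :=
  {v | (∃ j, v ∈ M.branch (φ i j)) ∨
    ∃ (j k : Fin 154) (e : (CGT.gridGraph 154 154).Adj (φ i j) (φ i k)), v ∈ CGT.walkSupp (M.path e)}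

variable {φ}

theorem line_conn (hφ : ∀ i j k : Fin 154, j.1 + 1 = k.1 → (CGT.gridGraph 154 154).Adj (φ i j) (φ i k))
    (i : Fin 154) : Conn (RR h d m) (Subtype.val '' line M φ i) := by
  rintro X _ _ ⟨a, ha, rfl⟩ haX ⟨b, hb, rfl⟩ hbX
  by_contra hno
  push Not at hno
  set Y : Set (Verts h d m) := Subtype.val ⁻¹' X with hY
  have hc : ∀ u w, u ∈ line M φ i → w ∈ line M φ i → (G h d m).Adj u w → (u ∈ Y ↔ w ∈ Y) := by
    have key : ∀ u w, u ∈ line M φ i → w ∈ line M φ i → (G h d m).Adj u w → u ∈ Y → w ∈ Y := by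
      intro u w hu hw e hX
      by_contra hwX
      exact hno u.1 w.1 ⟨u, hu, rfl⟩ hX ⟨w, hw, rfl⟩ hwX (adj_RR.1 e)
    exact fun u w hu hw e => ⟨key u w hu hw e, key w u hw hu e.symm⟩
  have hbr : ∀ j, M.branch (φ i j) ⊆ line M φ i := fun j v hv => Or.inl ⟨j, hv⟩
  have hpa : ∀ (j k : Fin 154) (e : (CGT.gridGraph 154 154).Adj (φ i j) (φ i k)),
      ∀ v ∈ (M.path e).support, (M.pathEnd e ∈ Y ↔ v ∈ Y) := fun j k e =>
    walk_inv hc (M.path e) (fun v hv => Or.inr ⟨j, k, e, hv⟩)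
  obtain ⟨o, ho⟩ := M.branch_nonempty (φ i 0)
  have hall : ∀ (n : ℕ) (hn : n < 154), ∀ v ∈ M.branch (φ i ⟨n, hn⟩), (o ∈ Y ↔ v ∈ Y) := by
    intro n
    induction n with
    | zero => intro hn v hv; exact branch_inv hc (M.branch_connected _) (hbr _) ho hv
    | succ n ih =>
      intro hn v hv
      have e := hφ i ⟨n, by omega⟩ ⟨n + 1, hn⟩ rfl
      rw [ih (by omega) _ (M.pathEnd_mem e), hpa _ _ e _ (SimpleGraph.Walk.end_mem_support _)]
      exact branch_inv hc (M.branch_connected _) (hbr _) (M.pathEnd_mem e.symm) hv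
  have hl : ∀ v ∈ line M φ i, (o ∈ Y ↔ v ∈ Y) := by
    rintro v (⟨j, hj⟩ | ⟨j, k, e, hv⟩)
    · exact hall j.1 j.2 v hj
    · rw [hall j.1 j.2 _ (M.pathEnd_mem e)]
      exact hpa j k e v hv
  exact hbX ((hl b hb).1 ((hl a ha).2 haX))

theorem line_far (hφ : ∀ i k j l, i ≠ k → φ i j ≠ φ k l) {i k : Fin 154} (hik : i ≠ k) :
    Far (RR h d m) (Subtype.val '' line M φ i) (Subtype.val '' line M φ k) := by
  have hpb : ∀ {i k : Fin 154}, i ≠ k → ∀ {u w : Verts h d m}, (∃ (j l : Fin 154)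
      (e : (CGT.gridGraph 154 154).Adj (φ i j) (φ i l)), u ∈ CGT.walkSupp (M.path e)) →
      (∃ j, w ∈ M.branch (φ k j)) → u.1 ≠ w.1 ∧ ¬ RR h d m u.1 w.1 ∧
        ∀ z, RR h d m u.1 z → RR h d m z w.1 → False := by
    rintro i k hik u w ⟨j, l, e, hu⟩ ⟨j', hw⟩
    exact far_of_sDist (M.fat_path_branch e _ (hφ _ _ _ _ hik.symm) (hφ _ _ _ _ hik.symm)) hu hw
  rintro _ _ ⟨u, hu, rfl⟩ ⟨w, hw, rfl⟩
  rcases hu with hu | hu <;> rcases hw with hw | hw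
  · obtain ⟨j, hj⟩ := hu
    obtain ⟨j', hj'⟩ := hw
    exact far_of_sDist (M.fat_branch (hφ _ _ _ _ hik)) hj hj'
  · obtain ⟨h1, h2, h3⟩ := hpb hik.symm hw hu
    exact ⟨h1.symm, fun e => h2 (RR_symm _ _ e), fun z a b => h3 z (RR_symm _ _ b) (RR_symm _ _ a)⟩
  · exact hpb hik hu hw
  · obtain ⟨j, l, e, hu⟩ := hu
    obtain ⟨j', l', e', hw⟩ := hw
    refine far_of_sDist (M.fat_paths e e' ?_) hu hw
    intro t
    rw [Sym2.eq_iff] at t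
    rcases t with t | t <;> exact hφ _ _ _ _ hik t.1

theorem grid_of_model : Grid h d m (fun i => Subtype.val '' line M (fun i j => (i, j)) i)
    (fun i => Subtype.val '' line M (fun i j => (j, i)) i) where
  cA := line_conn M (by
    intro i j k e
    simp only [CGT.gridGraph, SimpleGraph.fromRel_adj]
    refine ⟨?_, Or.inl (Or.inl ⟨trivial, e⟩)⟩
    intro t; rw [Prod.mk.injEq] at t; rw [t.2] at e; omega)
  cB := line_conn M (by
    intro i j k e
    simp only [CGT.gridGraph, SimpleGraph.fromRel_adj]
    refine ⟨?_, Or.inl (Or.inr ⟨trivial, e⟩)⟩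
    intro t; rw [Prod.mk.injEq] at t; rw [t.1] at e; omega)
  fA := fun i k hik => line_far M (fun _ _ _ _ hne t => hne (Prod.mk.inj t).1) hik
  fB := fun i k hik => line_far M (fun _ _ _ _ hne t => hne (Prod.mk.inj t).2) hik
  vA := by rintro i _ ⟨u, _, rfl⟩; exact u.2
  vB := by rintro i _ ⟨u, _, rfl⟩; exact u.2
  hAB := by
    intro i k
    obtain ⟨x, hx⟩ := M.branch_nonempty (i, k)
    exact ⟨x.1, ⟨x, Or.inl ⟨k, hx⟩, rfl⟩, ⟨x, Or.inl ⟨i, hx⟩, rfl⟩⟩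

end Line

end Ghdm

/-- the `(154 × 154)`-grid is not a 3-fat minor of `G_{h,d,m}`. -/
theorem statement6 (h d m : ℕ) (hm : 2 ≤ m) :
    ¬ CGT.IsFatMinor (Ghdm.G h d m) (CGT.gridGraph 154 154) 3 := by
  rintro ⟨M⟩
  exact Ghdm.grid_no (Ghdm.grid_of_model M) hm
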